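/- Let ι be a nonempty finite index set and for each i ∈ ι let p_i ≥ q_i ≥ 1 be natural numbers. Let M = ∏_{i∈ι} M_{p_i,q_i} be the product of the spaces of p_i×q_i complex matrices, let D = ∏_{i∈ι} D_{p_i,q_i} ⊆ M be the set of tuples (A_i) such that every A_i has rank less than q_i, and let W = M \ D. Set c = Σ_{i∈ι} (p_i − q_i + 1). Then the homotopy group π_{2c−1} of W (based at any point) is isomorphic to the infinite cyclic group ℤ. -/

import Mathlib

section
open Set Topology Filter

namespace PiW

/-! ### Homotopy groups: functoriality and tools -/

section Functoriality

variable {N : Type*} {X Y : Type*} [TopologicalSpace X] [TopologicalSpace Y]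

/-- Class of a loop. -/
def cls {x : X} (f : GenLoop N X x) : HomotopyGroup N X x :=
  Quotient.mk (GenLoop.Homotopic.setoid N x) f

theorem cls_surj {x : X} (a : HomotopyGroup N X x) : ∃ f : GenLoop N X x, cls f = a :=
  Quotient.exists_rep a

theorem cls_eq {x : X} {f g : GenLoop N X x} : cls f = cls g ↔ GenLoop.Homotopic f g :=
  Quotient.eq (r := GenLoop.Homotopic.setoid N x)

theorem cls_mul [DecidableEq N] [Nonempty N] {x : X} (i : N) (f g : GenLoop N X x) :
    cls f * cls g = cls (GenLoop.transAt i g f) :=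
  HomotopyGroup.mul_spec (i := i) (p := f) (q := g)

theorem cls_one [DecidableEq N] [Nonempty N] {x : X} :
    (1 : HomotopyGroup N X x) = cls GenLoop.const :=
  HomotopyGroup.one_def

theorem transAt_apply [DecidableEq N] {x : X} (i : N) (f g : GenLoop N X x) (t : N → unitInterval) :
    GenLoop.transAt i f g t = if (t i : ℝ) ≤ 1 / 2
      then f (Function.update t i <| Set.projIcc 0 1 zero_le_one (2 * t i))
      else g (Function.update t i <| Set.projIcc 0 1 zero_le_one (2 * t i - 1)) := rfl

/-- Push-forward of a loop. -/
def mapLoop (φ : C(X, Y)) {x : X} {y : Y} (h : φ x = y) (f : GenLoop N X x) : GenLoop N Y y :=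
  ⟨φ.comp f.1, fun z hz => by
    rw [ContinuousMap.comp_apply]
    exact (congrArg φ (f.2 z hz)).trans h⟩

theorem mapLoop_apply (φ : C(X, Y)) {x : X} {y : Y} (h : φ x = y) (f : GenLoop N X x) (t) :
    mapLoop φ h f t = φ (f t) := rfl

theorem mapLoop_homotopic (φ : C(X, Y)) {x : X} {y : Y} (h : φ x = y) {f g : GenLoop N X x}
    (H : GenLoop.Homotopic f g) : GenLoop.Homotopic (mapLoop φ h f) (mapLoop φ h g) :=
  H.map fun H => H.compContinuousMap φ

/-- Induced homomorphism. -/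
noncomputable def mapHom [DecidableEq N] [Nonempty N] (φ : C(X, Y)) {x : X} {y : Y} (h : φ x = y) :
    HomotopyGroup N X x →* HomotopyGroup N Y y :=
  MonoidHom.mk' (Quotient.map' (s₁ := GenLoop.Homotopic.setoid N x)
      (s₂ := GenLoop.Homotopic.setoid N y) (mapLoop φ h)
      (fun _ _ H => mapLoop_homotopic φ h H)) (by
    intro a b
    obtain ⟨f, rfl⟩ := cls_surj a
    obtain ⟨g, rfl⟩ := cls_surj b
    rw [cls_mul (Classical.arbitrary N)]
    change cls (mapLoop φ h _) = cls (mapLoop φ h f) * cls (mapLoop φ h g)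
    rw [cls_mul (Classical.arbitrary N)]
    congr 1
    ext t
    simp only [mapLoop_apply, transAt_apply]
    split_ifs <;> rfl)

theorem mapHom_cls [DecidableEq N] [Nonempty N] (φ : C(X, Y)) {x : X} {y : Y} (h : φ x = y)
    (f : GenLoop N X x) : mapHom φ h (cls f) = cls (mapLoop φ h f) := rfl

/-- Homeomorphic pointed spaces have isomorphic groups. -/
noncomputable def homeoEquiv [DecidableEq N] [Nonempty N] (φ : X ≃ₜ Y) {x : X} {y : Y} (h : φ x = y) :
    HomotopyGroup N X x ≃* HomotopyGroup N Y y :=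
  MulEquiv.mk' ⟨mapHom (N := N) (φ : C(X, Y)) h,
    mapHom (N := N) (φ.symm : C(Y, X)) (by simp [← h]), by
      intro a
      obtain ⟨f, rfl⟩ := cls_surj a
      rw [mapHom_cls, mapHom_cls]
      congr 1; ext t; simp [mapLoop_apply], by
      intro a
      obtain ⟨f, rfl⟩ := cls_surj a
      rw [mapHom_cls, mapHom_cls]
      congr 1; ext t; simp [mapLoop_apply]⟩ (fun a b => map_mul (mapHom (N := N) (φ : C(X, Y)) h) a b)

/-- Construct a loop in a subset. -/
def mkLoop {W : Set X} {b : W} (f : (N → unitInterval) → X) (hc : Continuous f)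
    (hW : ∀ t, f t ∈ W) (hb : ∀ t ∈ Cube.boundary N, f t = b) : GenLoop N W b :=
  ⟨⟨fun t => ⟨f t, hW t⟩, hc.subtype_mk hW⟩, fun t ht => Subtype.ext (hb t ht)⟩

@[simp] theorem mkLoop_apply {W : Set X} {b : W} (f : (N → unitInterval) → X) (hc : Continuous f)
    (hW : ∀ t, f t ∈ W) (hb : ∀ t ∈ Cube.boundary N, f t = b) (t) :
    (mkLoop f hc hW hb t : X) = f t := rfl

theorem loop_continuous {x : X} (f : GenLoop N X x) : Continuous (fun t => f t) := f.1.2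

theorem loop_continuous' {W : Set X} {b : W} (f : GenLoop N W b) :
    Continuous (fun t => (f t : X)) := continuous_subtype_val.comp f.1.2

theorem loop_boundary {W : Set X} {b : W} (f : GenLoop N W b) {t} (ht : t ∈ Cube.boundary N) :
    (f t : X) = b := congrArg Subtype.val (f.2 t ht)

theorem homotopic_of_family {W : Set X} {b : W} (f g : GenLoop N W b)
    (H : unitInterval × (N → unitInterval) → X) (hc : Continuous H)
    (h0 : ∀ t, H (0, t) = f t) (h1 : ∀ t, H (1, t) = g t)
    (hW : ∀ p, H p ∈ W) (hb : ∀ s, ∀ t ∈ Cube.boundary N, H (s, t) = b) :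
    GenLoop.Homotopic f g :=
  ⟨⟨⟨⟨fun p => ⟨H p, hW p⟩, hc.subtype_mk hW⟩, fun t => Subtype.ext (h0 t),
    fun t => Subtype.ext (h1 t)⟩, fun s t ht => Subtype.ext (by
      change H (s, t) = f t
      rw [hb s t ht, loop_boundary f ht])⟩⟩

theorem homotopic_family {W : Set X} {b : W} {f g : GenLoop N W b} (h : GenLoop.Homotopic f g) :
    ∃ H : unitInterval × (N → unitInterval) → X, Continuous H ∧
    (∀ t, H (0, t) = f t) ∧ (∀ t, H (1, t) = g t) ∧
    (∀ p, H p ∈ W) ∧ (∀ s, ∀ t ∈ Cube.boundary N, H (s, t) = b) := by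
  obtain ⟨H⟩ := h
  refine ⟨fun p => (H p : X), continuous_subtype_val.comp H.continuous, ?_, ?_,
    fun p => (H p).2, ?_⟩
  · intro t; exact congrArg Subtype.val (H.apply_zero t)
  · intro t; exact congrArg Subtype.val (H.apply_one t)
  · intro s t ht
    have := H.eq_fst s ht
    exact (congrArg Subtype.val this).trans (loop_boundary f ht)

theorem homotopic_line {V : Type*} [NormedAddCommGroup V] [NormedSpace ℝ V] {W : Set V} {b : W}
    (f g : GenLoop N W b)
    (hW : ∀ t, ∀ s : ℝ, 0 ≤ s → s ≤ 1 → (f t : V) + s • ((g t : V) - f t) ∈ W) :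
    GenLoop.Homotopic f g := by
  refine homotopic_of_family f g (fun p => (f p.2 : V) + (p.1 : ℝ) • ((g p.2 : V) - f p.2))
    ?_ ?_ ?_ ?_ ?_
  · have h1 := (loop_continuous' f).comp (continuous_snd (X := unitInterval))
    have h2 := (loop_continuous' g).comp (continuous_snd (X := unitInterval))
    exact h1.add ((continuous_subtype_val.comp continuous_fst).smul (h2.sub h1))
  · intro t; simp
  · intro t; simp
  · intro p; exact hW _ _ p.1.2.1 p.1.2.2
  · intro s t ht
    simp [loop_boundary f ht, loop_boundary g ht]

end Functoriality

end PiW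
end

section
open Set Topology Filter

set_option linter.unusedSectionVars false

namespace PiW

/-! ### General position -/

section GenPos

variable {V : Type*} [NormedAddCommGroup V] [NormedSpace ℝ V] [FiniteDimensional ℝ V]

/-- Contained in a finite union of `C¹` images of `ℝ^d`. -/
def Thin (S : Set V) (d : ℕ) : Prop :=
  ∃ (m : ℕ) (g : Fin m → (Fin d → ℝ) → V), (∀ k, ContDiff ℝ 1 (g k)) ∧ S ⊆ ⋃ k, range (g k)

theorem thin_of {K E : Type*} [Fintype K] [NormedAddCommGroup E] [NormedSpace ℝ E]
    [FiniteDimensional ℝ E] {S : Set V} {d : ℕ} (hd : Module.finrank ℝ E = d)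
    (g : K → E → V) (hg : ∀ k, ContDiff ℝ 1 (g k)) (hS : S ⊆ ⋃ k, range (g k)) : Thin S d := by
  have e : E ≃L[ℝ] (Fin d → ℝ) := ContinuousLinearEquiv.ofFinrankEq (by simp [hd])
  have k0 := Fintype.equivFin K
  refine ⟨Fintype.card K, fun k x => g (k0.symm k) (e.symm x), fun k =>
    (hg _).comp e.symm.contDiff, fun x hx => ?_⟩
  obtain ⟨k, y, hy⟩ := mem_iUnion.1 (hS hx)
  exact mem_iUnion.2 ⟨k0 k, e y, by simp [hy]⟩

theorem dimH_iUnion_range_le {K E : Type*} [Countable K] [NormedAddCommGroup E] [NormedSpace ℝ E]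
    [FiniteDimensional ℝ E] (g : K → E → V) (hg : ∀ k, ContDiff ℝ 1 (g k)) :
    dimH (⋃ k, range (g k)) ≤ Module.finrank ℝ E := by
  rw [dimH_iUnion]
  exact iSup_le fun k => (hg k).dimH_range_le

theorem exists_small_notMem {S : Set V} {d : ℕ} (hS : dimH S ≤ d) (hd : d < Module.finrank ℝ V)
    {ε : ℝ} (hε : 0 < ε) : ∃ v, ‖v‖ < ε ∧ v ∉ S := by
  have : Dense Sᶜ := dense_compl_of_dimH_lt_finrank (hS.trans_lt (by exact_mod_cast hd))
  obtain ⟨v, hv, h⟩ := this.exists_dist_lt 0 hε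
  exact ⟨v, by simpa [dist_eq_norm] using h, hv⟩

/-- Smooth approximation on the cube. -/
theorem exists_smooth_approx {N : Type*} [Fintype N] (f : (N → unitInterval) → V)
    (hf : Continuous f) {ε : ℝ} (hε : 0 < ε) :
    ∃ P : (N → ℝ) → V, ContDiff ℝ ((⊤ : ℕ∞) : WithTop ℕ∞) P ∧
      ∀ y : N → unitInterval, ‖P (fun i => y i) - f y‖ < ε := by
  have hF : Continuous (fun y : N → ℝ => f (fun i => projIcc 0 1 zero_le_one (y i))) := by
    refine hf.comp (continuous_pi fun i => ?_)
    exact continuous_projIcc.comp (continuous_apply i)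
  obtain ⟨g, hg, hg', -⟩ := hF.exists_contDiff_approx (⊤ : ℕ∞) (ε := fun _ => ε)
    continuous_const (fun _ => hε)
  refine ⟨g, hg, fun y => ?_⟩
  have := hg' (fun i => y i)
  simpa [dist_eq_norm] using this

/-- Clamp to `[0,1]`. -/
noncomputable def cl (x : ℝ) : ℝ := max 0 (min 1 x)

theorem cl_continuous : Continuous cl := by unfold cl; fun_prop
theorem cl_nonneg (x) : 0 ≤ cl x := le_max_left _ _
theorem cl_le_one (x) : cl x ≤ 1 := by unfold cl; simp
theorem cl_of_le {x : ℝ} (h : x ≤ 0) : cl x = 0 := by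
  unfold cl; exact max_eq_left ((min_le_right _ _).trans h)
theorem cl_of_ge {x : ℝ} (h : 1 ≤ x) : cl x = 1 := by
  unfold cl; rw [min_eq_left h]; simp
theorem cl_of_mem {x : ℝ} (h0 : 0 ≤ x) (h : x ≤ 1) : cl x = x := by
  unfold cl; rw [min_eq_right h]; simp [h0]
theorem cl_abs_le {x : ℝ} : |cl x| ≤ 1 := by
  rw [abs_of_nonneg (cl_nonneg x)]; exact cl_le_one x

theorem norm_smul_lt {χ η : ℝ} {u : V} (h0 : 0 ≤ χ) (h1 : χ ≤ 1) (hu : ‖u‖ < η) :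
    ‖χ • u‖ < η := by
  rw [norm_smul, Real.norm_of_nonneg h0]
  nlinarith [norm_nonneg u]

theorem general_position {n d : ℕ} {Z : Set V} (hZc : IsClosed Z) (hZ : Thin Z d)
    (hd : n + d < Module.finrank ℝ V) (G : (Fin n → unitInterval) → V) (hG : Continuous G)
    {C : Set (Fin n → unitInterval)} (hC : IsClosed C) (hCZ : ∀ y ∈ C, G y ∉ Z) :
    ∃ G' : (Fin n → unitInterval) → V, Continuous G' ∧ (∀ y ∈ C, G' y = G y) ∧
      ∀ y, G' y ∉ Z := by
  rcases Z.eq_empty_or_nonempty with rfl | hne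
  · exact ⟨G, hG, fun _ _ => rfl, fun _ => notMem_empty _⟩
  have hdc : Continuous (fun y => Metric.infDist (G y) Z) :=
    (Metric.continuous_infDist_pt Z).comp hG
  obtain ⟨η, hη, hηC⟩ : ∃ η > 0, ∀ y ∈ C, 2 * η ≤ Metric.infDist (G y) Z := by
    rcases C.eq_empty_or_nonempty with rfl | hCne
    · exact ⟨1, one_pos, by simp⟩
    obtain ⟨y0, hy0, hmin⟩ := hC.isCompact.exists_isMinOn hCne hdc.continuousOn
    refine ⟨Metric.infDist (G y0) Z / 2, ?_, fun y hy => ?_⟩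
    · have := (hZc.notMem_iff_infDist_pos hne).1 (hCZ y0 hy0)
      positivity
    · have := hmin hy
      simp only [mem_ofPred_eq] at this
      linarith
  obtain ⟨P, hP, hPG⟩ := exists_smooth_approx G hG (half_pos hη)
  obtain ⟨m, g, hg, hZg⟩ := hZ
  have hP1 : ContDiff ℝ 1 P := hP.of_le (by exact_mod_cast le_top)
  obtain ⟨v, hv, hvS⟩ := exists_small_notMem (V := V) (d := n + d)
    (S := ⋃ k, range (fun p : (Fin n → ℝ) × (Fin d → ℝ) => g k p.2 - P p.1)) (by
      refine (dimH_iUnion_range_le _ fun k => ?_).trans ?_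
      · have := hg k
        fun_prop
      · simp) hd (half_pos hη)
  set χ : (Fin n → unitInterval) → ℝ := fun y => cl (2 - Metric.infDist (G y) Z / η) with hχ
  have hχc : Continuous χ := cl_continuous.comp (continuous_const.sub (hdc.div_const η))
  have hPc : Continuous (fun y : Fin n → unitInterval => P (fun i => y i)) :=
    hP.continuous.comp (by fun_prop)
  refine ⟨fun y => G y + χ y • (P (fun i => y i) + v - G y), by fun_prop, ?_, ?_⟩
  · intro y hy
    have : χ y = 0 := cl_of_le (by
      have := hηC y hy
      rw [sub_nonpos, le_div_iff₀ hη]; exact this)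
    simp [this]
  · intro y hyZ
    have hb : ‖P (fun i => y i) + v - G y‖ < η := by
      have h1 := hPG y
      calc ‖P (fun i => y i) + v - G y‖ = ‖(P (fun i => y i) - G y) + v‖ := by congr 1; abel
        _ ≤ _ := norm_add_le _ _
        _ < η := by linarith
    rcases le_or_gt (Metric.infDist (G y) Z) η with h | h
    · have h1 : χ y = 1 := cl_of_ge (by
        have : Metric.infDist (G y) Z / η ≤ 1 := by rwa [div_le_one hη]
        linarith)
      simp only [h1, one_smul, add_sub_cancel] at hyZ
      obtain ⟨k, e, he⟩ := mem_iUnion.1 (hZg hyZ)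
      exact hvS (mem_iUnion.2 ⟨k, (fun i => y i, e), by simp [he]⟩)
    · have h1 : Metric.infDist (G y) Z ≤ _ := Metric.infDist_le_dist_of_mem hyZ
      have h2 := norm_smul_lt (cl_nonneg (2 - Metric.infDist (G y) Z / η)) (cl_le_one _) hb
      rw [dist_eq_norm, sub_add_cancel_left, norm_neg] at h1
      linarith

/-- projection along the compact interval is closed -/
theorem isClosed_exists_seg {Y : Type*} [TopologicalSpace Y] {D : Set V} (hD : IsClosed D)
    (a b : Y → V) (ha : Continuous a) (hb : Continuous b) :
    IsClosed {y | ∃ s : unitInterval, a y + (s : ℝ) • (b y - a y) ∈ D} := by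
  have h : IsClosed {p : Y × unitInterval | a p.1 + (p.2 : ℝ) • (b p.1 - a p.1) ∈ D} :=
    hD.preimage (by fun_prop)
  have := isClosedMap_fst_of_compactSpace (X := Y) (Y := unitInterval) _ h
  convert! this using 1
  ext y
  simp

theorem exists_urysohn {Y : Type*} [TopologicalSpace Y] [NormalSpace Y] {A B : Set Y}
    (hA : IsClosed A) (hB : IsClosed B) (h : Disjoint A B) :
    ∃ θ : Y → ℝ, Continuous θ ∧ (∀ y ∈ A, θ y = 0) ∧ (∀ y ∈ B, θ y = 1) ∧
      ∀ y, 0 ≤ θ y ∧ θ y ≤ 1 := by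
  obtain ⟨f, h0, h1, h2⟩ := exists_continuous_zero_one_of_isClosed hA hB h
  exact ⟨f, f.continuous, h0, h1, fun y => ⟨(h2 y).1, (h2 y).2⟩⟩

/-- The double-point lemma: a loop avoiding `D` can be moved off `Z`. -/
theorem move_off {n d1 d2 d3 : ℕ} {D Z : Set V} (hDc : IsClosed D) (hZc : IsClosed Z)
    (hD : Thin D d1) (hZ : Thin Z d2) (hDZ : Thin (D ∩ Z) d3)
    (hd : n + 2 + d1 + d2 < 2 * Module.finrank ℝ V) (hd3 : n + 1 + d3 < Module.finrank ℝ V)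
    (b : (Dᶜ : Set V)) (hbZ : (b : V) ∉ Z) (f : GenLoop (Fin n) (Dᶜ : Set V) b) :
    ∃ g : GenLoop (Fin n) (Dᶜ : Set V) b, GenLoop.Homotopic f g ∧ ∀ t, (g t : V) ∉ Z := by
  obtain ⟨b, hbD⟩ := b
  simp only at hbZ
  obtain ⟨ρ', hρ', hball'⟩ := Metric.isOpen_iff.1 (hDc.union hZc).isOpen_compl b
    (by simp only [mem_compl_iff, mem_union, not_or]; exact ⟨hbD, hbZ⟩)
  obtain ⟨ρ, hρ, hball⟩ : ∃ ρ > 0, ∀ x : V, ‖x - b‖ < 4 * ρ → x ∉ D ∧ x ∉ Z := by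
    refine ⟨ρ' / 4, by positivity, fun x hx => ?_⟩
    have := hball' (show x ∈ Metric.ball b ρ' by
      rw [Metric.mem_ball, dist_eq_norm]; linarith)
    simpa [not_or] using this
  have hfc := loop_continuous' f
  obtain ⟨δ, hδ, hfδ⟩ : ∃ δ > 0, ∀ t, ∀ x : V, ‖x - f t‖ < δ → x ∉ D := by
    have hcomp : IsCompact (range fun t => (f t : V)) := isCompact_range hfc
    obtain ⟨δ, hδ, h⟩ := hcomp.exists_thickening_subset_open hDc.isOpen_compl
      (by rintro _ ⟨t, rfl⟩; exact (f t).2)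
    refine ⟨δ, hδ, fun t x hx => h ?_⟩
    rw [Metric.mem_thickening_iff]
    exact ⟨_, ⟨t, rfl⟩, by simpa [dist_eq_norm] using hx⟩
  set κ := min ρ δ with hκ
  have hκ0 : 0 < κ := lt_min hρ hδ
  obtain ⟨P, hP, hPf⟩ := exists_smooth_approx _ hfc (half_pos hκ0)
  have hP1 : ContDiff ℝ 1 P := hP.of_le (by exact_mod_cast le_top)
  obtain ⟨m1, g1, hg1, hD⟩ := hD
  obtain ⟨m2, g2, hg2, hZ⟩ := hZ
  obtain ⟨m3, g3, hg3, hDZ⟩ := hDZ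
  set S1 : Set (V × V) := ⋃ k : Fin m1 × Fin m2,
    range (fun p : (Fin d1 → ℝ) × (Fin d2 → ℝ) × ℝ × ℝ × (Fin n → ℝ) =>
      ((g1 k.1 p.1 + p.2.2.1 • (g2 k.2 p.2.1 - g1 k.1 p.1) - P p.2.2.2.2,
        g1 k.1 p.1 + p.2.2.2.1 • (g2 k.2 p.2.1 - g1 k.1 p.1) - b) : V × V)) with hS1
  set S2 : Set (V × V) := ⋃ k : Fin m3,
    range (fun p : (Fin d3 → ℝ) × V × ℝ × (Fin n → ℝ) =>
      ((p.2.2.1 • g3 k p.1 + (1 - p.2.2.1) • (b + p.2.1) - P p.2.2.2, p.2.1) : V × V)) with hS2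
  have hVV : Module.finrank ℝ (V × V) = 2 * Module.finrank ℝ V := by
    rw [Module.finrank_prod]; ring
  obtain ⟨⟨v, w⟩, hvw, hvwS⟩ := exists_small_notMem (V := V × V)
    (d := 2 * Module.finrank ℝ V - 1) (S := S1 ∪ S2) (by
      rw [dimH_union]
      refine max_le ?_ ?_
      · refine (dimH_iUnion_range_le _ fun k => ?_).trans ?_
        · have := hg1 k.1
          have := hg2 k.2
          fun_prop
        · simp only [Module.finrank_prod, Module.finrank_self, Module.finrank_fin_fun]
          norm_cast; omega
      · refine (dimH_iUnion_range_le _ fun k => ?_).trans ?_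
        · have := hg3 k
          fun_prop
        · simp only [Module.finrank_prod, Module.finrank_self, Module.finrank_fin_fun]
          norm_cast; omega) (by rw [hVV]; omega) (half_pos hκ0)
  have hv : ‖v‖ < κ / 2 := (le_max_left _ _).trans_lt hvw
  have hw : ‖w‖ < ρ := by
    have h1 : ‖w‖ < κ / 2 := (le_max_right _ _).trans_lt hvw
    have : κ ≤ ρ := min_le_left _ _
    linarith
  set χ : (Fin n → unitInterval) → ℝ := fun y => cl (‖(f y : V) - b‖ / ρ - 1) with hχ
  have hχc : Continuous χ :=
    cl_continuous.comp (((hfc.sub continuous_const).norm.div_const ρ).sub continuous_const)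
  have hχ0 : ∀ y, 0 ≤ χ y := fun y => cl_nonneg _
  have hχ1 : ∀ y, χ y ≤ 1 := fun y => cl_le_one _
  have hχb : ∀ y ∈ Cube.boundary (Fin n), χ y = 0 := fun y hy => by
    refine cl_of_le ?_
    simp [loop_boundary f hy]
  have hPc : Continuous (fun y : Fin n → unitInterval => P (fun i => y i)) :=
    hP.continuous.comp (by fun_prop)
  set f' : (Fin n → unitInterval) → V :=
    fun y => (f y : V) + χ y • (P (fun i => y i) + v - f y) with hf'
  set b' : (Fin n → unitInterval) → V := fun y => b + χ y • w with hb'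
  have hf'c : Continuous f' := by fun_prop
  have hb'c : Continuous b' := by fun_prop
  have hPv : ∀ y : Fin n → unitInterval, ‖P (fun i => y i) + v - f y‖ < κ := fun y => by
    have h1 := hPf y
    calc ‖P (fun i => y i) + v - f y‖ = ‖(P (fun i => y i) - f y) + v‖ := by congr 1; abel
      _ ≤ _ := norm_add_le _ _
      _ < κ := by linarith
  have hf'b : ∀ y ∈ Cube.boundary (Fin n), f' y = b := fun y hy => by
    simp only [hf', hχb y hy, zero_smul, add_zero]; exact loop_boundary f hy
  have hb'b : ∀ y ∈ Cube.boundary (Fin n), b' y = b := fun y hy => by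
    simp [hb', hχb y hy]
  have hb'n : ∀ y, ‖b' y - b‖ < ρ := fun y => by
    simpa [hb'] using norm_smul_lt (hχ0 y) (hχ1 y) hw
  have hf'D : ∀ y, f' y ∉ D := fun y => hfδ y _ (by
    simpa [hf'] using (norm_smul_lt (hχ0 y) (hχ1 y) (hPv y)).trans_le (min_le_right _ _))
  -- the first homotopy
  let F' : GenLoop (Fin n) (Dᶜ : Set V) ⟨b, hbD⟩ := mkLoop f' hf'c hf'D hf'b
  have H1 : GenLoop.Homotopic f F' := by
    refine homotopic_line f F' fun t s hs0 hs1 => hfδ t _ ?_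
    have : ((F' t : V) - f t) = χ t • (P (fun i => t i) + v - f t) := by
      simp [F', hf']
    rw [this, add_sub_cancel_left]
    exact norm_smul_lt hs0 hs1 ((norm_smul_lt (hχ0 t) (hχ1 t) (hPv t)).trans_le (min_le_right _ _))
  have key : ∀ y, ∀ s t : unitInterval, f' y + (s : ℝ) • (b' y - f' y) ∈ D →
      f' y + (t : ℝ) • (b' y - f' y) ∈ Z → False := by
    intro y s t hs ht
    rcases lt_or_ge ‖(f y : V) - b‖ (2 * ρ) with h | h
    · refine (hball (f' y + (s : ℝ) • (b' y - f' y)) ?_).1 hs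
      have e1 : f' y + (s : ℝ) • (b' y - f' y) - b
          = (1 - (s : ℝ)) • (f' y - b) + (s : ℝ) • (b' y - b) := by module
      have e2 : ‖f' y - b‖ < 4 * ρ := by
        have : f' y - b = (f y - b) + χ y • (P (fun i => y i) + v - f y) := by
          simp only [hf']; abel
        rw [this]
        have h3 := norm_smul_lt (hχ0 y) (hχ1 y) (hPv y)
        have h4 : κ ≤ ρ := min_le_left _ _
        exact (norm_add_le _ _).trans_lt (by linarith)
      have e3 : ‖b' y - b‖ < 4 * ρ := (hb'n y).trans (by linarith)
      have := (convex_ball (0 : V) (4 * ρ)) (x := f' y - b) (by simpa using e2)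
        (y := b' y - b) (by simpa using e3) (a := 1 - (s : ℝ)) (b := (s : ℝ))
        (by linarith [s.2.2]) s.2.1 (by ring)
      rw [e1]; simpa using this
    have hc1 : χ y = 1 := cl_of_ge (by
      have : 2 ≤ ‖(f y : V) - b‖ / ρ := by rw [le_div_iff₀ hρ]; exact h
      linarith)
    have ef : f' y = P (fun i => y i) + v := by simp [hf', hc1]
    have eb : b' y = b + w := by simp [hb', hc1]
    have ev : v = f' y - P (fun i => y i) := by rw [ef]; abel
    have ew : w = b' y - b := by rw [eb]; abel
    have hB := (hball (b' y) ((hb'n y).trans (by linarith))).1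
    by_cases hst : s = t
    · subst hst
      by_cases hs1 : (s : ℝ) = 1
      · apply hB; simpa [hs1] using hs
      obtain ⟨k, e, he⟩ := mem_iUnion.1 (hDZ ⟨hs, ht⟩)
      apply hvwS
      right
      have h1s : (1 - (s : ℝ)) ≠ 0 := fun h => hs1 (by linarith)
      refine mem_iUnion.2 ⟨k, (e, w, (1 - (s : ℝ))⁻¹, fun i => y i), ?_⟩
      refine Prod.ext ?_ rfl
      simp only
      rw [he, ev, ← eb]
      have e5 : f' y + (s : ℝ) • (b' y - f' y) = (1 - (s : ℝ)) • f' y + (s : ℝ) • b' y := by module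
      have e6 : (1 - (1 - (s : ℝ))⁻¹) = - ((1 - (s : ℝ))⁻¹ * s) := by field_simp; ring
      rw [e5, e6, smul_add, smul_smul, smul_smul, inv_mul_cancel₀ h1s]
      module
    · obtain ⟨k1, x1, h1⟩ := mem_iUnion.1 (hD hs)
      obtain ⟨k2, x2, h2⟩ := mem_iUnion.1 (hZ ht)
      have hts : ((t : ℝ) - s) ≠ 0 := fun h => hst (Subtype.ext (by linarith))
      apply hvwS
      left
      refine mem_iUnion.2 ⟨(k1, k2), (x1, x2, -(s : ℝ) / (t - s), (1 - (s : ℝ)) / (t - s),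
        fun i => y i), ?_⟩
      have e7 : (f' y + (t : ℝ) • (b' y - f' y)) - (f' y + (s : ℝ) • (b' y - f' y))
        = ((t : ℝ) - s) • (b' y - f' y) := by module
      refine Prod.ext ?_ ?_
      · simp only
        rw [h1, h2, e7, smul_smul, div_mul_cancel₀ _ hts, ev]; module
      · simp only
        rw [h1, h2, e7, smul_smul, div_mul_cancel₀ _ hts, ew]; module
  obtain ⟨θ, hθc, hθ0, hθ1, hθ⟩ := exists_urysohn (isClosed_exists_seg hDc f' b' hf'c hb'c)
    (isClosed_exists_seg hZc f' b' hf'c hb'c)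
    (Set.disjoint_left.2 fun y ⟨s, hs⟩ ⟨t, ht⟩ => key y s t hs ht)
  have hDr : ∀ y, ∀ r : ℝ, 0 ≤ r → r ≤ 1 → f' y + (r * θ y) • (b' y - f' y) ∉ D := by
    intro y r hr0 hr1 hD'
    have h0 : θ y = 0 := hθ0 y ⟨⟨r * θ y, mul_nonneg hr0 (hθ y).1,
      mul_le_one₀ hr1 (hθ y).1 (hθ y).2⟩, hD'⟩
    rw [h0] at hD'
    exact hf'D y (by simpa using hD')
  let g : GenLoop (Fin n) (Dᶜ : Set V) ⟨b, hbD⟩ := mkLoop (fun y => f' y + θ y • (b' y - f' y))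
    (by fun_prop) (fun y => by simpa using hDr y 1 zero_le_one le_rfl)
    (fun y hy => by simp [hf'b y hy, hb'b y hy])
  refine ⟨g, H1.trans (homotopic_line F' g fun t s hs0 hs1 => ?_), fun t ht => ?_⟩
  · have := hDr t s hs0 hs1
    simpa [F', g, smul_smul] using this
  · have ht' : f' t + θ t • (b' t - f' t) ∈ Z := ht
    have h1 : θ t = 1 := hθ1 t ⟨⟨θ t, hθ t⟩, ht'⟩
    rw [h1] at ht'
    exact (hball (b' t) ((hb'n t).trans (by linarith))).2 (by simpa using ht')

end GenPos

end PiW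
end

section
open Set Topology Filter
set_option linter.unusedSectionVars false

namespace PiW

/-! ### Suspension -/

section Susp

variable {E : Type*} [NormedAddCommGroup E] [NormedSpace ℝ E]

/-- The signed height parameter. -/
def ta {m : ℕ} (y : Fin (m + 1) → unitInterval) : ℝ := 2 * (y 0 : ℝ) - 1

theorem ta_continuous {m : ℕ} : Continuous (ta (m := m)) := by unfold ta; fun_prop

theorem ta_le_one {m : ℕ} (y : Fin (m + 1) → unitInterval) : |ta y| ≤ 1 := by
  have h1 := (y 0).2.1
  have h2 := (y 0).2.2
  unfold ta; rw [abs_le]; constructor <;> linarith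

/-- A bump vanishing exactly on the boundary. -/
noncomputable def be {m : ℕ} (x : Fin m → unitInterval) : ℝ := ∏ i, ((x i : ℝ) * (1 - x i))

theorem be_continuous {m : ℕ} : Continuous (be (m := m)) := by unfold be; fun_prop

theorem be_nonneg {m : ℕ} (x : Fin m → unitInterval) : 0 ≤ be x :=
  Finset.prod_nonneg fun i _ => mul_nonneg (x i).2.1 (by linarith [(x i).2.2])

theorem be_eq_zero {m : ℕ} {x : Fin m → unitInterval} : be x = 0 ↔ x ∈ Cube.boundary (Fin m) := by
  unfold be Cube.boundary
  simp only [Finset.prod_eq_zero_iff, Finset.mem_univ, true_and, mul_eq_zero, mem_ofPred_eq]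
  refine exists_congr fun i => or_congr ?_ ?_
  · exact ⟨fun h => Subtype.ext h, fun h => by rw [h]; rfl⟩
  · rw [sub_eq_zero]; exact ⟨fun h => Subtype.ext h.symm, fun h => by rw [h]; rfl⟩

theorem boundary_cons {m : ℕ} {y : Fin (m + 1) → unitInterval} :
    y ∈ Cube.boundary (Fin (m + 1)) ↔ |ta y| = 1 ∨ Fin.tail y ∈ Cube.boundary (Fin m) := by
  unfold Cube.boundary
  simp only [mem_ofPred_eq]
  rw [Fin.exists_fin_succ]
  refine or_congr ?_ Iff.rfl
  unfold ta
  constructor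
  · rintro (h | h) <;> simp [h]; norm_num
  · intro h
    rcases eq_or_eq_neg_of_abs_eq h with h | h
    · right; apply Subtype.ext; push_cast; linarith
    · left; apply Subtype.ext; push_cast; linarith

/-- The suspension formula. -/
noncomputable def susp {m : ℕ} (b e : E) (y : Fin (m + 1) → unitInterval) : E × ℝ :=
  ((1 - |ta y|) • e + |ta y| • b, ta y * ((1 - |ta y|) * be (Fin.tail y)))

theorem susp_boundary {m : ℕ} {b e : E} {y : Fin (m + 1) → unitInterval}
    (hy : y ∈ Cube.boundary (Fin (m + 1))) (he : Fin.tail y ∈ Cube.boundary (Fin m) → e = b) :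
    susp b e y = (b, 0) := by
  rcases boundary_cons.1 hy with h | h
  · simp [susp, h]
  · simp only [susp, he h, be_eq_zero.2 h, mul_zero]
    congr 1; module

theorem susp_pos {m : ℕ} {b e : E} (hb : b ≠ 0) (he0 : e ≠ 0) {y : Fin (m + 1) → unitInterval}
    (he : Fin.tail y ∈ Cube.boundary (Fin m) → e = b) (h0 : (susp b e y).1 = 0) :
    ta y ≠ 0 ∧ 0 < (1 - |ta y|) * be (Fin.tail y) := by
  simp only [susp] at h0
  have h1 : ta y ≠ 0 := fun h => he0 (by simpa [h] using h0)
  refine ⟨h1, ?_⟩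
  have h2 : |ta y| ≠ 1 := fun h => hb (by simpa [h] using h0)
  have h3 : be (Fin.tail y) ≠ 0 := fun h => by
    rw [he (be_eq_zero.1 h)] at h0
    apply hb; rw [← h0]; module
  have h4 := ta_le_one y
  have h5 : |ta y| < 1 := lt_of_le_of_ne h4 h2
  have := be_nonneg (Fin.tail y)
  have h6 : 0 < be (Fin.tail y) := lt_of_le_of_ne this (Ne.symm h3)
  have h7 : 0 < 1 - |ta y| := by linarith
  positivity

theorem susp_ne {m : ℕ} {b e : E} (hb : b ≠ 0) (he0 : e ≠ 0) {y : Fin (m + 1) → unitInterval}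
    (he : Fin.tail y ∈ Cube.boundary (Fin m) → e = b) : susp b e y ≠ 0 := by
  intro h
  obtain ⟨h1, h2⟩ := susp_pos hb he0 he (congrArg Prod.fst h)
  have h3 : ta y * ((1 - |ta y|) * be (Fin.tail y)) = 0 := congrArg Prod.snd h
  exact (mul_ne_zero h1 h2.ne') h3

variable {m : ℕ} {b : ({0}ᶜ : Set E)}

/-- base point in `E × ℝ` -/
def bp (b : ({0}ᶜ : Set E)) : ({0}ᶜ : Set (E × ℝ)) :=
  ⟨((b : E), 0), fun h => b.2 (congrArg Prod.fst h)⟩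

theorem loop_ne (g : GenLoop (Fin m) ({0}ᶜ : Set E) b) (t) : (g t : E) ≠ 0 := (g t).2

/-- Suspension of a loop. -/
noncomputable def suspLoop (g : GenLoop (Fin m) ({0}ᶜ : Set E) b) :
    GenLoop (Fin (m + 1)) ({0}ᶜ : Set (E × ℝ)) (bp b) :=
  mkLoop (fun y => susp (b : E) (g (Fin.tail y)) y)
    (by
      have h1 := loop_continuous' g
      have h2 := ta_continuous (m := m)
      have h3 := be_continuous (m := m)
      have h4 : Continuous (fun y : Fin (m + 1) → unitInterval => Fin.tail y) := by
        unfold Fin.tail; fun_prop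
      have h5 := h1.comp h4
      have h6 := h3.comp h4
      simp only [Function.comp_def] at h5 h6
      unfold susp
      fun_prop)
    (fun y => susp_ne b.2 (loop_ne g _) (fun h => loop_boundary g h))
    (fun y hy => susp_boundary hy (fun h => loop_boundary g h))

theorem suspLoop_homotopic {g g' : GenLoop (Fin m) ({0}ᶜ : Set E) b} (h : GenLoop.Homotopic g g') :
    GenLoop.Homotopic (suspLoop g) (suspLoop g') := by
  obtain ⟨H, hc, h0, h1, hW, hb⟩ := homotopic_family h
  refine homotopic_of_family _ _ (fun p => susp (b : E) (H (p.1, Fin.tail p.2)) p.2) ?_ ?_ ?_ ?_ ?_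
  · have h2 := ta_continuous (m := m)
    have h3 := be_continuous (m := m)
    have h4 : Continuous (fun y : Fin (m + 1) → unitInterval => Fin.tail y) := by
      unfold Fin.tail; fun_prop
    unfold susp
    fun_prop
  · intro t; simp only [h0]; rfl
  · intro t; simp only [h1]; rfl
  · intro p
    exact susp_ne b.2 (hW _) (fun h => hb _ _ h)
  · intro s t ht
    exact susp_boundary ht (fun h => hb _ _ h)

/-- `f` is vertically separated with equator `g`. -/
structure Sep (f : GenLoop (Fin (m + 1)) ({0}ᶜ : Set (E × ℝ)) (bp b))
    (g : GenLoop (Fin m) ({0}ᶜ : Set E) b) : Prop where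
  pos : ∀ y, 0 ≤ ta y → (f y : E × ℝ).1 = 0 → 0 < (f y : E × ℝ).2
  neg : ∀ y, ta y ≤ 0 → (f y : E × ℝ).1 = 0 → (f y : E × ℝ).2 < 0
  mid : ∀ y, ta y = 0 → (f y : E × ℝ).1 = g (Fin.tail y)

theorem sep_susp (g : GenLoop (Fin m) ({0}ᶜ : Set E) b) : Sep (suspLoop g) g where
  pos y hy h := by
    obtain ⟨h1, h2⟩ := susp_pos b.2 (loop_ne g _) (fun h => loop_boundary g h) h
    exact mul_pos (lt_of_le_of_ne hy (Ne.symm h1)) h2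
  neg y hy h := by
    obtain ⟨h1, h2⟩ := susp_pos b.2 (loop_ne g _) (fun h => loop_boundary g h) h
    exact mul_neg_of_neg_of_pos (lt_of_le_of_ne hy h1) h2
  mid y hy := by
    change (susp (b : E) (g (Fin.tail y)) y).1 = _
    simp [susp, hy]

theorem exists_delta {Y : Type*} [TopologicalSpace Y] [CompactSpace Y] (a : Y → E) (h : Y → ℝ)
    (ha : Continuous a) (hh : Continuous h) {K : Set Y} (hK : IsClosed K)
    (H : ∀ y ∈ K, a y = 0 → 0 < h y) : ∃ δ > 0, ∀ y ∈ K, ‖a y‖ < δ → 0 < h y := by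
  have hC : IsClosed (K ∩ {y | h y ≤ 0}) := hK.inter (isClosed_le hh continuous_const)
  rcases (K ∩ {y | h y ≤ 0}).eq_empty_or_nonempty with he | hne
  · refine ⟨1, one_pos, fun y hy _ => ?_⟩
    by_contra hcon
    have : y ∈ K ∩ {y | h y ≤ 0} := ⟨hy, not_lt.1 hcon⟩
    rw [he] at this; exact this
  obtain ⟨y0, hy0, hmin⟩ := hC.isCompact.exists_isMinOn hne ha.norm.continuousOn
  refine ⟨‖a y0‖, norm_pos_iff.2 fun h0 => ?_, fun y hy hlt => ?_⟩
  · exact absurd (H y0 hy0.1 h0) (not_lt.2 hy0.2)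
  · by_contra hcon
    have := hmin (show y ∈ K ∩ {y | h y ≤ 0} from ⟨hy, not_lt.1 hcon⟩)
    simp only [mem_ofPred_eq] at this
    linarith

theorem sep_unique {f f' : GenLoop (Fin (m + 1)) ({0}ᶜ : Set (E × ℝ)) (bp b)}
    {g : GenLoop (Fin m) ({0}ᶜ : Set E) b} (h : Sep f g) (h' : Sep f' g) :
    GenLoop.Homotopic f f' := by
  have fc := loop_continuous' f
  have fc' := loop_continuous' f'
  have tc := ta_continuous (m := m)
  set ω : (Fin (m + 1) → unitInterval) → ℝ := fun y => ‖(f y : E × ℝ).1 - (f' y : E × ℝ).1‖ with hω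
  have ωc : Continuous ω := (fc.fst.sub fc'.fst).norm
  have ω0 : ∀ y, ta y = 0 → ω y = 0 := fun y hy => by
    simp [hω, h.mid y hy, h'.mid y hy]
  have ωb : ∀ y ∈ Cube.boundary (Fin (m + 1)), ω y = 0 := fun y hy => by
    simp [hω, loop_boundary f hy, loop_boundary f' hy]
  have ωn : ∀ y, 0 ≤ ω y := fun y => norm_nonneg _
  -- signed version
  set σ : (Fin (m + 1) → unitInterval) → ℝ := fun y => if 0 ≤ ta y then ω y else - ω y with hσ
  have σc : Continuous σ := ωc.if_le ωc.neg continuous_const tc (fun y hy => by simp [ω0 y hy.symm])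
  have σb : ∀ y ∈ Cube.boundary (Fin (m + 1)), σ y = 0 := fun y hy => by simp [hσ, ωb y hy]
  have σp : ∀ y, 0 ≤ ta y → σ y = ω y := fun y hy => by simp [hσ, hy]
  have σn : ∀ y, ta y ≤ 0 → σ y = - ω y := fun y hy => by
    rcases hy.lt_or_eq with hy | hy
    · simp [hσ, not_le.2 hy]
    · simp [hσ, ω0 y hy]
  have Kp : IsClosed {y : Fin (m + 1) → unitInterval | 0 ≤ ta y} := isClosed_le continuous_const tc
  have Kn : IsClosed {y : Fin (m + 1) → unitInterval | ta y ≤ 0} := isClosed_le tc continuous_const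
  obtain ⟨δ1, p1, h1⟩ := exists_delta _ _ fc.fst fc.snd Kp (fun y hy => h.pos y hy)
  obtain ⟨δ2, p2, h2⟩ := exists_delta _ _ fc'.fst fc'.snd Kp (fun y hy => h'.pos y hy)
  obtain ⟨δ3, p3, h3⟩ := exists_delta _ _ fc.fst fc.snd.neg Kn
    (fun y hy e => neg_pos.2 (h.neg y hy e))
  obtain ⟨δ4, p4, h4⟩ := exists_delta _ _ fc'.fst fc'.snd.neg Kn
    (fun y hy e => neg_pos.2 (h'.neg y hy e))
  obtain ⟨M1, hM1⟩ := (isCompact_range fc.snd.norm).bddAbove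
  obtain ⟨M2, hM2⟩ := (isCompact_range fc'.snd.norm).bddAbove
  have hM1 : ∀ y, |(f y : E × ℝ).2| ≤ M1 := fun y => hM1 ⟨y, rfl⟩
  have hM2 : ∀ y, |(f' y : E × ℝ).2| ≤ M2 := fun y => hM2 ⟨y, rfl⟩
  obtain ⟨δ, hδ, d1, d2, d3, d4⟩ : ∃ δ > 0, δ ≤ δ1 ∧ δ ≤ δ2 ∧ δ ≤ δ3 ∧ δ ≤ δ4 :=
    ⟨min (min δ1 δ2) (min δ3 δ4), by positivity, by simp, by simp, by simp, by simp⟩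
  have M1n : 0 ≤ M1 := (abs_nonneg _).trans (hM1 (fun _ => 0))
  have M2n : 0 ≤ M2 := (abs_nonneg _).trans (hM2 (fun _ => 0))
  set C := (M1 + M2 + 1) / δ with hC
  have Cn : 0 ≤ C := by positivity
  have Cδ : C * δ = M1 + M2 + 1 := by rw [hC]; field_simp
  -- push
  have push : ∀ (k : GenLoop (Fin (m + 1)) ({0}ᶜ : Set (E × ℝ)) (bp b)), Sep k g →
      ∃ k' : GenLoop (Fin (m + 1)) ({0}ᶜ : Set (E × ℝ)) (bp b), GenLoop.Homotopic k k' ∧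
        ∀ y, (k' y : E × ℝ) = (k y : E × ℝ) + (0, C * σ y) := by
    intro k hk
    have kc := loop_continuous' k
    have ne : ∀ y, ∀ s : ℝ, 0 ≤ s → (k y : E × ℝ) + s • (0, C * σ y) ∈ ({0}ᶜ : Set (E × ℝ)) := by
      intro y s hs h0
      have e1 : (k y : E × ℝ).1 = 0 := by simpa using congrArg Prod.fst h0
      have e2 : (k y : E × ℝ).2 + s * (C * σ y) = 0 := by simpa using congrArg Prod.snd h0
      rcases le_total 0 (ta y) with ht | ht
      · have := hk.pos y ht e1
        rw [σp y ht] at e2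
        have := ωn y
        have : 0 ≤ s * (C * ω y) := by positivity
        linarith
      · have := hk.neg y ht e1
        rw [σn y ht] at e2
        have := ωn y
        have : 0 ≤ s * (C * ω y) := by positivity
        linarith
    refine ⟨mkLoop (fun y => (k y : E × ℝ) + (0, C * σ y)) (by fun_prop)
      (fun y => by simpa only [one_smul] using ne y 1 zero_le_one)
      (fun y hy => by simp [σb y hy, loop_boundary k hy]), ?_, fun y => rfl⟩
    refine homotopic_line _ _ fun t s hs0 hs1 => ?_
    rw [mkLoop_apply, add_sub_cancel_left]
    exact ne t s hs0
  obtain ⟨k, hk, ek⟩ := push f h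
  obtain ⟨k', hk', ek'⟩ := push f' h'
  refine hk.trans (GenLoop.Homotopic.trans ?_ hk'.symm)
  refine homotopic_line _ _ fun y s hs0 hs1 => ?_
  intro h0
  rw [mem_singleton_iff, ek, ek'] at h0
  have e1 : (f y : E × ℝ).1 + s • ((f' y : E × ℝ).1 - (f y : E × ℝ).1) = 0 := by
    simpa using congrArg Prod.fst h0
  have e2 : (f y : E × ℝ).2 + C * σ y + s * ((f' y : E × ℝ).2 - (f y : E × ℝ).2) = 0 := by
    simpa using congrArg Prod.snd h0
  have n1 : ‖(f y : E × ℝ).1‖ ≤ ω y := by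
    have : (f y : E × ℝ).1 = s • ((f y : E × ℝ).1 - (f' y : E × ℝ).1) := by
      rw [← sub_eq_zero, ← e1]; module
    rw [this, norm_smul, Real.norm_of_nonneg hs0]
    exact mul_le_of_le_one_left (ωn y) hs1
  have n2 : ‖(f' y : E × ℝ).1‖ ≤ ω y := by
    have : (f' y : E × ℝ).1 = (-(1 - s)) • ((f y : E × ℝ).1 - (f' y : E × ℝ).1) := by
      rw [← sub_eq_zero, ← e1]; module
    rw [this, norm_smul, norm_neg, Real.norm_of_nonneg (by linarith)]
    exact mul_le_of_le_one_left (ωn y) (by linarith)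
  have a1 := abs_le.1 (hM1 y)
  have a2 := abs_le.1 (hM2 y)
  have comb : ∀ u v : ℝ, 0 < u → 0 < v → 0 < u + s * (v - u) := fun u v hu hv => by
    rcases hs1.lt_or_eq with hs | rfl
    · nlinarith [mul_nonneg hs0 hv.le, mul_pos (sub_pos.2 hs) hu]
    · linarith
  have bnd : ∀ u v : ℝ, -M1 ≤ u → -M2 ≤ v → 0 < u + s * (v - u) + (M1 + M2 + 1) :=
    fun u v hu hv => by
      nlinarith [mul_nonneg hs0 (show 0 ≤ v + M2 by linarith),
        mul_nonneg (sub_nonneg.2 hs1) (show 0 ≤ u + M1 by linarith)]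
  rcases le_total 0 (ta y) with ht | ht
  · rw [σp y ht] at e2
    rcases lt_or_ge (ω y) δ with hlt | hge
    · have q1 := h1 y ht (by linarith)
      have q2 := h2 y ht (by linarith)
      have := comb _ _ q1 q2
      have := mul_nonneg Cn (ωn y)
      linarith
    · have : C * δ ≤ C * ω y := mul_le_mul_of_nonneg_left hge Cn
      have := bnd _ _ a1.1 a2.1
      linarith
  · rw [σn y ht] at e2
    rcases lt_or_ge (ω y) δ with hlt | hge
    · have q1 : 0 < -(f y : E × ℝ).2 := h3 y ht (by linarith)
      have q2 : 0 < -(f' y : E × ℝ).2 := h4 y ht (by linarith)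
      have := comb _ _ q1 q2
      have := mul_nonneg Cn (ωn y)
      nlinarith
    · have : C * δ ≤ C * ω y := mul_le_mul_of_nonneg_left hge Cn
      have := bnd (-(f y : E × ℝ).2) (-(f' y : E × ℝ).2) (by linarith) (by linarith)
      nlinarith

theorem sep_trans (i : Fin m) (g g' : GenLoop (Fin m) ({0}ᶜ : Set E) b) :
    Sep (GenLoop.transAt i.succ (suspLoop g) (suspLoop g')) (GenLoop.transAt i g g') := by
  have key : ∀ (y : Fin (m + 1) → unitInterval) (c : unitInterval),
      ta (Function.update y i.succ c) = ta y := fun y c => by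
    simp [ta, Function.update_of_ne (Fin.succ_ne_zero i).symm]
  have key2 : ∀ (y : Fin (m + 1) → unitInterval) (c : unitInterval),
      Fin.tail (Function.update y i.succ c) = Function.update (Fin.tail y) i c := fun y c =>
    Fin.tail_update_succ y i c
  constructor
  · intro y hy h
    rw [transAt_apply] at h ⊢
    split_ifs at h ⊢
    · exact (sep_susp g).pos _ (by rwa [key]) h
    · exact (sep_susp g').pos _ (by rwa [key]) h
  · intro y hy h
    rw [transAt_apply] at h ⊢
    split_ifs at h ⊢
    · exact (sep_susp g).neg _ (by rwa [key]) h
    · exact (sep_susp g').neg _ (by rwa [key]) h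
  · intro y hy
    by_cases hc : (y i.succ : ℝ) ≤ 1 / 2
    · have hc' : (Fin.tail y i : ℝ) ≤ 1 / 2 := hc
      rw [transAt_apply, transAt_apply, if_pos hc, if_pos hc',
        (sep_susp g).mid _ (by rwa [key]), key2]; rfl
    · have hc' : ¬ (Fin.tail y i : ℝ) ≤ 1 / 2 := hc
      rw [transAt_apply, transAt_apply, if_neg hc, if_neg hc',
        (sep_susp g').mid _ (by rwa [key]), key2]; rfl

/-- Suspension homomorphism. -/
noncomputable def suspHom : HomotopyGroup (Fin (m + 1)) ({0}ᶜ : Set E) b →*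
    HomotopyGroup (Fin (m + 1 + 1)) ({0}ᶜ : Set (E × ℝ)) (bp b) :=
  MonoidHom.mk' (Quotient.map' (s₁ := GenLoop.Homotopic.setoid _ b)
      (s₂ := GenLoop.Homotopic.setoid _ (bp b)) suspLoop
      (fun _ _ H => suspLoop_homotopic H)) (by
    intro x y
    obtain ⟨f, rfl⟩ := cls_surj x
    obtain ⟨g, rfl⟩ := cls_surj y
    rw [cls_mul 0]
    change cls (suspLoop _) = cls (suspLoop f) * cls (suspLoop g)
    rw [cls_mul (Fin.succ 0), cls_eq]
    exact sep_unique (sep_susp _) (sep_trans 0 g f))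

theorem suspHom_cls (g : GenLoop (Fin (m + 1)) ({0}ᶜ : Set E) b) :
    suspHom (cls g) = cls (suspLoop g) := rfl

end Susp

end PiW
end

section
open Set Topology Filter
set_option linter.unusedSectionVars false

namespace PiW

section SuspSurj

variable {E : Type*} [NormedAddCommGroup E] [NormedSpace ℝ E] [FiniteDimensional ℝ E]
variable {m : ℕ} {b : ({0}ᶜ : Set E)}

theorem consR_continuous : Continuous (fun p : ℝ × (Fin m → ℝ) => (Fin.cons p.1 p.2 : Fin (m+1) → ℝ)) := by
  refine continuous_pi fun i => ?_
  refine Fin.cases ?_ (fun j => ?_) i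
  · simpa using continuous_fst
  · simp only [Fin.cons_succ]; fun_prop

theorem consR_contDiff {k : WithTop ℕ∞} : ContDiff ℝ k
    (fun p : ℝ × (Fin m → ℝ) => (Fin.cons p.1 p.2 : Fin (m+1) → ℝ)) := by
  refine contDiff_pi.2 fun i => ?_
  refine Fin.cases ?_ (fun j => ?_) i
  · simpa using contDiff_fst
  · simp only [Fin.cons_succ]; fun_prop

/-- Generic choice: no two zeros on the same vertical line. -/
theorem exists_generic (hE : m + 2 < 2 * Module.finrank ℝ E) (P : (Fin (m + 1) → ℝ) → E)
    (hP : ContDiff ℝ 1 P) {ε : ℝ} (hε : 0 < ε) :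
    ∃ v w : E, ‖v‖ < ε ∧ ‖w‖ < ε ∧ ∀ (x : Fin m → ℝ) (t s : ℝ), t < s →
      P (Fin.cons t x) + v + t • w = 0 → P (Fin.cons s x) + v + s • w = 0 → False := by
  set F : (ℝ × ℝ × (Fin m → ℝ)) → E × E := fun p =>
    (-(P (Fin.cons p.1 p.2.2)) - p.1 • (-((p.2.1 - p.1)⁻¹ • (P (Fin.cons p.2.1 p.2.2)
      - P (Fin.cons p.1 p.2.2)))), -((p.2.1 - p.1)⁻¹ • (P (Fin.cons p.2.1 p.2.2)
      - P (Fin.cons p.1 p.2.2)))) with hF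
  set R : Set (ℝ × ℝ × (Fin m → ℝ)) := {p | p.1 < p.2.1} with hR
  have hRc : Convex ℝ R := by
    intro p hp q hq a c ha hc hac
    simp only [hR, mem_ofPred_eq, Prod.fst_add, Prod.smul_fst, Prod.snd_add, Prod.smul_snd,
      smul_eq_mul] at *
    rcases ha.lt_or_eq with ha | rfl
    · nlinarith [mul_nonneg hc (sub_nonneg.2 hq.le), mul_pos ha (sub_pos.2 hp)]
    · have : c = 1 := by linarith
      subst this; linarith
  have c1 : ContDiff ℝ 1 (fun p : ℝ × ℝ × (Fin m → ℝ) => P (Fin.cons p.1 p.2.2)) :=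
    hP.comp (consR_contDiff.comp (f := fun p : ℝ × ℝ × (Fin m → ℝ) => (p.1, p.2.2)) (by fun_prop))
  have c2 : ContDiff ℝ 1 (fun p : ℝ × ℝ × (Fin m → ℝ) => P (Fin.cons p.2.1 p.2.2)) :=
    hP.comp (consR_contDiff.comp (f := fun p : ℝ × ℝ × (Fin m → ℝ) => (p.2.1, p.2.2)) (by fun_prop))
  have c3 : ContDiffOn ℝ 1 (fun p : ℝ × ℝ × (Fin m → ℝ) => (p.2.1 - p.1)⁻¹) R := by
    refine ContDiffOn.inv (by fun_prop) (fun p hp => ?_)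
    have : p.1 < p.2.1 := hp
    exact (sub_pos.2 this).ne'
  have c4 := c3.smul (c2.sub c1).contDiffOn
  have c5 : ContDiffOn ℝ 1 F R := by
    refine ContDiffOn.prodMk ?_ c4.neg
    exact c1.neg.contDiffOn.sub (contDiff_fst.contDiffOn.smul c4.neg)
  obtain ⟨⟨v, w⟩, hvw, hnot⟩ := exists_small_notMem (V := E × E) (S := F '' R) (d := m + 2)
    (by
      refine (c5.dimH_image_le hRc Subset.rfl).trans ?_
      refine (dimH_mono (subset_univ _)).trans ?_
      rw [Real.dimH_univ_eq_finrank]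
      simp only [Module.finrank_prod, Module.finrank_self, Module.finrank_fin_fun]
      norm_cast; omega) (by rw [Module.finrank_prod]; omega) hε
  refine ⟨v, w, (le_max_left _ _).trans_lt hvw, (le_max_right _ _).trans_lt hvw, ?_⟩
  intro x t s hts h1 h2
  apply hnot
  refine ⟨(t, s, x), hts, ?_⟩
  have hne : s - t ≠ 0 := (sub_pos.2 hts).ne'
  have hw : -((s - t)⁻¹ • (P (Fin.cons s x) - P (Fin.cons t x))) = w := by
    have : P (Fin.cons s x) - P (Fin.cons t x) = -((s - t) • w) := by
      rw [← sub_eq_zero]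
      have : P (Fin.cons s x) - P (Fin.cons t x) - -((s - t) • w) =
        (P (Fin.cons s x) + v + s • w) - (P (Fin.cons t x) + v + t • w) := by module
      rw [this, h1, h2, sub_zero]
    rw [this, smul_neg, neg_neg, smul_smul, inv_mul_cancel₀ hne, one_smul]
  refine Prod.ext ?_ hw
  change -(P (Fin.cons t x)) - t • (-((s - t)⁻¹ • (P (Fin.cons s x) - P (Fin.cons t x)))) = v
  rw [hw, ← sub_eq_zero, ← neg_eq_zero, ← h1]; module

theorem consI_continuous : Continuous (fun p : unitInterval × (Fin m → unitInterval) =>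
    (Fin.cons p.1 p.2 : Fin (m+1) → unitInterval)) := by
  refine continuous_pi fun i => ?_
  refine Fin.cases ?_ (fun j => ?_) i
  · simpa using continuous_fst
  · simp only [Fin.cons_succ]; fun_prop

theorem tail_continuous : Continuous (fun y : Fin (m + 1) → unitInterval => Fin.tail y) := by
  unfold Fin.tail; fun_prop

/-- every loop is homotopic to a separated one -/
theorem exists_sep (hE : m + 2 < 2 * Module.finrank ℝ E)
    (f : GenLoop (Fin (m + 1)) ({0}ᶜ : Set (E × ℝ)) (bp b)) :
    ∃ f' g, GenLoop.Homotopic f f' ∧ Sep f' g := by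
  have fc := loop_continuous' f
  have hb : (b : E) ≠ 0 := b.2
  obtain ⟨η, hη, hηb, hηf⟩ : ∃ η > 0, 2 * η ≤ ‖(b : E)‖ ∧ ∀ y, η ≤ ‖(f y : E × ℝ)‖ := by
    obtain ⟨y0, -, hmin⟩ := isCompact_univ.exists_isMinOn univ_nonempty fc.norm.continuousOn
    have h1 : 0 < ‖(f y0 : E × ℝ)‖ := norm_pos_iff.2 (f y0).2
    have h2 : 0 < ‖(b : E)‖ := norm_pos_iff.2 hb
    refine ⟨min (‖(b : E)‖ / 2) ‖(f y0 : E × ℝ)‖, by positivity, ?_, fun y => ?_⟩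
    · have := min_le_left (‖(b : E)‖ / 2) ‖(f y0 : E × ℝ)‖
      linarith
    · exact (min_le_right _ _).trans (hmin (mem_univ y))
  obtain ⟨P, hP, hPf⟩ := exists_smooth_approx _ fc.fst (show 0 < η / 3 by positivity)
  have hP1 : ContDiff ℝ 1 P := hP.of_le (by exact_mod_cast le_top)
  obtain ⟨v, w, hv, hw, hgen⟩ := exists_generic hE P hP1 (show 0 < η / 3 by positivity)
  set u : (Fin (m + 1) → unitInterval) → E :=
    fun y => P (fun i => y i) + v + (y 0 : ℝ) • w - (f y : E × ℝ).1 with hu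
  have hPc : Continuous (fun y : Fin (m + 1) → unitInterval => P (fun i => y i)) :=
    hP.continuous.comp (by fun_prop)
  have huc : Continuous u := by
    have := fc.fst
    fun_prop
  have hun : ∀ y, ‖u y‖ < η := fun y => by
    have h1 := hPf y
    have h2 : u y = (P (fun i => y i) - (f y : E × ℝ).1) + v + (y 0 : ℝ) • w := by
      simp only [hu]; abel
    have h3 := norm_smul_lt (y 0).2.1 (y 0).2.2 hw
    rw [h2]
    have := norm_add₃_le (a := P (fun i => y i) - (f y : E × ℝ).1) (b := v) (c := (y 0 : ℝ) • w)
    linarith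
  set χ : (Fin (m + 1) → unitInterval) → ℝ := fun y => cl (2 - ‖(f y : E × ℝ).1‖ / η) with hχ
  have hχc : Continuous χ := cl_continuous.comp (continuous_const.sub (fc.fst.norm.div_const η))
  have hχb : ∀ y ∈ Cube.boundary (Fin (m + 1)), χ y = 0 := fun y hy => by
    refine cl_of_le ?_
    rw [loop_boundary f hy, sub_nonpos, le_div_iff₀ hη]
    exact hηb
  set F : (Fin (m + 1) → unitInterval) → E × ℝ := fun y => (f y : E × ℝ) + (χ y • u y, 0) with hF
  have hFne : ∀ y, ∀ s : ℝ, 0 ≤ s → s ≤ 1 → (f y : E × ℝ) + s • (χ y • u y, (0 : ℝ)) ≠ 0 := by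
    intro y s hs0 hs1 h0
    have h1 : (f y : E × ℝ) = - (s • (χ y • u y, (0 : ℝ))) := eq_neg_of_add_eq_zero_left h0
    have h2 : ‖(χ y • u y, (0 : ℝ))‖ < η := by
      rw [Prod.norm_mk, norm_zero, max_eq_left (norm_nonneg _)]
      exact norm_smul_lt (cl_nonneg _) (cl_le_one _) (hun y)
    have h3 := norm_smul_lt hs0 hs1 h2
    rw [← norm_neg, ← h1] at h3
    linarith [hηf y]
  have hFc : Continuous F := by fun_prop
  let f1 : GenLoop (Fin (m + 1)) ({0}ᶜ : Set (E × ℝ)) (bp b) := mkLoop F hFc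
    (fun y => by
      have := hFne y 1 zero_le_one le_rfl
      rw [one_smul] at this; exact this)
    (fun y hy => by simp [hF, hχb y hy, loop_boundary f hy])
  have H1 : GenLoop.Homotopic f f1 := homotopic_line _ _ fun y s hs0 hs1 => by
    have : (f1 y : E × ℝ) = (f y : E × ℝ) + (χ y • u y, 0) := rfl
    rw [this, add_sub_cancel_left]; exact hFne y s hs0 hs1
  have hF0 : ∀ y, (F y).1 = 0 → P (fun i => y i) + v + (y 0 : ℝ) • w = 0 := by
    intro y hy
    have h1 : (f y : E × ℝ).1 + χ y • u y = 0 := hy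
    have h2 : ‖(f y : E × ℝ).1‖ < η := by
      rw [eq_neg_of_add_eq_zero_left h1, norm_neg]
      exact norm_smul_lt (cl_nonneg _) (cl_le_one _) (hun y)
    have h3 : χ y = 1 := cl_of_ge (by
      have : ‖(f y : E × ℝ).1‖ / η ≤ 1 := by rw [div_le_one hη]; exact h2.le
      linarith)
    rw [h3, one_smul] at h1
    rw [← h1]; simp only [hu]; abel
  have hFn : ∀ y, F y ≠ 0 := fun y => (f1 y).2
  have hFb : ∀ y ∈ Cube.boundary (Fin (m + 1)), F y = ((b : E), 0) :=
    fun y hy => loop_boundary f1 hy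
  have hcoe : ∀ y : Fin (m + 1) → unitInterval,
      (fun i => (y i : ℝ)) = Fin.cons (y 0 : ℝ) (fun i => (Fin.tail y i : ℝ)) := fun y => by
    ext i; refine Fin.cases ?_ (fun j => ?_) i <;> simp [Fin.tail]
  have huniq : ∀ y y' : Fin (m + 1) → unitInterval, Fin.tail y = Fin.tail y' → (F y).1 = 0 →
      (F y').1 = 0 → y = y' := by
    intro y y' ht h h'
    have e := hF0 y h
    have e' := hF0 y' h'
    rw [hcoe] at e e'
    rw [← ht] at e'
    have h0 : y 0 = y' 0 := by
      rcases lt_trichotomy (y 0 : ℝ) (y' 0) with hlt | heq | hgt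
      · exact (hgen _ _ _ hlt e e').elim
      · exact Subtype.ext heq
      · exact (hgen _ _ _ hgt e' e).elim
    rw [← Fin.cons_self_tail y, ← Fin.cons_self_tail y', ht, h0]
  -- separation in the base
  set Kp : Set (Fin m → unitInterval) := Fin.tail '' {y | (F y).1 = 0 ∧ 0 ≤ (F y).2} with hKp
  set Kn : Set (Fin m → unitInterval) := Fin.tail '' {y | (F y).1 = 0 ∧ (F y).2 ≤ 0} with hKn
  have Kpc : IsClosed Kp := (((isClosed_eq hFc.fst continuous_const).inter
    (isClosed_le continuous_const hFc.snd)).isCompact.image tail_continuous).isClosed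
  have Knc : IsClosed Kn := (((isClosed_eq hFc.fst continuous_const).inter
    (isClosed_le hFc.snd continuous_const)).isCompact.image tail_continuous).isClosed
  obtain ⟨θ, θc, θ0, θ1, θI⟩ := exists_urysohn Knc Kpc (Set.disjoint_left.2 (by
    rintro _ ⟨y, ⟨hy, hy2⟩, rfl⟩ ⟨y', ⟨hy', hy2'⟩, ht⟩
    obtain rfl := huniq y y' ht.symm hy hy'
    exact hFn y (Prod.ext hy (le_antisymm hy2 hy2'))))
  -- reparametrization
  set R : unitInterval × (Fin (m + 1) → unitInterval) → (Fin (m + 1) → unitInterval) := fun p =>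
    Fin.cons (projIcc 0 1 zero_le_one ((1 - (p.1 : ℝ)) * (p.2 0 : ℝ)
      + p.1 * cl (2 * (p.2 0 : ℝ) - θ (Fin.tail p.2)))) (Fin.tail p.2) with hR
  have hRc : Continuous R := by
    have h1 := cl_continuous
    have h2 : Continuous (fun p : unitInterval × (Fin (m + 1) → unitInterval) =>
      cl (2 * (p.2 0 : ℝ) - θ (Fin.tail p.2))) := by
      have := tail_continuous (m := m)
      fun_prop
    refine consI_continuous.comp (Continuous.prodMk ((continuous_projIcc (h := zero_le_one)).comp ?_)
      (tail_continuous.comp continuous_snd))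
    fun_prop
  have hRb : ∀ r, ∀ y ∈ Cube.boundary (Fin (m + 1)), R (r, y) ∈ Cube.boundary (Fin (m + 1)) := by
    intro r y hy
    obtain ⟨i, hi⟩ := hy
    revert hi
    refine Fin.cases (fun hi => ?_) (fun j hi => ?_) i
    · refine ⟨0, ?_⟩
      simp only [hR, Fin.cons_zero]
      rcases hi with hi | hi
      · left
        rw [hi, cl_of_le (by simpa using (θI _).1)]; simp
      · right
        rw [hi, cl_of_ge (by have := (θI (Fin.tail y)).2; push_cast; linarith)]; simp
    · exact ⟨j.succ, by simpa [hR, Fin.tail] using hi⟩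
  have hR0 : ∀ y, R (0, y) = y := fun y => by
    simp only [hR]
    conv_rhs => rw [← Fin.cons_self_tail y]
    simp
  have hR1 : ∀ y, ((R (1, y)) 0 : ℝ) = cl (2 * (y 0 : ℝ) - θ (Fin.tail y)) := fun y => by
    simp only [hR, Fin.cons_zero, Icc.coe_one, sub_self, zero_mul, zero_add, one_mul]
    rw [projIcc_of_mem zero_le_one ⟨cl_nonneg _, cl_le_one _⟩]
  have hRt : ∀ p, Fin.tail (R p) = Fin.tail p.2 := fun p => by simp [hR]
  let f2 : GenLoop (Fin (m + 1)) ({0}ᶜ : Set (E × ℝ)) (bp b) := mkLoop (fun y => F (R (1, y)))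
    (hFc.comp (hRc.comp (by fun_prop))) (fun y => hFn _) (fun y hy => hFb _ (hRb _ _ hy))
  have H2 : GenLoop.Homotopic f1 f2 := by
    refine homotopic_of_family f1 f2 (fun p => F (R p)) (hFc.comp hRc) ?_ ?_ ?_ ?_
    · intro t; simp only [hR0]; rfl
    · intro t; rfl
    · intro p; exact hFn _
    · intro s t ht; exact hFb _ (hRb _ _ ht)
  have pos : ∀ y, 0 ≤ ta y → (f2 y : E × ℝ).1 = 0 → 0 < (f2 y : E × ℝ).2 := by
    intro y hy h0
    have h0' : (F (R (1, y))).1 = 0 := h0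
    change 0 < (F (R (1, y))).2
    by_contra hneg
    have hK : Fin.tail y ∈ Kn := ⟨R (1, y), ⟨h0', not_lt.1 hneg⟩, hRt _⟩
    have h2 := hR1 y
    rw [θ0 _ hK, cl_of_ge (by unfold ta at hy; linarith)] at h2
    rw [hFb _ ⟨0, Or.inr (Subtype.ext h2)⟩] at h0'
    exact hb h0'
  have neg : ∀ y, ta y ≤ 0 → (f2 y : E × ℝ).1 = 0 → (f2 y : E × ℝ).2 < 0 := by
    intro y hy h0
    have h0' : (F (R (1, y))).1 = 0 := h0
    change (F (R (1, y))).2 < 0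
    by_contra hneg
    have hK : Fin.tail y ∈ Kp := ⟨R (1, y), ⟨h0', not_lt.1 hneg⟩, hRt _⟩
    have h2 := hR1 y
    rw [θ1 _ hK, cl_of_le (by unfold ta at hy; linarith)] at h2
    rw [hFb _ ⟨0, Or.inl (Subtype.ext h2)⟩] at h0'
    exact hb h0'
  let hf : unitInterval := ⟨1 / 2, by norm_num, by norm_num⟩
  have hta : ∀ x : Fin m → unitInterval, ta (Fin.cons hf x : Fin (m + 1) → unitInterval) = 0 :=
    fun x => by simp [ta, hf]
  let g : GenLoop (Fin m) ({0}ᶜ : Set E) b := mkLoop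
    (fun x => (f2 (Fin.cons hf x) : E × ℝ).1)
    ((loop_continuous' f2).fst.comp (consI_continuous.comp
      (f := fun x : Fin m → unitInterval => (hf, x)) (by fun_prop)))
    (fun x h0 => lt_asymm (pos _ (hta x).ge h0) (neg _ (hta x).le h0))
    (fun x hx => by
      have : (Fin.cons hf x : Fin (m + 1) → unitInterval) ∈ Cube.boundary (Fin (m + 1)) :=
        boundary_cons.2 (Or.inr (by simpa using hx))
      rw [loop_boundary f2 this]; rfl)
  refine ⟨f2, g, H1.trans H2, ⟨pos, neg, ?_⟩⟩
  intro y hy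
  have h0 : y 0 = hf := Subtype.ext (by unfold ta at hy; simp only [hf]; linarith)
  change _ = (f2 (Fin.cons hf (Fin.tail y)) : E × ℝ).1
  rw [← h0, Fin.cons_self_tail]

theorem suspHom_surjective (hE : m + 3 < 2 * Module.finrank ℝ E) :
    Function.Surjective (suspHom (E := E) (m := m) (b := b)) := by
  intro x
  obtain ⟨f, rfl⟩ := cls_surj x
  obtain ⟨f', g, h1, h2⟩ := exists_sep (by omega) f
  refine ⟨cls g, ?_⟩
  rw [suspHom_cls, cls_eq]
  exact (sep_unique (sep_susp g) h2).trans h1.symm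

end SuspSurj

section Sphere

theorem pi1_cyclic : IsCyclic (HomotopyGroup (Fin 1) {z : ℂ // z ≠ 0} ⟨1, one_ne_zero⟩) := by
  rw [MulEquiv.isCyclic HomotopyGroup.pi1MulEquivFundamentalGroup]
  have hp := Complex.isAddQuotientCoveringMap_exp
  haveI : IsCyclic (Multiplicative (AddSubgroup.zmultiples (2 * Real.pi * Complex.I)))ᵐᵒᵖ :=
    (MulEquiv.isCyclic (MulEquiv.inv' _)).1 inferInstance
  exact isCyclic_of_injective
    (hp.fundamentalGroupToMulOpposite (x := (⟨1, one_ne_zero⟩ : {z : ℂ // z ≠ 0}))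
      ⟨0, by simp⟩) (hp.fundamentalGroupToMulOpposite_injective _)

/-- linear equivalences restrict to punctured spaces -/
def puncHomeo {V V' : Type*} [NormedAddCommGroup V] [NormedSpace ℝ V]
    [NormedAddCommGroup V'] [NormedSpace ℝ V'] (e : V ≃L[ℝ] V') :
    ({0}ᶜ : Set V) ≃ₜ ({0}ᶜ : Set V') :=
  e.toHomeomorph.sets (by
    ext x; simp)

theorem exists_equiv_base {V V' : Type*} [NormedAddCommGroup V] [NormedSpace ℝ V]
    [NormedAddCommGroup V'] [NormedSpace ℝ V'] [FiniteDimensional ℝ V] [FiniteDimensional ℝ V']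
    (h : Module.finrank ℝ V = Module.finrank ℝ V') {b : V} {b' : V'} (hb : b ≠ 0) (hb' : b' ≠ 0) :
    ∃ e : V ≃L[ℝ] V', e b = b' := by
  have e0 : V ≃L[ℝ] V' := ContinuousLinearEquiv.ofFinrankEq h
  obtain ⟨A, hA⟩ := SeparatingDual.exists_continuousLinearEquiv_apply_eq (R := ℝ)
    (show e0 b ≠ 0 by simpa using hb) hb'
  exact ⟨e0.trans A, hA⟩

theorem punc_cyclic_congr {V V' : Type*} [NormedAddCommGroup V] [NormedSpace ℝ V]
    [NormedAddCommGroup V'] [NormedSpace ℝ V'] [FiniteDimensional ℝ V] [FiniteDimensional ℝ V']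
    (h : Module.finrank ℝ V = Module.finrank ℝ V') (n : ℕ)
    (b : ({0}ᶜ : Set V)) (b' : ({0}ᶜ : Set V'))
    (H : IsCyclic (HomotopyGroup (Fin (n + 1)) ({0}ᶜ : Set V) b)) :
    IsCyclic (HomotopyGroup (Fin (n + 1)) ({0}ᶜ : Set V') b') := by
  obtain ⟨e, he⟩ := exists_equiv_base h b.2 b'.2
  exact (MulEquiv.isCyclic (homeoEquiv (N := Fin (n + 1)) (puncHomeo e) (Subtype.ext he))).1 H

theorem sphere_cyclic (n : ℕ) : ∀ (V : Type) [NormedAddCommGroup V] [NormedSpace ℝ V]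
    [FiniteDimensional ℝ V] (_ : Module.finrank ℝ V = n + 2) (b : ({0}ᶜ : Set V)),
    IsCyclic (HomotopyGroup (Fin (n + 1)) ({0}ᶜ : Set V) b) := by
  induction n with
  | zero =>
    intro V _ _ _ hV b
    exact punc_cyclic_congr (V := ℂ) (by rw [hV, Complex.finrank_real_complex]) 0
      ⟨1, one_ne_zero⟩ b pi1_cyclic
  | succ n ih =>
    intro V _ _ _ hV b
    let E := Fin (n + 2) → ℝ
    let b0 : ({0}ᶜ : Set E) := ⟨fun _ => 1, fun h => one_ne_zero (congrFun h 0)⟩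
    have := ih E (by simp [E]) b0
    refine punc_cyclic_congr (V := E × ℝ) (by simp [hV, E]) (n + 1) (bp b0) b ?_
    exact isCyclic_of_surjective (suspHom (m := n) (b := b0)) (suspHom_surjective (by
      simp [E]; omega))

end Sphere

end PiW
end

section
open Set Topology Filter
set_option linter.unusedSectionVars false
namespace PiW

section Homog

variable {ι : Type*} [Fintype ι] {P Q : ι → Type} [∀ i, Fintype (P i)] [∀ i, Fintype (Q i)]
  [∀ i, DecidableEq (Q i)]

/-- the ambient space of tuples of matrices -/
abbrev VV {ι : Type*} (P Q : ι → Type) := ∀ i, P i → Q i → ℂ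

/-- the degenerate tuples -/
def DD {ι : Type*} (P Q : ι → Type) [∀ i, Fintype (Q i)] : Set (VV P Q) :=
  {A | ∀ i, ∃ u : Q i → ℂ, u ≠ 0 ∧ ∀ a, ∑ b, A i a b * u b = 0}

/-- injectivity of one matrix -/
def Inj {p q : Type} [Fintype q] (M : p → q → ℂ) : Prop :=
  ∀ u : q → ℂ, (∀ a, ∑ b, M a b * u b = 0) → u = 0

theorem mem_DDc {A : VV P Q} : A ∈ (DD P Q)ᶜ ↔ ∃ i, Inj (A i) := by
  simp only [DD, Inj, mem_compl_iff, mem_ofPred_eq, not_forall, not_exists, not_and]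
  constructor
  · rintro ⟨i, h⟩
    refine ⟨i, fun u hu => ?_⟩
    by_contra h0
    obtain ⟨a, ha⟩ := h u h0
    exact ha (hu a)
  · rintro ⟨i, h⟩
    refine ⟨i, fun u hu => ?_⟩
    by_contra h0
    push Not at h0
    exact hu (h u h0)

/-- Gram determinant -/
noncomputable def gram {p q : Type} [Fintype p] [Fintype q] [DecidableEq q] (M : p → q → ℂ) : ℂ :=
  (Matrix.conjTranspose (Matrix.of M) * Matrix.of M).det

open scoped ComplexOrder in
theorem gram_ne_zero_iff {p q : Type} [Fintype p] [Fintype q] [DecidableEq q] (M : p → q → ℂ) :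
    gram M ≠ 0 ↔ Inj M := by
  rw [gram, Ne, ← Matrix.exists_mulVec_eq_zero_iff]
  simp only [Matrix.conjTranspose_mul_self_mulVec_eq_zero, Inj, not_exists, not_and]
  refine forall_congr' fun u => ?_
  have : (Matrix.of M).mulVec u = 0 ↔ ∀ a, ∑ b, M a b * u b = 0 := by
    rw [funext_iff]; rfl
  rw [this]
  tauto

theorem gram_continuous {p q : Type} [Fintype p] [Fintype q] [DecidableEq q] :
    Continuous (gram : (p → q → ℂ) → ℂ) := by
  unfold gram
  have : Continuous fun M : p → q → ℂ => (Matrix.of M) := continuous_id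
  fun_prop

/-- shear homeomorphism -/
noncomputable def shear (i0 : ι) (C : VV P Q) (hC : C i0 = 0) : VV P Q ≃ₜ VV P Q where
  toFun A := A + gram (A i0) • C
  invFun A := A - gram (A i0) • C
  left_inv A := by simp [hC]
  right_inv A := by simp [hC]
  continuous_toFun := continuous_id.add
    ((gram_continuous.comp (continuous_apply i0)).smul continuous_const)
  continuous_invFun := continuous_id.sub
    ((gram_continuous.comp (continuous_apply i0)).smul continuous_const)

theorem shear_mem (i0 : ι) (C : VV P Q) (hC : C i0 = 0) (A : VV P Q) :
    A ∈ (DD P Q)ᶜ ↔ shear i0 C hC A ∈ (DD P Q)ᶜ := by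
  by_cases h : Inj (A i0)
  · refine iff_of_true (mem_DDc.2 ⟨i0, h⟩) (mem_DDc.2 ⟨i0, ?_⟩)
    have : shear i0 C hC A i0 = A i0 := by simp [shear, hC]
    rwa [this]
  · have h' := mt (gram_ne_zero_iff (A i0)).1 h
    have : shear i0 C hC A = A := by
      simp only [shear]
      change A + gram (A i0) • C = A
      rw [not_ne_iff.1 h']; simp
    rw [this]

theorem Inj.exists_equiv {p q : Type} [Fintype p] [Fintype q] {M N : p → q → ℂ} (hM : Inj M)
    (hN : Inj N) : ∃ g : (p → ℂ) ≃ₗ[ℂ] (p → ℂ), ∀ b, g (fun a => M a b) = fun a => N a b := by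
  classical
  let f := Matrix.mulVecLin (Matrix.of M)
  let h := Matrix.mulVecLin (Matrix.of N)
  have hf : Function.Injective f := by
    rw [injective_iff_map_eq_zero]
    intro u hu; exact hM u (fun a => congrFun hu a)
  have hh : Function.Injective h := by
    rw [injective_iff_map_eq_zero]
    intro u hu; exact hN u (fun a => congrFun hu a)
  obtain ⟨g, hg⟩ := Submodule.exists_linearEquiv_restrict_eq
    ((LinearEquiv.ofInjective f hf).symm.trans (LinearEquiv.ofInjective h hh))
  refine ⟨g, fun b => ?_⟩
  have := hg (LinearEquiv.ofInjective f hf (Pi.single b 1))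
  simp only [LinearEquiv.trans_apply, LinearEquiv.symm_apply_apply,
    LinearEquiv.ofInjective_apply] at this
  have e1 : f (Pi.single b 1) = fun a => M a b := by
    ext a; simp [f]
  have e2 : h (Pi.single b 1) = fun a => N a b := by
    ext a; simp [h]
  rw [← e1, ← e2, this]

theorem Inj.map {p q : Type} [Fintype p] [Fintype q] {M : p → q → ℂ} (hM : Inj M)
    (g : (p → ℂ) ≃ₗ[ℂ] (p → ℂ)) : Inj (fun a b => g (fun a' => M a' b) a) := by
  intro u hu
  apply hM
  have : g (∑ b, u b • fun a' => M a' b) = 0 := by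
    ext a
    rw [map_sum]
    simp only [map_smul, Finset.sum_apply, Pi.smul_apply, smul_eq_mul, Pi.zero_apply]
    rw [← hu a]
    exact Finset.sum_congr rfl fun b _ => mul_comm _ _
  rw [LinearEquiv.map_eq_zero_iff] at this
  intro a
  have := congrFun this a
  simp only [Finset.sum_apply, Pi.smul_apply, smul_eq_mul, Pi.zero_apply] at this
  rw [← this]
  exact Finset.sum_congr rfl fun b _ => mul_comm _ _

/-- left multiplication -/
noncomputable def leftAct (g : ∀ i, (P i → ℂ) ≃ₗ[ℂ] (P i → ℂ)) : VV P Q ≃ₜ VV P Q where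
  toFun A i a b := g i (fun a' => A i a' b) a
  invFun A i a b := (g i).symm (fun a' => A i a' b) a
  left_inv A := by
    ext i a b
    have := (g i).symm_apply_apply (fun a' => A i a' b)
    exact congrFun this a
  right_inv A := by
    ext i a b
    have := (g i).apply_symm_apply (fun a' => A i a' b)
    exact congrFun this a
  continuous_toFun := by
    have := fun i => LinearMap.continuous_of_finiteDimensional (g i).toLinearMap
    refine continuous_pi fun i => continuous_pi fun a => continuous_pi fun b => ?_
    refine (continuous_apply a).comp ((this i).comp ?_)
    fun_prop
  continuous_invFun := by
    have := fun i => LinearMap.continuous_of_finiteDimensional (g i).symm.toLinearMap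
    refine continuous_pi fun i => continuous_pi fun a => continuous_pi fun b => ?_
    refine (continuous_apply a).comp ((this i).comp ?_)
    fun_prop

theorem leftAct_mem (g : ∀ i, (P i → ℂ) ≃ₗ[ℂ] (P i → ℂ)) (A : VV P Q) :
    A ∈ (DD P Q)ᶜ ↔ leftAct g A ∈ (DD P Q)ᶜ := by
  constructor
  · intro h
    obtain ⟨i, hi⟩ := mem_DDc.1 h
    exact mem_DDc.2 ⟨i, hi.map (g i)⟩
  · intro h
    obtain ⟨i, hi⟩ := mem_DDc.1 h
    refine mem_DDc.2 ⟨i, ?_⟩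
    have := hi.map (g i).symm
    have e : (fun a b => (g i).symm (fun a' => leftAct g A i a' b) a) = A i := by
      ext a b
      have := (g i).symm_apply_apply (fun a' => A i a' b)
      exact congrFun this a
    rwa [e] at this

theorem homog_std (S : VV P Q) (hS : ∀ i, Inj (S i)) (hS' : S ∈ (DD P Q)ᶜ)
    (x : ((DD P Q)ᶜ : Set (VV P Q))) :
    ∃ φ : ((DD P Q)ᶜ : Set (VV P Q)) ≃ₜ ((DD P Q)ᶜ : Set (VV P Q)), φ x = ⟨S, hS'⟩ := by
  classical
  obtain ⟨i0, h0⟩ := mem_DDc.1 x.2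
  have hg := (gram_ne_zero_iff _).2 h0
  let C : VV P Q := Function.update ((gram (x.1 i0))⁻¹ • (S - x.1)) i0 0
  have hC : C i0 = 0 := by simp [C]
  obtain ⟨g0, hg0⟩ := h0.exists_equiv (hS i0)
  let g : ∀ i, (P i → ℂ) ≃ₗ[ℂ] (P i → ℂ) := Function.update (fun i => LinearEquiv.refl _ _) i0 g0
  refine ⟨((shear i0 C hC).subtype (shear_mem i0 C hC)).trans
    ((leftAct g).subtype (leftAct_mem g)), ?_⟩
  apply Subtype.ext
  change leftAct g (shear i0 C hC x.1) = S
  ext i a b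
  by_cases hi : i = i0
  · subst hi
    have e : shear i C hC x.1 i = x.1 i := by simp [shear, hC]
    change g i (fun a' => shear i C hC x.1 i a' b) a = _
    rw [e]
    simp only [g, Function.update_self]
    rw [hg0]
  · change g i (fun a' => shear i0 C hC x.1 i a' b) a = _
    simp only [g, Function.update_of_ne hi]
    simp only [LinearEquiv.refl_apply]
    change x.1 i a b + gram (x.1 i0) * C i a b = _
    simp only [C, Function.update_of_ne hi]
    simp only [Pi.smul_apply, Pi.sub_apply, smul_eq_mul]
    field_simp
    ring

theorem exists_std (h : ∀ i, Fintype.card (Q i) ≤ Fintype.card (P i)) :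
    ∃ S : VV P Q, ∀ i, Inj (S i) := by
  classical
  have : ∀ i, ∃ M : P i → Q i → ℂ, Inj M := by
    intro i
    obtain ⟨j⟩ := Function.Embedding.nonempty_of_card_le (h i)
    refine ⟨fun a b => if a = j b then 1 else 0, fun u hu => ?_⟩
    ext b
    simpa using hu (j b)
  choose S hS using this
  exact ⟨S, hS⟩

theorem homog [Nonempty ι] (h : ∀ i, Fintype.card (Q i) ≤ Fintype.card (P i))
    (x y : ((DD P Q)ᶜ : Set (VV P Q))) :
    ∃ φ : ((DD P Q)ᶜ : Set (VV P Q)) ≃ₜ ((DD P Q)ᶜ : Set (VV P Q)), φ x = y := by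
  obtain ⟨S, hS⟩ := exists_std (P := P) (Q := Q) h
  have hS' := mem_DDc.2 ⟨Classical.arbitrary ι, hS _⟩
  obtain ⟨φ, hφ⟩ := homog_std S hS hS' x
  obtain ⟨ψ, hψ⟩ := homog_std S hS hS' y
  exact ⟨φ.trans ψ.symm, by simp [hφ, ← hψ]⟩

end Homog
end PiW
end

section
open Set Topology Filter
set_option linter.unusedSectionVars false
namespace PiW

section Param

theorem thin_iUnion {V : Type*} [NormedAddCommGroup V] [NormedSpace ℝ V] [FiniteDimensional ℝ V]
    {K : Type*} [Fintype K] {d : ℕ} (S : K → Set V) (h : ∀ k, Thin (S k) d) :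
    Thin (⋃ k, S k) d := by
  choose m g hg hS using h
  refine thin_of (K := Σ k, Fin (m k)) (E := Fin d → ℝ) (by simp) (fun k => g k.1 k.2)
    (fun k => hg _ _) ?_
  refine iUnion_subset fun k x hx => ?_
  obtain ⟨j, hj⟩ := mem_iUnion.1 (hS k hx)
  exact mem_iUnion.2 ⟨⟨k, j⟩, hj⟩

theorem Thin.mono {V : Type*} [NormedAddCommGroup V] [NormedSpace ℝ V] [FiniteDimensional ℝ V]
    {d : ℕ} {S T : Set V} (h : Thin T d) (hS : S ⊆ T) : Thin S d := by
  obtain ⟨m, g, hg, hT⟩ := h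
  exact ⟨m, g, hg, hS.trans hT⟩

/-- image of the kernel of a nonzero complex functional -/
theorem thin_kernel {V E : Type*} [NormedAddCommGroup V] [NormedSpace ℝ V] [FiniteDimensional ℝ V]
    [NormedAddCommGroup E] [NormedSpace ℝ E] [FiniteDimensional ℝ E] {d : ℕ}
    (hd : Module.finrank ℝ E = d + 2) (g : E → V) (hg : ContDiff ℝ 1 g) (L : E →ₗ[ℝ] ℂ)
    (hL : Function.Surjective L) : Thin (g '' {e | L e = 0}) d := by
  have hk : Module.finrank ℝ (LinearMap.ker L) = d := by
    have := L.finrank_range_add_finrank_ker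
    rw [LinearMap.range_eq_top.2 hL, finrank_top, Complex.finrank_real_complex] at this
    omega
  refine thin_of (K := Unit) hk (fun _ e => g e) (fun _ => hg.comp
    (LinearMap.ker L).subtypeL.contDiff) ?_
  rintro _ ⟨e, he, rfl⟩
  exact mem_iUnion.2 ⟨(), ⟨⟨e, he⟩, rfl⟩⟩

variable {ι : Type*} [Fintype ι] {P Q : ι → Type} [∀ i, Fintype (P i)] [∀ i, Fintype (Q i)]
  [∀ i, DecidableEq (Q i)]

theorem finrank_VV : Module.finrank ℝ (VV P Q) =
    ∑ i, 2 * (Fintype.card (P i) * Fintype.card (Q i)) := by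
  simp only [VV]
  rw [Module.finrank_pi_fintype]
  refine Finset.sum_congr rfl fun i _ => ?_
  rw [Module.finrank_pi_fintype]
  simp only [Module.finrank_pi_fintype, Complex.finrank_real_complex, Finset.sum_const,
    Finset.card_univ, smul_eq_mul]
  ring

theorem mem_DD_iff_gram {A : VV P Q} : A ∈ DD P Q ↔ ∀ i, gram (A i) = 0 := by
  have := mem_DDc (A := A)
  rw [mem_compl_iff, not_iff_comm] at this
  rw [← this]
  push Not
  exact forall_congr' fun i => by rw [← gram_ne_zero_iff, not_ne_iff]

theorem isClosed_DD : IsClosed (DD P Q) := by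
  have : DD P Q = ⋂ i, {A : VV P Q | gram (A i) = 0} := by
    ext A; rw [mem_DD_iff_gram, mem_iInter]; rfl
  rw [this]
  exact isClosed_iInter fun i => isClosed_eq (gram_continuous.comp (continuous_apply i))
    continuous_const

/-- kernel vectors with vanishing special coordinate -/
def DInf (l : ∀ i, Q i) : Set (VV P Q) :=
  {A | A ∈ DD P Q ∧ ∃ i, ∃ u : Q i → ℂ, u ≠ 0 ∧ u (l i) = 0 ∧ ∀ a, ∑ b, A i a b * u b = 0}

theorem not_inj_sub {p q : Type} [Fintype p] [Fintype q] [DecidableEq q] (M : p → q → ℂ) (l : q) :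
    (∃ u : q → ℂ, u ≠ 0 ∧ u l = 0 ∧ ∀ a, ∑ b, M a b * u b = 0) ↔
    ¬ Inj (fun a (b : {b // b ≠ l}) => M a b) := by
  have key : ∀ u : q → ℂ, u l = 0 → ∀ a, ∑ b, M a b * u b = ∑ b : {b // b ≠ l}, M a b * u b := by
    intro u hu a
    rw [Fintype.sum_eq_add_sum_subtype_ne _ l, hu]
    simp
  unfold Inj
  push Not
  constructor
  · rintro ⟨u, h0, hl, h⟩
    refine ⟨fun b => u b, fun a => by rw [← key u hl, h], fun h' => h0 ?_⟩
    ext b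
    by_cases hb : b = l
    · rw [hb, hl]; rfl
    · exact congrFun h' ⟨b, hb⟩
  · rintro ⟨v, h, h0⟩
    let u : q → ℂ := fun b => if h : b ≠ l then v ⟨b, h⟩ else 0
    have hl : u l = 0 := by simp [u]
    have hv : ∀ b : {b // b ≠ l}, u b = v b := by
      intro b; simp only [u]; rw [dif_pos b.2]
    refine ⟨u, fun h' => h0 ?_, hl, fun a => ?_⟩
    · ext b; rw [← hv, h']; rfl
    · rw [key u hl, ← h a]; simp only [hv]

theorem isClosed_DInf (l : ∀ i, Q i) : IsClosed (DInf (P := P) l) := by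
  have : DInf (P := P) l = DD P Q ∩ ⋃ i, {A : VV P Q |
      gram (fun a (b : {b // b ≠ l i}) => A i a b) = 0} := by
    ext A
    simp only [DInf, mem_ofPred_eq, mem_inter_iff, mem_iUnion, not_inj_sub, ← gram_ne_zero_iff,
      not_ne_iff]
  rw [this]
  refine isClosed_DD.inter (isClosed_iUnion_of_finite fun i => isClosed_eq
    (gram_continuous.comp ?_) continuous_const)
  fun_prop

/-- parameter space -/
abbrev EE (P : ι → Type) {Q : ι → Type} (l : ∀ i, Q i) :=
  ∀ i, (P i → {b // b ≠ l i} → ℂ) × ({b // b ≠ l i} → ℂ)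

/-- parametrisation -/
noncomputable def gg (l : ∀ i, Q i) (e : EE P l) : VV P Q := fun i a b =>
  if h : b = l i then ∑ b' : {b // b ≠ l i}, (e i).2 b' * (e i).1 a b' else (e i).1 a ⟨b, h⟩

theorem gg_contDiff (l : ∀ i, Q i) : ContDiff ℝ 1 (gg (P := P) l) := by
  unfold gg
  refine contDiff_pi.2 fun i => contDiff_pi.2 fun a => contDiff_pi.2 fun b => ?_
  have h0 : ContDiff ℝ 1 fun e : EE P l => e i :=
    (ContinuousLinearMap.proj (R := ℝ)
      (φ := fun i => (P i → {b // b ≠ l i} → ℂ) × ({b // b ≠ l i} → ℂ)) i).contDiff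
  have h1 : ∀ b', ContDiff ℝ 1 fun e : EE P l => (e i).1 a b' := fun b' =>
    (contDiff_apply_apply ℝ ℂ a b').comp h0.fst
  have h2 : ∀ b', ContDiff ℝ 1 fun e : EE P l => (e i).2 b' := fun b' =>
    (contDiff_apply ℝ ℂ b').comp h0.snd
  split_ifs
  · exact ContDiff.sum fun b' _ => (h2 b').mul (h1 b')
  · exact h1 _

theorem gg_eq (l : ∀ i, Q i) (A : VV P Q) (u : ∀ i, Q i → ℂ) (h0 : ∀ i, u i (l i) ≠ 0)
    (hu : ∀ i a, ∑ b, A i a b * u i b = 0) :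
    gg l (fun i => (fun a b => A i a b, fun b => - u i b / u i (l i))) = A := by
  ext i a b
  simp only [gg]
  split_ifs with h
  · have := hu i a
    rw [Fintype.sum_eq_add_sum_subtype_ne _ (l i)] at this
    subst h
    have h2 := h0 i
    have e : ∀ b' : {b // b ≠ l i}, -u i b' / u i (l i) * A i a b' =
      -(u i (l i))⁻¹ * (A i a b' * u i b') := fun b' => by ring
    simp only [e]
    rw [← Finset.mul_sum, eq_neg_of_add_eq_zero_right this]
    field_simp
  · rfl

/-- dimension of the parameter space -/
def dE (P Q : ι → Type) [∀ i, Fintype (P i)] [∀ i, Fintype (Q i)] : ℕ :=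
  ∑ i, 2 * ((Fintype.card (P i) + 1) * (Fintype.card (Q i) - 1))

/-- the complex codimension -/
def cc (P Q : ι → Type) [∀ i, Fintype (P i)] [∀ i, Fintype (Q i)] : ℕ :=
  ∑ i, (Fintype.card (P i) - Fintype.card (Q i) + 1)

theorem finrank_EE (l : ∀ i, Q i) : Module.finrank ℝ (EE P l) = dE P Q := by
  rw [Module.finrank_pi_fintype]
  refine Finset.sum_congr rfl fun i _ => ?_
  rw [Module.finrank_prod]
  simp only [Module.finrank_pi_fintype, Complex.finrank_real_complex, Finset.sum_const,
    Finset.card_univ, smul_eq_mul, Fintype.card_subtype_compl, ne_eq, Fintype.card_unique]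
  ring

theorem dE_add (hq : ∀ i, 1 ≤ Fintype.card (Q i)) (h : ∀ i, Fintype.card (Q i) ≤ Fintype.card (P i)) :
    dE P Q + 2 * cc P Q = Module.finrank ℝ (VV P Q) := by
  rw [finrank_VV, dE, cc, Finset.mul_sum, ← Finset.sum_add_distrib]
  refine Finset.sum_congr rfl fun i _ => ?_
  obtain ⟨r, hr⟩ := Nat.exists_eq_add_of_le (h i)
  obtain ⟨s, hs⟩ := Nat.exists_eq_add_of_le (hq i)
  rw [hr, hs]
  have e1 : 1 + s + r - (1 + s) = r := by omega
  have e2 : 1 + s - 1 = s := by omega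
  rw [e1, e2]
  ring

theorem thin_DD : Thin (DD P Q) (dE P Q) := by
  classical
  refine (thin_iUnion (K := ∀ i, Q i) (fun l => range (gg (P := P) l)) (fun l =>
    thin_of (K := Unit) (finrank_EE l) (fun _ => gg l) (fun _ => gg_contDiff l)
      (by intro x hx; exact mem_iUnion.2 ⟨(), hx⟩))).mono ?_
  intro A hA
  choose u hu0 hu using hA
  have : ∀ i, ∃ b, u i b ≠ 0 := fun i => Function.ne_iff.1 (hu0 i)
  choose l hl using this
  exact mem_iUnion.2 ⟨l, _, gg_eq l A u hl hu⟩

/-- coordinate functionals -/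
def kIdx (P : ι → Type) {Q : ι → Type} (l : ∀ i, Q i) : Type _ :=
  (Σ i, P i × {b // b ≠ l i}) ⊕ (Σ i, {b // b ≠ l i})

/-- coordinate functionals -/
def kFun (l : ∀ i, Q i) : kIdx P l → (EE P l →ₗ[ℝ] ℂ)
  | .inl x => { toFun := fun e => (e x.1).1 x.2.1 x.2.2, map_add' := fun _ _ => rfl,
                map_smul' := fun _ _ => rfl }
  | .inr x => { toFun := fun e => (e x.1).2 x.2, map_add' := fun _ _ => rfl,
                map_smul' := fun _ _ => rfl }

theorem kFun_surj (l : ∀ i, Q i) (k : kIdx P l) : Function.Surjective (kFun l k) := by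
  intro z
  refine ⟨fun i => (fun _ _ => z, fun _ => z), ?_⟩
  cases k <;> rfl

theorem thin_sub {S : Set (VV P Q)} {d : ℕ} (hd : dE P Q = d + 2)
    (hS : ∀ A ∈ S, ∃ (l : ∀ i, Q i) (k : kIdx P l) (e : EE P l), gg l e = A ∧ kFun l k e = 0) :
    Thin S d := by
  classical
  have : ∀ l : ∀ i, Q i, Fintype (kIdx P l) := fun l => by unfold kIdx; infer_instance
  refine (thin_iUnion (K := Σ l : (∀ i, Q i), kIdx P l)
    (fun k => gg (P := P) k.1 '' {e | kFun k.1 k.2 e = 0}) (fun k =>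
    thin_kernel ((finrank_EE k.1).trans hd) _ (gg_contDiff k.1) _ (kFun_surj k.1 k.2))).mono ?_
  intro A hA
  obtain ⟨l, k, e, h1, h2⟩ := hS A hA
  exact mem_iUnion.2 ⟨⟨l, k⟩, e, h2, h1⟩

theorem thin_DInf (l : ∀ i, Q i) {d : ℕ} (hd : dE P Q = d + 2) : Thin (DInf (P := P) l) d := by
  classical
  refine thin_sub hd ?_
  rintro A ⟨hA, i0, u0, hu0, hl0, h0⟩
  choose u hu0' hu using hA
  let v := Function.update u i0 u0
  have hv : ∀ i, v i ≠ 0 ∧ ∀ a, ∑ b, A i a b * v i b = 0 := by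
    intro i
    by_cases h : i = i0
    · subst h; simp only [v, Function.update_self]; exact ⟨hu0, h0⟩
    · simp only [v, Function.update_of_ne h]; exact ⟨hu0' i, hu i⟩
  have : ∀ i, ∃ b, v i b ≠ 0 := fun i => Function.ne_iff.1 (hv i).1
  choose l' hl' using this
  have hne : l i0 ≠ l' i0 := by
    intro h
    apply hl' i0
    rw [← h]; simp only [v, Function.update_self]; exact hl0
  refine ⟨l', .inr ⟨i0, l i0, hne⟩, _, gg_eq l' A v hl' (fun i => (hv i).2), ?_⟩
  change -v i0 (l i0) / _ = 0
  simp only [v, Function.update_self, hl0]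
  simp

/-- the hyperplane -/
def ZZ (P Q : ι → Type) (i0 : ι) (p0 : P i0) (q0 : Q i0) : Set (VV P Q) := {A | A i0 p0 q0 = 0}

theorem isClosed_ZZ (i0 : ι) (p0 : P i0) (q0 : Q i0) : IsClosed (ZZ P Q i0 p0 q0) :=
  isClosed_eq (by fun_prop) continuous_const

theorem thin_ZZ (i0 : ι) (p0 : P i0) (q0 : Q i0) {d : ℕ}
    (hd : Module.finrank ℝ (VV P Q) = d + 2) : Thin (ZZ P Q i0 p0 q0) d := by
  let L : VV P Q →ₗ[ℝ] ℂ := { toFun := fun A => A i0 p0 q0, map_add' := fun _ _ => rfl,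
                              map_smul' := fun _ _ => rfl }
  have := thin_kernel hd (id : VV P Q → VV P Q) contDiff_id L (fun z => ⟨fun _ _ _ => z, rfl⟩)
  rwa [image_id] at this

theorem thin_DZ (i0 : ι) (p0 : P i0) (q0 q1 : Q i0) (hne : q1 ≠ q0) {d : ℕ}
    (hd : dE P Q = d + 2) : Thin (DD P Q ∩ ZZ P Q i0 p0 q0) d := by
  classical
  refine thin_sub hd ?_
  rintro A ⟨hA, hZ⟩
  choose u hu0 hu using hA
  have : ∀ i, ∃ b, u i b ≠ 0 := fun i => Function.ne_iff.1 (hu0 i)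
  choose l' hl' using this
  by_cases h : ∃ b, b ≠ q0 ∧ u i0 b ≠ 0
  · obtain ⟨b, hb, hb'⟩ := h
    let l := Function.update l' i0 b
    have hl : ∀ i, u i (l i) ≠ 0 := by
      intro i
      by_cases h : i = i0
      · subst h; simp only [l, Function.update_self]; exact hb'
      · simp only [l, Function.update_of_ne h]; exact hl' i
    refine ⟨l, .inl ⟨i0, p0, q0, ?_⟩, _, gg_eq l A u hl hu, ?_⟩
    · simp only [l, Function.update_self]; exact hb.symm
    · exact hZ
  · push Not at h
    have hq : l' i0 = q0 := by
      by_contra h2; exact hl' i0 (h _ h2)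
    refine ⟨l', .inr ⟨i0, q1, by rw [hq]; exact hne⟩, _, gg_eq l' A u hl' hu, ?_⟩
    change -u i0 q1 / _ = 0
    rw [h q1 hne]; simp

end Param
end PiW
end

section
open Set Topology Filter
set_option linter.unusedSectionVars false
namespace PiW

section OneMatrix

variable {p q : Type} [Fintype q] [DecidableEq p] [DecidableEq q]

theorem Inj.rowop {M : p → q → ℂ} (hM : Inj M) (p0 : p) (x : p → ℂ) (hx : x p0 = 0) :
    Inj (fun a b => M a b - x a * M p0 b) := by
  intro u hu
  apply hM
  have e : ∀ a, ∑ b, (M a b - x a * M p0 b) * u b =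
      ∑ b, M a b * u b - x a * ∑ b, M p0 b * u b := by
    intro a
    rw [Finset.mul_sum, ← Finset.sum_sub_distrib]
    exact Finset.sum_congr rfl fun b _ => by ring
  have h0 : ∑ b, M p0 b * u b = 0 := by
    have := hu p0
    rw [e, hx] at this
    simpa using this
  intro a
  have := hu a
  rw [e, h0] at this
  simpa using this

theorem Inj.colop {M : p → q → ℂ} (hM : Inj M) (q0 : q) (y : q → ℂ) (hy : y q0 = 0) :
    Inj (fun a b => M a b - y b * M a q0) := by
  intro u hu
  let v := Function.update u q0 (u q0 - ∑ b, y b * u b)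
  have hv : ∀ b, b ≠ q0 → v b = u b := fun b hb => Function.update_of_ne hb _ _
  have hv0 : v q0 = u q0 - ∑ b, y b * u b := Function.update_self _ _ _
  have e : ∀ a, ∑ b, M a b * v b = ∑ b, (M a b - y b * M a q0) * u b := by
    intro a
    have e1 : ∑ b, (M a b - y b * M a q0) * u b =
        ∑ b, M a b * u b - M a q0 * ∑ b, y b * u b := by
      rw [Finset.mul_sum, ← Finset.sum_sub_distrib]
      exact Finset.sum_congr rfl fun b _ => by ring
    rw [e1, Fintype.sum_eq_add_sum_subtype_ne _ q0,
      Fintype.sum_eq_add_sum_subtype_ne (fun b => M a b * u b) q0, hv0]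
    have : ∑ b : {b // b ≠ q0}, M a b * v b = ∑ b : {b // b ≠ q0}, M a b * u b :=
      Finset.sum_congr rfl fun b _ => by rw [hv b b.2]
    rw [this]; ring
  have hz := hM v (fun a => (e a).trans (hu a))
  have hu' : ∀ b, b ≠ q0 → u b = 0 := fun b hb => by rw [← hv b hb, hz]; rfl
  ext b
  by_cases hb : b = q0
  · subst hb
    have : ∑ b', y b' * u b' = 0 := Finset.sum_eq_zero fun b' _ => by
      by_cases h : b' = b
      · rw [h, hy]; simp
      · rw [hu' b' h]; simp
    rw [this, hz] at hv0
    simpa using hv0.symm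
  · exact hu' b hb

theorem Inj.scale {M : p → q → ℂ} (hM : Inj M) (r : p → ℂ) (hr : ∀ a, r a ≠ 0) :
    Inj (fun a b => r a * M a b) := by
  intro u hu
  refine hM u fun a => ?_
  have := hu a
  simp only [mul_assoc] at this
  rw [← Finset.mul_sum] at this
  exact (mul_eq_zero.1 this).resolve_left (hr a)

theorem Inj.two {M : p → q → ℂ} (hM : Inj M) {p0 p1 : p} (hp : p1 ≠ p0) (α β γ δ : ℂ)
    (hd : α * δ - β * γ ≠ 0) :
    Inj (fun a b => if a = p0 then α * M p0 b + β * M p1 b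
      else if a = p1 then γ * M p0 b + δ * M p1 b else M a b) := by
  intro u hu
  apply hM
  have lin : ∀ s t : ℂ, ∑ b, (s * M p0 b + t * M p1 b) * u b =
      s * ∑ b, M p0 b * u b + t * ∑ b, M p1 b * u b := by
    intro s t
    rw [Finset.mul_sum, Finset.mul_sum, ← Finset.sum_add_distrib]
    exact Finset.sum_congr rfl fun b _ => by ring
  have h0 := hu p0
  have h1 := hu p1
  simp only [if_true] at h0
  simp only [if_neg hp, if_true] at h1
  rw [lin] at h0 h1
  intro a
  by_cases ha : a = p0
  · subst ha
    refine (mul_eq_zero.1 ?_).resolve_left hd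
    linear_combination δ * h0 - β * h1
  by_cases ha' : a = p1
  · subst ha'
    refine (mul_eq_zero.1 ?_).resolve_left hd
    linear_combination α * h1 - γ * h0
  have := hu a
  simpa only [if_neg ha, if_neg ha'] using this

/-- clearing row and column -/
noncomputable def clr (p0 : p) (q0 : q) (s : ℝ) (M : p → q → ℂ) : p → q → ℂ := fun a b =>
  (M a b - (if a = p0 then 0 else s * (M a q0 / M p0 q0)) * M p0 b) -
    (if b = q0 then 0 else s * (M p0 b / M p0 q0)) *
    (M a q0 - (if a = p0 then 0 else s * (M a q0 / M p0 q0)) * M p0 q0)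

theorem Inj.clr {M : p → q → ℂ} (hM : Inj M) (p0 : p) (q0 : q) (s : ℝ) : Inj (clr p0 q0 s M) :=
  (hM.rowop p0 (fun a => if a = p0 then 0 else s * (M a q0 / M p0 q0)) (by simp)).colop q0
    (fun b => if b = q0 then 0 else s * (M p0 b / M p0 q0)) (by simp)

/-- `M` is block diagonal -/
def Blk (p0 : p) (q0 : q) (M : p → q → ℂ) : Prop :=
  (∀ a, a ≠ p0 → M a q0 = 0) ∧ (∀ b, b ≠ q0 → M p0 b = 0)

theorem clr_zero (p0 : p) (q0 : q) (M : p → q → ℂ) : clr p0 q0 0 M = M := by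
  ext a b; simp [PiW.clr]

theorem clr_blk {p0 : p} {q0 : q} {M : p → q → ℂ} (h : Blk p0 q0 M) (s : ℝ) :
    clr p0 q0 s M = M := by
  ext a b
  simp only [PiW.clr]
  by_cases ha : a = p0 <;> by_cases hb : b = q0
  · simp [ha, hb]
  · simp [ha, hb, h.2 b hb]
  · simp [ha, hb, h.1 a ha]
  · simp [ha, hb, h.1 a ha, h.2 b hb]

theorem blk_clr {p0 : p} {q0 : q} {M : p → q → ℂ} (h : M p0 q0 ≠ 0) : Blk p0 q0 (clr p0 q0 1 M) := by
  constructor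
  · intro a ha
    simp only [PiW.clr, if_neg ha, if_true]
    field_simp
    simp
  · intro b hb
    simp only [PiW.clr, if_neg hb, if_true]
    field_simp
    simp

theorem clr_corner {p0 : p} {q0 : q} {M : p → q → ℂ} (s : ℝ) : clr p0 q0 s M p0 q0 = M p0 q0 := by
  simp [PiW.clr]

/-- rotating the corner into another row -/
noncomputable def rot (p0 p1 : p) (l : ℂ) (c s : ℝ) (M : p → q → ℂ) : p → q → ℂ := fun a b =>
  if a = p0 then (l * c ^ 2 + s ^ 2) * M p0 b + ((l - 1) * c * s) * M p1 b
      else if a = p1 then ((l - 1) * c * s) * M p0 b + (l * s ^ 2 + c ^ 2) * M p1 b else M a b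

theorem Inj.rot {M : p → q → ℂ} (hM : Inj M) {p0 p1 : p} (hp : p1 ≠ p0) {l : ℂ} (hl : l ≠ 0) {c s : ℝ}
    (h : c ^ 2 + s ^ 2 = 1) : Inj (rot p0 p1 l c s M) := by
  refine hM.two hp _ _ _ _ ?_
  have h' : (c : ℂ) ^ 2 + (s : ℂ) ^ 2 = 1 := by exact_mod_cast h
  have : (l * (c : ℂ) ^ 2 + (s : ℂ) ^ 2) * (l * (s : ℂ) ^ 2 + (c : ℂ) ^ 2) -
    (l - 1) * c * s * ((l - 1) * c * s) = l * ((c : ℂ) ^ 2 + (s : ℂ) ^ 2) ^ 2 := by ring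
  rw [this, h']
  simpa using hl

theorem rot_one {p0 p1 : p} {c s : ℝ} (h : c ^ 2 + s ^ 2 = 1) (M : p → q → ℂ) :
    rot p0 p1 1 c s M = M := by
  have h' : (c : ℂ) ^ 2 + (s : ℂ) ^ 2 = 1 := by exact_mod_cast h
  have h'' : (s : ℂ) ^ 2 + (c : ℂ) ^ 2 = 1 := by rw [add_comm, h']
  ext a b
  simp only [PiW.rot]
  split_ifs with h1 h2
  · subst h1; simp [h']
  · subst h2; simp [h'']
  · rfl

end OneMatrix
end PiW
end

section
open Set Topology Filter
set_option linter.unusedSectionVars false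
namespace PiW

section Reduct

variable {ι : Type*} [Fintype ι] {P Q : ι → Type} [∀ i, Fintype (P i)] [∀ i, Fintype (Q i)]

/-- remove one index -/
abbrev Rem {ι : Type*} (P : ι → Type) (i0 : ι) (p0 : P i0) : ι → Type := fun i =>
  {a : P i // (⟨i, a⟩ : Σ i, P i) ≠ ⟨i0, p0⟩}

open Classical in
/-- block embedding -/
noncomputable def emb (i0 : ι) (p0 : P i0) (q0 : Q i0) (A : VV (Rem P i0 p0) (Rem Q i0 q0)) :
    VV P Q := fun i a b =>
  if ha : (⟨i, a⟩ : Σ i, P i) ≠ ⟨i0, p0⟩ then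
    if hb : (⟨i, b⟩ : Σ i, Q i) ≠ ⟨i0, q0⟩ then A i ⟨a, ha⟩ ⟨b, hb⟩ else 0
  else if (⟨i, b⟩ : Σ i, Q i) ≠ ⟨i0, q0⟩ then 0 else 1

theorem emb_continuous (i0 : ι) (p0 : P i0) (q0 : Q i0) : Continuous (emb i0 p0 q0) := by
  unfold emb
  refine continuous_pi fun i => continuous_pi fun a => continuous_pi fun b => ?_
  split_ifs <;> fun_prop

open Classical in
theorem emb_inj (i0 : ι) (p0 : P i0) (q0 : Q i0) (A : VV (Rem P i0 p0) (Rem Q i0 q0)) (i : ι) :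
    Inj (emb i0 p0 q0 A i) ↔ Inj (A i) := by
  have key : ∀ (u : Q i → ℂ) (a : Rem P i0 p0 i), ∑ b, emb i0 p0 q0 A i a b * u b =
      ∑ b : Rem Q i0 q0 i, A i a b * u b := by
    intro u a
    rw [← Fintype.sum_subtype_add_sum_subtype
      (fun b : Q i => (⟨i, b⟩ : Σ i, Q i) ≠ ⟨i0, q0⟩) (fun b => emb i0 p0 q0 A i a b * u b)]
    have h0 : ∑ b : {b : Q i // ¬ ((⟨i, b⟩ : Σ i, Q i) ≠ ⟨i0, q0⟩)},
        emb i0 p0 q0 A i a b * u b = 0 := by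
      refine Finset.sum_eq_zero fun b _ => ?_
      simp only [emb]
      rw [dif_pos a.2, dif_neg b.2, zero_mul]
    rw [h0, add_zero]
    refine Finset.sum_congr rfl fun b _ => ?_
    simp only [emb]
    rw [dif_pos a.2, dif_pos b.2]
  constructor
  · intro h v hv
    let u : Q i → ℂ := fun b => if h : (⟨i, b⟩ : Σ i, Q i) ≠ ⟨i0, q0⟩ then v ⟨b, h⟩ else 0
    have hu : ∀ b : Rem Q i0 q0 i, u b = v b := fun b => by simp only [u]; rw [dif_pos b.2]
    have := h u (fun a => by
      by_cases ha : (⟨i, a⟩ : Σ i, P i) ≠ ⟨i0, p0⟩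
      · have := key u ⟨a, ha⟩
        simp only at this
        rw [this, ← hv ⟨a, ha⟩]
        simp only [hu]
      · refine Finset.sum_eq_zero fun b _ => ?_
        simp only [emb, dif_neg ha, u]
        split_ifs <;> simp)
    ext b
    rw [← hu, this]; rfl
  · intro h u hu
    have h1 := h (fun b => u b) (fun a => by rw [← key u a, hu])
    ext b
    by_cases hb : (⟨i, b⟩ : Σ i, Q i) ≠ ⟨i0, q0⟩
    · exact congrFun h1 ⟨b, hb⟩
    · have hb' := hb
      rw [not_ne_iff, Sigma.mk.injEq] at hb
      obtain ⟨rfl, hb⟩ := hb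
      obtain rfl := eq_of_heq hb
      have := hu p0
      rw [Finset.sum_eq_single b] at this
      · simpa [emb] using this
      · intro b' _ hne
        have : u b' = 0 := congrFun h1 ⟨b', by simpa using hne⟩
        rw [this, mul_zero]
      · simp

open Classical in
theorem emb_mem (i0 : ι) (p0 : P i0) (q0 : Q i0) (A : VV (Rem P i0 p0) (Rem Q i0 q0)) :
    emb i0 p0 q0 A ∈ (DD P Q)ᶜ ↔ A ∈ (DD (Rem P i0 p0) (Rem Q i0 q0))ᶜ := by
  rw [mem_DDc, mem_DDc]
  exact exists_congr fun i => emb_inj i0 p0 q0 A i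

theorem emb_rst (i0 : ι) (p0 : P i0) (q0 : Q i0) (A : VV P Q) (h1 : A i0 p0 q0 = 1)
    (h : Blk p0 q0 (A i0)) : emb i0 p0 q0 (fun i a b => A i a.1 b.1) = A := by
  ext i a b
  simp only [emb]
  split_ifs with ha hb hb
  · rfl
  · rw [not_ne_iff, Sigma.mk.injEq] at hb
    obtain ⟨rfl, hb⟩ := hb
    obtain rfl := eq_of_heq hb
    exact (h.1 a (by simpa using ha)).symm
  · rw [not_ne_iff, Sigma.mk.injEq] at ha
    obtain ⟨rfl, ha⟩ := ha
    obtain rfl := eq_of_heq ha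
    exact (h.2 b (by simpa using hb)).symm
  · rw [not_ne_iff, Sigma.mk.injEq] at ha hb
    obtain ⟨rfl, ha⟩ := ha
    obtain rfl := eq_of_heq ha
    obtain ⟨-, hb⟩ := hb
    obtain rfl := eq_of_heq hb
    exact h1.symm

theorem emb_corner (i0 : ι) (p0 : P i0) (q0 : Q i0) (A : VV (Rem P i0 p0) (Rem Q i0 q0)) :
    emb i0 p0 q0 A i0 p0 q0 = 1 := by simp [emb]

theorem emb_blk (i0 : ι) (p0 : P i0) (q0 : Q i0) (A : VV (Rem P i0 p0) (Rem Q i0 q0)) :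
    Blk p0 q0 (emb i0 p0 q0 A i0) := by
  constructor
  · intro a ha; simp [emb, ha]
  · intro b hb; simp [emb, hb]

theorem rst_emb (i0 : ι) (p0 : P i0) (q0 : Q i0) (A : VV (Rem P i0 p0) (Rem Q i0 q0)) :
    (fun i a b => emb i0 p0 q0 A i a.1 b.1) = A := by
  ext i a b
  simp only [emb]
  rw [dif_pos a.2, dif_pos b.2]

open Classical in
theorem update_mem {A : VV P Q} (hA : A ∈ (DD P Q)ᶜ) {i0 : ι} {M : P i0 → Q i0 → ℂ}
    (h : Inj (A i0) → Inj M) : Function.update A i0 M ∈ (DD P Q)ᶜ := by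
  obtain ⟨i, hi⟩ := mem_DDc.1 hA
  refine mem_DDc.2 ⟨i, ?_⟩
  by_cases hh : i = i0
  · subst hh; rw [Function.update_self]; exact h hi
  · rw [Function.update_of_ne hh]; exact hi

theorem cos_sin_end : Real.cos (Real.pi / 2 * ((1 : unitInterval) : ℝ)) = 0 ∧
    Real.sin (Real.pi / 2 * ((1 : unitInterval) : ℝ)) = 1 := by
  simp

open Classical in
theorem emb_surj {n : ℕ} (i0 : ι) (p0 p1 : P i0) (q0 : Q i0) (hp : p1 ≠ p0)
    (b' : ((DD (Rem P i0 p0) (Rem Q i0 q0))ᶜ : Set _))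
    (b : ((DD P Q)ᶜ : Set _)) (hb : b.1 = emb i0 p0 q0 b'.1) (f : GenLoop (Fin n) ((DD P Q)ᶜ : Set _) b)
    (hf : ∀ t, (f t).1 i0 p0 q0 ≠ 0) :
    ∃ g : GenLoop (Fin n) ((DD (Rem P i0 p0) (Rem Q i0 q0))ᶜ : Set _) b',
      ∃ h : GenLoop (Fin n) ((DD P Q)ᶜ : Set _) b,
        (∀ t, (h t).1 = emb i0 p0 q0 (g t).1) ∧ GenLoop.Homotopic f h := by
  have hbd : ∀ t ∈ Cube.boundary (Fin n), (f t).1 = emb i0 p0 q0 b'.1 := fun t ht => by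
    rw [loop_boundary f ht, hb]
  have hfc := loop_continuous' f
  have hfc' : ∀ a b, Continuous fun t => (f t).1 i0 a b := fun a b =>
    (continuous_apply_apply a b).comp ((continuous_apply i0).comp hfc)
  -- first homotopy
  let H1 : unitInterval × (Fin n → unitInterval) → VV P Q := fun p =>
    Function.update (f p.2).1 i0 (clr p0 q0 (p.1 : ℝ) ((f p.2).1 i0))
  have hclr : Continuous fun p : unitInterval × (Fin n → unitInterval) =>
      clr p0 q0 (p.1 : ℝ) ((f p.2).1 i0) := by
    refine continuous_pi fun a => continuous_pi fun b => ?_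
    simp only [clr]
    have h1 : ∀ a b, Continuous fun p : unitInterval × (Fin n → unitInterval) =>
      (f p.2).1 i0 a b := fun a b => (hfc' a b).comp continuous_snd
    have h2 : Continuous fun p : unitInterval × (Fin n → unitInterval) => (((p.1 : ℝ)) : ℂ) := by
      fun_prop
    have h3 : ∀ a b, Continuous fun p : unitInterval × (Fin n → unitInterval) =>
      (((p.1 : ℝ)) : ℂ) * ((f p.2).1 i0 a b / (f p.2).1 i0 p0 q0) := fun a b =>
      h2.mul ((h1 a b).div (h1 p0 q0) (fun p => hf p.2))
    have h4 : Continuous fun p : unitInterval × (Fin n → unitInterval) =>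
        (if a = p0 then 0 else (((p.1 : ℝ)) : ℂ) * ((f p.2).1 i0 a q0 / (f p.2).1 i0 p0 q0)) := by
      split_ifs
      · exact continuous_const
      · exact h3 _ _
    have h5 : Continuous fun p : unitInterval × (Fin n → unitInterval) =>
        (if b = q0 then 0 else (((p.1 : ℝ)) : ℂ) * ((f p.2).1 i0 p0 b / (f p.2).1 i0 p0 q0)) := by
      split_ifs
      · exact continuous_const
      · exact h3 _ _
    exact ((h1 a b).sub (h4.mul (h1 p0 b))).sub (h5.mul ((h1 a q0).sub (h4.mul (h1 p0 q0))))
  have hH1c : Continuous H1 := (hfc.comp continuous_snd).update i0 hclr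
  have hH1W : ∀ p, H1 p ∈ (DD P Q)ᶜ := fun p => update_mem (f p.2).2 fun h => h.clr _ _ _
  have hH1b : ∀ s, ∀ t ∈ Cube.boundary (Fin n), H1 (s, t) = b := by
    intro s t ht
    simp only [H1]
    rw [hbd t ht, clr_blk (emb_blk i0 p0 q0 _), Function.update_eq_self, hb]
  let g1 : GenLoop (Fin n) ((DD P Q)ᶜ : Set _) b := mkLoop (fun t => H1 (1, t))
    (hH1c.comp (by fun_prop)) (fun t => hH1W _) (fun t ht => hH1b 1 t ht)
  have hom1 : GenLoop.Homotopic f g1 := by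
    refine homotopic_of_family f g1 H1 hH1c (fun t => ?_) (fun t => rfl) hH1W hH1b
    simp only [H1, Icc.coe_zero]
    rw [clr_zero, Function.update_eq_self]
  -- second homotopy
  let K : (Fin n → unitInterval) → P i0 → Q i0 → ℂ := fun t a b =>
    (if a = p0 then ((f t).1 i0 p0 q0)⁻¹ else 1) * clr p0 q0 1 ((f t).1 i0) a b
  have hKc : Continuous K := by
    refine continuous_pi fun a => continuous_pi fun b => ?_
    have h1 : Continuous fun t => clr p0 q0 1 ((f t).1 i0) a b := by
      have := hclr.comp (f := fun t => ((1 : unitInterval), t)) (by fun_prop)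
      simp only [Function.comp_def, Icc.coe_one] at this
      exact (continuous_apply_apply a b).comp this
    refine Continuous.mul ?_ h1
    split_ifs
    · exact (hfc' p0 q0).inv₀ hf
    · exact continuous_const
  let H2 : unitInterval × (Fin n → unitInterval) → VV P Q := fun p =>
    Function.update (f p.2).1 i0 (rot p0 p1 ((f p.2).1 i0 p0 q0) (Real.cos (Real.pi / 2 * p.1))
      (Real.sin (Real.pi / 2 * p.1)) (K p.2))
  have hH2c : Continuous H2 := by
    refine (hfc.comp continuous_snd).update i0 ?_
    refine continuous_pi fun a => continuous_pi fun b => ?_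
    simp only [rot]
    have h1 : ∀ a b, Continuous fun p : unitInterval × (Fin n → unitInterval) => K p.2 a b :=
      fun a b => (continuous_apply_apply a b).comp (hKc.comp continuous_snd)
    have h2 : Continuous fun p : unitInterval × (Fin n → unitInterval) =>
      (f p.2).1 i0 p0 q0 := (hfc' p0 q0).comp continuous_snd
    have hc : Continuous fun p : unitInterval × (Fin n → unitInterval) =>
      ((Real.cos (Real.pi / 2 * p.1) : ℝ) : ℂ) := by fun_prop
    have hs : Continuous fun p : unitInterval × (Fin n → unitInterval) =>
      ((Real.sin (Real.pi / 2 * p.1) : ℝ) : ℂ) := by fun_prop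
    split_ifs
    · exact (((h2.mul (hc.pow 2)).add (hs.pow 2)).mul (h1 p0 b)).add
        ((((h2.sub continuous_const).mul hc).mul hs).mul (h1 p1 b))
    · exact ((((h2.sub continuous_const).mul hc).mul hs).mul (h1 p0 b)).add
        (((h2.mul (hs.pow 2)).add (hc.pow 2)).mul (h1 p1 b))
    · exact h1 a b
  have hH2W : ∀ p, H2 p ∈ (DD P Q)ᶜ := fun p => update_mem (f p.2).2 fun h =>
    ((h.clr p0 q0 1).scale (fun a => if a = p0 then ((f p.2).1 i0 p0 q0)⁻¹ else 1) (fun a => by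
      split_ifs
      · exact inv_ne_zero (hf _)
      · exact one_ne_zero)).rot hp (hf _) (Real.cos_sq_add_sin_sq _)
  have hH2b : ∀ s, ∀ t ∈ Cube.boundary (Fin n), H2 (s, t) = b := by
    intro s t ht
    have : K t = (f t).1 i0 := by
      ext a b
      simp only [K]
      rw [hbd t ht, clr_blk (emb_blk i0 p0 q0 _), emb_corner]
      simp
    simp only [H2]
    rw [this, hbd t ht, emb_corner, rot_one (Real.cos_sq_add_sin_sq _), Function.update_eq_self, hb]
  let g2 : GenLoop (Fin n) ((DD P Q)ᶜ : Set _) b := mkLoop (fun t => H2 (1, t))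
    (hH2c.comp (by fun_prop)) (fun t => hH2W _) (fun t ht => hH2b 1 t ht)
  have hom2 : GenLoop.Homotopic g1 g2 := by
    refine homotopic_of_family g1 g2 H2 hH2c (fun t => ?_) (fun t => rfl) hH2W hH2b
    simp only [g1, mkLoop_apply, H1, H2]
    congr 1
    ext a b
    have h0 := hf t
    simp only [rot, K]
    by_cases ha : a = p0
    · subst ha; simp; field_simp
    · by_cases ha' : a = p1
      · subst ha'; simp [ha]
      · simp [ha, ha']
  have hemb : ∀ t, emb i0 p0 q0 (fun i a b => H2 (1, t) i a.1 b.1) = H2 (1, t) := by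
    intro t
    have hblk := blk_clr (hf t)
    have e : H2 (1, t) i0 = fun a b => (if a = p1 then (f t).1 i0 p0 q0 else 1) * K t a b := by
      simp only [H2, Function.update_self]
      ext a b
      simp only [rot, cos_sin_end]
      by_cases ha : a = p0
      · subst ha; simp [hp.symm]
      · by_cases ha' : a = p1
        · subst ha'; simp [ha]
        · simp [ha, ha']
    refine emb_rst i0 p0 q0 _ ?_ ⟨fun a ha => ?_, fun b hb => ?_⟩
    · rw [e]
      simp [hp.symm, K, clr_corner, hf t]
    · rw [e]; simp [K, hblk.1 a ha]
    · rw [e]; simp [K, hblk.2 b hb]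
  refine ⟨mkLoop (fun t i a b => H2 (1, t) i a.1 b.1) ?_ ?_ ?_, g2, ?_, hom1.trans hom2⟩
  · have : Continuous fun t => H2 (1, t) := hH2c.comp (by fun_prop)
    refine continuous_pi fun i => continuous_pi fun a => continuous_pi fun b => ?_
    exact (continuous_apply_apply a.1 b.1).comp ((continuous_apply i).comp this)
  · intro t
    rw [← emb_mem, hemb]
    exact hH2W _
  · intro t ht
    rw [hH2b 1 t ht, hb]
    exact rst_emb i0 p0 q0 _
  · intro t
    simp only [mkLoop_apply]
    rw [hemb]
    rfl

theorem card_rem [DecidableEq ι] (i0 : ι) (p0 : P i0) (i : ι) [Fintype (Rem P i0 p0 i)] :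
    Fintype.card (Rem P i0 p0 i) = if i = i0 then Fintype.card (P i) - 1 else Fintype.card (P i) := by
  classical
  split_ifs with h
  · subst h
    have e : Rem P i p0 i ≃ {a : P i // a ≠ p0} := Equiv.subtypeEquivRight fun a => by simp
    rw [Fintype.card_congr e]
    simp
  · have e : Rem P i0 p0 i ≃ P i := Equiv.subtypeUnivEquiv fun a => by simp [h]
    exact Fintype.card_congr e

open Classical in
theorem cyclic_step {k : ℕ} (hq : ∀ i, 1 ≤ Fintype.card (Q i))
    (hpq : ∀ i, Fintype.card (Q i) ≤ Fintype.card (P i))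
    (hk : k + 1 + 1 = 2 * cc P Q)
    (i0 : ι) (p0 p1 : P i0) (q0 q1 : Q i0) (hp : p1 ≠ p0) (hqq : q1 ≠ q0)
    (b' : ((DD (Rem P i0 p0) (Rem Q i0 q0))ᶜ : Set _))
    (H : IsCyclic (HomotopyGroup (Fin (k + 1)) ((DD (Rem P i0 p0) (Rem Q i0 q0))ᶜ : Set _) b')) :
    ∃ b : ((DD P Q)ᶜ : Set _), IsCyclic (HomotopyGroup (Fin (k + 1)) ((DD P Q)ᶜ : Set _) b) := by
  let b : ((DD P Q)ᶜ : Set _) := ⟨emb i0 p0 q0 b'.1, (emb_mem i0 p0 q0 _).2 b'.2⟩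
  let φ : C(((DD (Rem P i0 p0) (Rem Q i0 q0))ᶜ : Set _), ((DD P Q)ᶜ : Set _)) :=
    ⟨fun A => ⟨emb i0 p0 q0 A.1, (emb_mem i0 p0 q0 _).2 A.2⟩,
      ((emb_continuous i0 p0 q0).comp continuous_subtype_val).subtype_mk _⟩
  refine ⟨b, isCyclic_of_surjective (mapHom (N := Fin (k + 1)) φ (y := b) rfl) ?_⟩
  intro z
  obtain ⟨f, rfl⟩ := cls_surj z
  have hdim := dE_add hq hpq
  have hdE : 2 ≤ dE P Q := by
    have h1 : 2 ≤ Fintype.card (Q i0) := Fintype.one_lt_card_iff.2 ⟨q1, q0, hqq⟩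
    have h2 : 2 * ((Fintype.card (P i0) + 1) * (Fintype.card (Q i0) - 1)) ≤ dE P Q :=
      Finset.single_le_sum (f := fun i => 2 * ((Fintype.card (P i) + 1) * (Fintype.card (Q i) - 1)))
        (fun _ _ => Nat.zero_le _) (Finset.mem_univ i0)
    have h3 : 1 ≤ (Fintype.card (P i0) + 1) * (Fintype.card (Q i0) - 1) :=
      Nat.one_le_iff_ne_zero.2 (Nat.mul_ne_zero (by omega) (by omega))
    omega
  obtain ⟨g, hg, hgZ⟩ := move_off (n := k + 1) isClosed_DD (isClosed_ZZ i0 p0 q0) thin_DD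
    (thin_ZZ (d := Module.finrank ℝ (VV P Q) - 2) i0 p0 q0 (by omega))
    (thin_DZ (d := dE P Q - 2) i0 p0 q0 q1 hqq (by omega)) (by omega) (by omega) b
    (by
      change ¬ (emb i0 p0 q0 b'.1 i0 p0 q0 = 0)
      rw [emb_corner]; exact one_ne_zero) f
  obtain ⟨g', h, hh, hgh⟩ := emb_surj i0 p0 p1 q0 hp b' b rfl g hgZ
  refine ⟨cls g', ?_⟩
  rw [mapHom_cls, cls_eq]
  have : mapLoop φ rfl g' = h := by
    ext t : 1
    exact Subtype.ext (hh t).symm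
  rw [this]
  exact (hg.trans hgh).symm

theorem cyclic_base {k : ℕ} [Nonempty ι] (hq : ∀ i, Fintype.card (Q i) = 1)
    (hpq : ∀ i, Fintype.card (Q i) ≤ Fintype.card (P i))
    (hk : k + 1 + 1 = 2 * cc P Q) :
    ∃ b : ((DD P Q)ᶜ : Set _), IsCyclic (HomotopyGroup (Fin (k + 1)) ((DD P Q)ᶜ : Set _) b) := by
  classical
  obtain ⟨S, hS⟩ := exists_std (P := P) (Q := Q) hpq
  have hfr : Module.finrank ℝ (VV P Q) = k + 2 := by
    rw [finrank_VV]
    simp only [hq]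
    rw [show k + 2 = 2 * cc P Q from hk, cc, Finset.mul_sum]
    refine Finset.sum_congr rfl fun i _ => ?_
    have := hpq i
    rw [hq] at this ⊢
    omega
  have hD : DD P Q = {0} := by
    ext A
    rw [mem_singleton_iff]
    constructor
    · intro h
      ext i a b
      obtain ⟨u, hu0, hu⟩ := h i
      have hsub : Subsingleton (Q i) := Fintype.card_le_one_iff_subsingleton.1 (hq i).le
      have : Unique (Q i) := ⟨⟨b⟩, fun x => Subsingleton.elim _ _⟩
      have h1 := hu a
      rw [Fintype.sum_eq_single b (fun b' hb' => (hb' (Subsingleton.elim _ _)).elim)] at h1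
      refine (mul_eq_zero.1 h1).resolve_right fun h2 => hu0 ?_
      ext b'
      rw [Subsingleton.elim b' b, h2]; rfl
    · rintro rfl i
      have hne : Nonempty (Q i) := Fintype.card_pos_iff.1 (by rw [hq]; exact one_pos)
      exact ⟨fun _ => 1, fun h => one_ne_zero (congrFun h (Classical.arbitrary _)), by simp⟩
  have hSW : S ∈ (DD P Q)ᶜ := mem_DDc.2 ⟨Classical.arbitrary ι, hS _⟩
  have hS0 : S ∈ ({0}ᶜ : Set (VV P Q)) := by rw [← hD]; exact hSW
  have key : ∃ b : ({0}ᶜ : Set (VV P Q)),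
      IsCyclic (HomotopyGroup (Fin (k + 1)) ({0}ᶜ : Set (VV P Q)) b) := by
    let E := Fin (k + 2) → ℝ
    let b0 : ({0}ᶜ : Set E) := ⟨fun _ => 1, fun h => one_ne_zero (congrFun h 0)⟩
    exact ⟨⟨S, hS0⟩, punc_cyclic_congr (V := E) (by simp [E, hfr]) k b0 _
      (sphere_cyclic k E (by simp [E]) b0)⟩
  rw [hD]
  exact key

theorem cyclic_all [Nonempty ι] (k : ℕ) : ∀ (N : ℕ) (P Q : ι → Type) (_ : ∀ i, Fintype (P i))
    (_ : ∀ i, Fintype (Q i)) (_ : ∀ i, 1 ≤ Fintype.card (Q i))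
    (_ : ∀ i, Fintype.card (Q i) ≤ Fintype.card (P i))
    (_ : k + 1 + 1 = 2 * cc P Q) (_ : ∑ i, Fintype.card (Q i) = N),
    ∃ b : ((DD P Q)ᶜ : Set _), IsCyclic (HomotopyGroup (Fin (k + 1)) ((DD P Q)ᶜ : Set _) b) := by
  classical
  intro N
  induction N with
  | zero =>
    intro P Q _ _ hq _ _ h
    have := Finset.sum_eq_zero_iff.1 h (Classical.arbitrary ι) (Finset.mem_univ _)
    have := hq (Classical.arbitrary ι)
    omega
  | succ N ih =>
    intro P Q _ _ hq hpq hk h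
    by_cases h1 : ∀ i, Fintype.card (Q i) = 1
    · exact cyclic_base h1 hpq hk
    · push Not at h1
      obtain ⟨i0, hi0⟩ := h1
      have h2 : 1 < Fintype.card (Q i0) := lt_of_le_of_ne (hq i0) (Ne.symm hi0)
      obtain ⟨q1, q0, hqq⟩ := Fintype.one_lt_card_iff.1 h2
      obtain ⟨p1, p0, hpp⟩ := Fintype.one_lt_card_iff.1 (h2.trans_le (hpq i0))
      have hP := card_rem (P := P) i0 p0
      have hQ := card_rem (P := Q) i0 q0
      have g1 : ∀ i, 1 ≤ Fintype.card (Rem Q i0 q0 i) := by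
        intro i
        rw [hQ]
        split_ifs with hi
        · subst hi; omega
        · exact hq i
      have g2 : ∀ i, Fintype.card (Rem Q i0 q0 i) ≤ Fintype.card (Rem P i0 p0 i) := by
        intro i
        rw [hQ, hP]
        have := hpq i
        split_ifs <;> omega
      have g3 : k + 1 + 1 = 2 * cc (Rem P i0 p0) (Rem Q i0 q0) := by
        rw [hk]
        congr 1
        refine Finset.sum_congr rfl fun i _ => ?_
        rw [hQ, hP]
        have := hpq i
        split_ifs with hi
        · subst hi; omega
        · rfl
      have g4 : ∑ i, Fintype.card (Rem Q i0 q0 i) = N := by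
        have e : ∑ i, Fintype.card (Q i) = ∑ i, (Fintype.card (Rem Q i0 q0 i) +
            if i = i0 then 1 else 0) := by
          refine Finset.sum_congr rfl fun i _ => ?_
          rw [hQ]
          split_ifs with hi
          · subst hi; omega
          · rfl
        rw [e, Finset.sum_add_distrib] at h
        simp only [Finset.sum_ite_eq', Finset.mem_univ, if_true] at h
        omega
      obtain ⟨b', hb'⟩ := ih (Rem P i0 p0) (Rem Q i0 q0) (fun i => inferInstance)
        (fun i => inferInstance) g1 g2 g3 g4
      refine cyclic_step hq hpq hk i0 p0 p1 q0 q1 hpp hqq b' ?_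
      convert hb'

end Reduct
end PiW
end

section
open Set Topology Filter MeasureTheory
set_option linter.unusedSectionVars false
namespace PiW

section Inv

/-- standard basis -/
noncomputable def sb {m : ℕ} (j : Fin m) : Fin m → ℝ := Pi.single j 1

/-- the volume form -/
noncomputable def vol (m : ℕ) : (Fin m → ℝ) [⋀^Fin m]→L[ℝ] ℝ :=
  { (Matrix.detRowAlternating : (Fin m → ℝ) [⋀^Fin m]→ₗ[ℝ] ℝ) with
    cont := by
      change Continuous fun v : Fin m → Fin m → ℝ => Matrix.det (Matrix.of v)
      exact Continuous.matrix_det continuous_id }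

theorem vol_apply {m : ℕ} (v : Fin m → Fin m → ℝ) : vol m v = Matrix.det (Matrix.of v) := rfl

theorem contDiff_det {m : ℕ} {E : Type*} [NormedAddCommGroup E] [NormedSpace ℝ E]
    {k : WithTop ℕ∞} (M : E → Fin m → Fin m → ℝ) (hM : ∀ i j, ContDiff ℝ k fun x => M x i j) :
    ContDiff ℝ k fun x => Matrix.det (Matrix.of (M x)) := by
  simp only [Matrix.det_apply]
  refine ContDiff.sum fun σ _ => ?_
  have : ContDiff ℝ k fun x => ∏ i, Matrix.of (M x) (σ i) i :=
    contDiff_prod fun i _ => hM _ _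
  rcases Int.units_eq_one_or (Equiv.Perm.sign σ) with h | h <;> simp only [h]
  · simpa using this
  · simpa using this.neg

/-- Jacobian determinant -/
noncomputable def Jac {m : ℕ} (F : (Fin m → ℝ) → Fin m → ℝ) (y : Fin m → ℝ) : ℝ :=
  Matrix.det (Matrix.of fun j => fderiv ℝ F y (sb j))

theorem Jac_continuous {m : ℕ} {F : (Fin m → ℝ) → Fin m → ℝ}
    (hF : ContDiff ℝ ((⊤ : ℕ∞) : WithTop ℕ∞) F) : Continuous (Jac F) := by
  have h1 : ContDiff ℝ ((⊤ : ℕ∞) : WithTop ℕ∞) (fderiv ℝ F) := hF.fderiv_right (by simp)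
  refine (contDiff_det (k := ((⊤ : ℕ∞) : WithTop ℕ∞)) (fun y j => fderiv ℝ F y (sb j))
    fun i j => ?_).continuous
  exact (contDiff_apply ℝ ℝ j).comp (h1.clm_apply contDiff_const)

theorem divfree {m : ℕ} (φ : (Fin m → ℝ) → ℝ) (hφ : ContDiff ℝ ((⊤ : ℕ∞) : WithTop ℕ∞) φ)
    (Ψ : (Fin (m + 1) → ℝ) → Fin m → ℝ) (hΨ : ContDiff ℝ ((⊤ : ℕ∞) : WithTop ℕ∞) Ψ)
    (x : Fin (m + 1) → ℝ) :
    ∑ i : Fin (m + 1), (-1 : ℝ) ^ i.val * fderiv ℝ (fun x => φ (Ψ x) *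
      Matrix.det (Matrix.of fun j => fderiv ℝ Ψ x (i.removeNth sb j))) x (sb i) = 0 := by
  let ω : (Fin m → ℝ) → (Fin m → ℝ) [⋀^Fin m]→L[ℝ] ℝ := fun y => φ y • vol m
  have hω : ContDiff ℝ ((⊤ : ℕ∞) : WithTop ℕ∞) ω := hφ.smul contDiff_const
  have hd : ∀ y, DifferentiableAt ℝ ω y := fun y => (hω.differentiable (by simp)) y
  have hpb := extDeriv_pullback (r := ((⊤ : ℕ∞) : WithTop ℕ∞)) (hd (Ψ x)) hΨ.contDiffAt (by
    simp only [minSmoothness_of_isRCLikeNormedField]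
    exact WithTop.coe_le_coe.2 (le_top : (2 : ℕ∞) ≤ ⊤))
  let η : (Fin (m + 1) → ℝ) → (Fin (m + 1) → ℝ) [⋀^Fin m]→L[ℝ] ℝ :=
    fun x => (ω (Ψ x)).compContinuousLinearMap (fderiv ℝ Ψ x)
  have hΨ' : ContDiff ℝ ((⊤ : ℕ∞) : WithTop ℕ∞) (fderiv ℝ Ψ) := hΨ.fderiv_right (by simp)
  have hηd : DifferentiableAt ℝ η x := by
    have h1 : DifferentiableAt ℝ (fun x => ω (Ψ x)) x :=
      ((hω.comp hΨ).differentiable (by simp)) x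
    have h2 : DifferentiableAt ℝ (fderiv ℝ Ψ) x := (hΨ'.differentiable (by simp)) x
    exact h1.continuousAlternatingMapCompContinuousLinearMap h2
  have h1 := extDeriv_apply hηd (sb : Fin (m + 1) → Fin (m + 1) → ℝ)
  have h2 : extDeriv η x (sb : Fin (m + 1) → Fin (m + 1) → ℝ) = 0 := by
    change extDeriv (fun x => (ω (Ψ x)).compContinuousLinearMap (fderiv ℝ Ψ x)) x _ = 0
    rw [hpb]
    refine AlternatingMap.map_linearDependent (extDeriv ω (Ψ x)).toAlternatingMap
      (fun i => fderiv ℝ Ψ x (sb i)) fun h => ?_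
    have := h.fintype_card_le_finrank
    simp at this
  rw [h2] at h1
  rw [h1]
  refine Finset.sum_congr rfl fun i _ => ?_
  rw [zsmul_eq_mul]
  push_cast
  rfl

end Inv
end PiW
end

section
open Set Topology Filter MeasureTheory
set_option linter.unusedSectionVars false
namespace PiW

section Inv

theorem cons_zero_sb {m : ℕ} (j : Fin m) :
    (Fin.cons (0:ℝ) (sb j) : Fin (m+1) → ℝ) = sb j.succ := by
  funext i
  refine Fin.cases ?_ (fun i => ?_) i
  · simp [sb]
  · simp [sb, Pi.single_apply]

theorem hasFDerivAt_slice {m : ℕ} (Ψ : (Fin (m + 1) → ℝ) → Fin m → ℝ)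
    (hΨ : ContDiff ℝ ((⊤ : ℕ∞) : WithTop ℕ∞) Ψ) (s : ℝ) (y : Fin m → ℝ) (j : Fin m) :
    fderiv ℝ (fun y : Fin m → ℝ => Ψ (Fin.cons s y)) y (sb j) =
      fderiv ℝ Ψ (Fin.cons s y) (sb j.succ) := by
  let L : (Fin m → ℝ) →L[ℝ] (Fin (m+1) → ℝ) :=
    ContinuousLinearMap.pi (Fin.cons 0 fun i => ContinuousLinearMap.proj i)
  have hL : ∀ y, L y = Fin.cons 0 y := by
    intro y; funext i
    refine Fin.cases ?_ (fun i => ?_) i <;> simp [L]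
  have h1 : HasFDerivAt (fun y : Fin m → ℝ => (Fin.cons s y : Fin (m+1) → ℝ)) L y := by
    have : (fun y : Fin m → ℝ => (Fin.cons s y : Fin (m+1) → ℝ)) =
        fun y => (Fin.cons s 0 : Fin (m+1) → ℝ) + L y := by
      funext y i
      rw [hL]
      refine Fin.cases ?_ (fun i => ?_) i <;> simp
    rw [this]
    exact L.hasFDerivAt.const_add _
  have h2 : HasFDerivAt Ψ (fderiv ℝ Ψ (Fin.cons s y)) (Fin.cons s y) :=
    ((hΨ.differentiable (by simp)) _).hasFDerivAt
  have h3 : HasFDerivAt (fun y : Fin m → ℝ => Ψ (Fin.cons s y)) _ y := HasFDerivAt.comp y h2 h1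
  rw [h3.fderiv]
  simp [hL, cons_zero_sb]

theorem inv_integral {m : ℕ} (φ : (Fin m → ℝ) → ℝ) (hφ : ContDiff ℝ ((⊤ : ℕ∞) : WithTop ℕ∞) φ)
    (ε : ℝ) (hφs : ∀ y, φ y ≠ 0 → ‖y‖ < ε)
    (Ψ : (Fin (m + 1) → ℝ) → Fin m → ℝ) (hΨ : ContDiff ℝ ((⊤ : ℕ∞) : WithTop ℕ∞) Ψ)
    (hb : ∀ x ∈ Icc (0 : Fin (m+1) → ℝ) 1, ∀ j : Fin m, (x j.succ = 0 ∨ x j.succ = 1) →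
      ε ≤ ‖Ψ x‖) :
    ∫ y in Icc (0 : Fin m → ℝ) 1, φ (Ψ (Fin.cons 0 y)) * Jac (fun y => Ψ (Fin.cons 0 y)) y =
    ∫ y in Icc (0 : Fin m → ℝ) 1, φ (Ψ (Fin.cons 1 y)) * Jac (fun y => Ψ (Fin.cons 1 y)) y := by
  have hΨ' : ContDiff ℝ ((⊤ : ℕ∞) : WithTop ℕ∞) (fderiv ℝ Ψ) := hΨ.fderiv_right (by simp)
  let g : Fin (m+1) → (Fin (m+1) → ℝ) → ℝ := fun i x => φ (Ψ x) *
      Matrix.det (Matrix.of fun j => fderiv ℝ Ψ x (i.removeNth sb j))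
  have hg : ∀ i, ContDiff ℝ ((⊤ : ℕ∞) : WithTop ℕ∞) (g i) := fun i => by
    refine (hφ.comp hΨ).mul (contDiff_det _ fun a b => ?_)
    exact (contDiff_apply ℝ ℝ b).comp (hΨ'.clm_apply contDiff_const)
  let f : Fin (m+1) → (Fin (m+1) → ℝ) → ℝ := fun i x => (-1:ℝ)^i.val * g i x
  let f' : Fin (m+1) → (Fin (m+1) → ℝ) → (Fin (m+1) → ℝ) →L[ℝ] ℝ :=
    fun i x => (-1:ℝ)^i.val • fderiv ℝ (g i) x
  have hz : ∀ x, ∑ i, f' i x (Pi.single i 1) = 0 := fun x => by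
    have := divfree φ hφ Ψ hΨ x
    simpa [f', g, sb] using this
  have key := integral_divergence_of_hasFDerivAt_off_countable' (0 : Fin (m+1) → ℝ) 1
    (fun _ => zero_le_one) f f' ∅ countable_empty
    (fun i => (continuous_const.mul (hg i).continuous).continuousOn)
    (fun x _ i => ((((hg i).differentiable (by simp)) x).hasFDerivAt).const_mul _)
    (by simp only [hz]; exact integrableOn_zero)
  simp only [hz] at key
  rw [Fin.sum_univ_succ, Finset.sum_eq_zero, add_zero] at key
  · simp only [integral_zero] at key
    have e : ∀ (s : ℝ), (∫ (x : Fin m → ℝ) in Icc ((0 : Fin (m+1) → ℝ) ∘ (0 : Fin (m+1)).succAbove)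
        ((1 : Fin (m+1) → ℝ) ∘ (0 : Fin (m+1)).succAbove), f 0 ((0 : Fin (m+1)).insertNth s x)) =
        ∫ y in Icc (0 : Fin m → ℝ) 1, φ (Ψ (Fin.cons s y)) * Jac (fun y => Ψ (Fin.cons s y)) y := by
      intro s
      congr 1
      funext y
      simp only [f, g, Jac, hasFDerivAt_slice Ψ hΨ, Fin.insertNth_zero']
      simp
      exact Or.inl rfl
    have h1 := e 1
    have h0 := e 0
    rw [← h1, ← h0]
    exact (sub_eq_zero.1 key.symm).symm
  · intro i _
    have hv : ∀ s : ℝ, (s = 0 ∨ s = 1) →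
      (∫ (x : Fin m → ℝ) in Icc ((0 : Fin (m+1) → ℝ) ∘ i.succ.succAbove)
        ((1 : Fin (m+1) → ℝ) ∘ i.succ.succAbove), f i.succ (i.succ.insertNth s x)) = 0 := by
      intro s hs
      refine setIntegral_eq_zero_of_forall_eq_zero fun x hx => ?_
      have h1 : (i.succ.insertNth s x : Fin (m+1) → ℝ) ∈ Icc (0 : Fin (m+1) → ℝ) 1 := by
        rw [Fin.insertNth_mem_Icc]
        refine ⟨?_, hx⟩
        rcases hs with rfl | rfl <;> simp
      have h2 := hb _ h1 i (by simpa using hs)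
      have : φ (Ψ (i.succ.insertNth s x)) = 0 := by
        by_contra hne
        exact absurd (hφs _ hne) (not_lt.2 h2)
      simp [f, g, this]
    have h1 := hv 1 (Or.inr rfl)
    have h0 := hv 0 (Or.inl rfl)
    simp only [Pi.one_apply, Pi.zero_apply]
    rw [h1, h0, sub_zero]

end Inv
end PiW
end

section
open Set Topology Filter MeasureTheory
open scoped unitInterval
set_option linter.unusedSectionVars false
namespace PiW

section Pos
variable {m : ℕ}

/-- coercion of a cube point -/
def cI (y : Fin m → I) : Fin m → ℝ := fun i => (y i : ℝ)

theorem cI_continuous : Continuous (cI : (Fin m → I) → Fin m → ℝ) := by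
  unfold cI; fun_prop

theorem cI_mem (y : Fin m → I) : cI y ∈ Icc (0 : Fin m → ℝ) 1 :=
  ⟨fun i => (y i).2.1, fun i => (y i).2.2⟩

theorem exists_cI {x : Fin m → ℝ} (hx : x ∈ Icc (0 : Fin m → ℝ) 1) : ∃ y, cI y = x :=
  ⟨fun i => ⟨x i, hx.1 i, hx.2 i⟩, rfl⟩

/-- admissible weights -/
def Adm (η : ℝ) (φ : (Fin m → ℝ) → ℝ) : Prop :=
  ContDiff ℝ ((⊤ : ℕ∞) : WithTop ℕ∞) φ ∧ (∀ y, 0 ≤ φ y) ∧ 0 < φ 0 ∧ ∀ y, φ y ≠ 0 → ‖y‖ < η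

theorem Adm.mono {η η' : ℝ} (h : η ≤ η') {φ : (Fin m → ℝ) → ℝ} (hφ : Adm η φ) : Adm η' φ :=
  ⟨hφ.1, hφ.2.1, hφ.2.2.1, fun y hy => (hφ.2.2.2 y hy).trans_le h⟩

theorem exists_adm {η : ℝ} (hη : 0 < η) : ∃ φ : (Fin m → ℝ) → ℝ, Adm η φ := by
  let b : ContDiffBump (0 : Fin m → ℝ) := ⟨η/2, η, by positivity, by linarith⟩
  refine ⟨b, b.contDiff, fun y => b.nonneg, ?_, fun y hy => ?_⟩
  · exact b.pos_of_mem_ball (by simpa [b] using hη)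
  · have : y ∈ Function.support b := hy
    rw [b.support_eq] at this
    simpa [b] using this

/-- weighted degree -/
noncomputable def wdeg (φ : (Fin m → ℝ) → ℝ) (P : (Fin m → ℝ) → Fin m → ℝ) : ℝ :=
  ∫ y in Icc (0 : Fin m → ℝ) 1, φ (P y) * Jac P y

/-- positive degree -/
def Pos (F : (Fin m → I) → Fin m → ℝ) : Prop :=
  ∃ η > 0, ∀ φ, Adm η φ → ∀ P : (Fin m → ℝ) → Fin m → ℝ,
    ContDiff ℝ ((⊤ : ℕ∞) : WithTop ℕ∞) P → (∀ y, ‖P (cI y) - F y‖ < η) → 0 < wdeg φ P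

theorem exists_lower {X : Type*} [TopologicalSpace X] [CompactSpace X] {C : Set X}
    (hC : IsClosed C) {F : X → Fin m → ℝ} (hF : Continuous F) (h : ∀ x ∈ C, F x ≠ 0) :
    ∃ ε > 0, ∀ x ∈ C, ε ≤ ‖F x‖ := by
  rcases C.eq_empty_or_nonempty with rfl | hne
  · exact ⟨1, one_pos, by simp⟩
  · obtain ⟨x, hx, hmin⟩ := hC.isCompact.exists_isMinOn hne hF.norm.continuousOn
    exact ⟨‖F x‖, norm_pos_iff.2 (h x hx), fun y hy => hmin hy⟩

theorem isClosed_bdry : IsClosed {y : Fin m → I | ∃ j, y j = 0 ∨ y j = 1} := by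
  simp only [ofPred_exists]
  refine isClosed_iUnion_of_finite fun j => ?_
  exact (isClosed_eq (continuous_apply j) continuous_const).union
    (isClosed_eq (continuous_apply j) continuous_const)

theorem Pos_homotopy (H : I × (Fin m → I) → Fin m → ℝ) (hH : Continuous H)
    (hb : ∀ s y, (∃ j, y j = 0 ∨ y j = 1) → H (s, y) ≠ 0)
    (h0 : Pos fun y => H (0, y)) : Pos fun y => H (1, y) := by
  obtain ⟨ε, hε, hlow⟩ := exists_lower (C := {p : I × (Fin m → I) | p.2 ∈
    {y : Fin m → I | ∃ j, y j = 0 ∨ y j = 1}}) (isClosed_bdry.preimage continuous_snd) hH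
    (fun p hp => hb p.1 p.2 hp)
  obtain ⟨η0, hη0, h0⟩ := h0
  let η := min η0 (ε / 4)
  have hη : 0 < η := lt_min hη0 (by positivity)
  have hη1 : η ≤ η0 := min_le_left _ _
  have hη2 : η ≤ ε / 4 := min_le_right _ _
  refine ⟨η, hη, fun φ hφ P hP hPF => ?_⟩
  obtain ⟨Q, hQ, hQH⟩ := exists_smooth_approx (N := Fin (m+1))
    (fun x : Fin (m+1) → I => H (x 0, Fin.tail x))
    (hH.comp (by unfold Fin.tail; fun_prop)) hη
  have hQ' : ∀ (s : I) (y : Fin m → I), ‖Q (Fin.cons (s:ℝ) (cI y)) - H (s, y)‖ < η := by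
    intro s y
    have := hQH (Fin.cons s y)
    have e : (fun i => (((Fin.cons s y : Fin (m+1) → I) i : I) : ℝ)) = Fin.cons (s:ℝ) (cI y) := by
      funext i
      refine Fin.cases ?_ (fun i => ?_) i <;> simp [cI]
    rw [e] at this
    simpa using this
  let Ψ : (Fin (m+1) → ℝ) → Fin m → ℝ := fun x =>
    Q x + x 0 • (P (fun i => x i.succ) - Q (Fin.cons 1 (fun i => x i.succ)))
  have hΨ : ContDiff ℝ ((⊤ : ℕ∞) : WithTop ℕ∞) Ψ := by
    have ht : ContDiff ℝ ((⊤ : ℕ∞) : WithTop ℕ∞) fun x : Fin (m+1) → ℝ => (fun i : Fin m => x i.succ) :=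
      contDiff_pi.2 fun i => contDiff_apply ℝ ℝ _
    refine hQ.add (ContDiff.smul (contDiff_apply ℝ ℝ 0) ((hP.comp ht).sub (hQ.comp ?_)))
    exact consR_contDiff.comp (contDiff_const.prodMk ht)
  have hΨc : ∀ (s : I) (y : Fin m → I), ‖Ψ (Fin.cons (s:ℝ) (cI y)) - H (s, y)‖ < 3 * η := by
    intro s y
    have e : Ψ (Fin.cons (s:ℝ) (cI y)) - H (s, y) = (Q (Fin.cons (s:ℝ) (cI y)) - H (s, y)) +
      (s:ℝ) • ((P (cI y) - H (1, y)) - (Q (Fin.cons 1 (cI y)) - H (1, y))) := by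
      simp only [Ψ, Fin.cons_zero, Fin.cons_succ]
      have : (fun i => cI y i) = cI y := rfl
      rw [sub_sub_sub_cancel_right]
      abel
    rw [e]
    have h1 := hQ' s y
    have h2 := hPF y
    have h3 : ‖Q (Fin.cons 1 (cI y)) - H (1, y)‖ < η := by simpa using hQ' 1 y
    have h4 : ‖(P (cI y) - H (1, y)) - (Q (Fin.cons 1 (cI y)) - H (1, y))‖ < 2 * η :=
      (norm_sub_le _ _).trans_lt (by linarith)
    have h5 : ‖(s:ℝ) • ((P (cI y) - H (1, y)) - (Q (Fin.cons 1 (cI y)) - H (1, y)))‖ ≤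
        ‖(P (cI y) - H (1, y)) - (Q (Fin.cons 1 (cI y)) - H (1, y))‖ := by
      rw [norm_smul, Real.norm_of_nonneg s.2.1]
      exact mul_le_of_le_one_left (norm_nonneg _) s.2.2
    exact (norm_add_le _ _).trans_lt (by linarith)
  have key := inv_integral φ hφ.1 η hφ.2.2.2 Ψ hΨ (by
    intro x hx j hj
    let s : I := ⟨x 0, hx.1 0, hx.2 0⟩
    let y : Fin m → I := fun i => ⟨x i.succ, hx.1 _, hx.2 _⟩
    have e : x = Fin.cons (s:ℝ) (cI y) := by
      funext i
      refine Fin.cases ?_ (fun i => ?_) i <;> simp [cI, s, y]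
    have h1 := hΨc s y
    have h2 := hlow (s, y) ⟨j, hj.imp (fun h => Subtype.ext h) (fun h => Subtype.ext h)⟩
    rw [e]
    have h3 := norm_sub_norm_le (H (s,y)) (Ψ (Fin.cons (s:ℝ) (cI y)))
    rw [norm_sub_rev] at h3
    linarith)
  have e1 : (fun y : Fin m → ℝ => Ψ (Fin.cons 1 y)) = P := by
    funext y; simp [Ψ]
  have hw := h0 φ (hφ.mono hη1) (fun y => Ψ (Fin.cons 0 y))
    (hΨ.comp (consR_contDiff.comp (contDiff_const.prodMk contDiff_id))) (fun y => by
      have := hQ' 0 y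
      refine lt_of_lt_of_le ?_ hη1
      simpa [Ψ] using this)
  unfold wdeg at hw ⊢
  rw [key] at hw
  have e2 : ∀ y : Fin m → ℝ, Ψ (Fin.cons 1 y) = P y := fun y => congrFun e1 y
  rw [e1] at hw
  simpa only [e2] using hw

theorem not_Pos {F : (Fin m → I) → Fin m → ℝ} (hF : Continuous F) (h : ∀ y, F y ≠ 0) :
    ¬ Pos F := by
  rintro ⟨η, hη, hp⟩
  obtain ⟨ε, hε, hlow⟩ := exists_lower isClosed_univ hF (fun y _ => h y)
  have hη' : 0 < min η (ε/2) := lt_min hη (by positivity)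
  obtain ⟨φ, hφ⟩ := exists_adm (m := m) hη'
  obtain ⟨P, hP, hPF⟩ := exists_smooth_approx F hF hη'
  have h1 := hp φ (hφ.mono (min_le_left _ _)) P hP fun y => (hPF y).trans_le (min_le_left _ _)
  have h2 : wdeg φ P = 0 := by
    refine setIntegral_eq_zero_of_forall_eq_zero fun x hx => ?_
    obtain ⟨y, rfl⟩ := exists_cI hx
    have : φ (P (cI y)) = 0 := by
      by_contra hne
      have h3 := (hφ.2.2.2 _ hne).trans_le (min_le_right _ _)
      have h4 : ‖P (cI y) - F y‖ < ε / 2 := (hPF y).trans_le (min_le_right _ _)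
      have h5 := hlow y (mem_univ _)
      have h6 := norm_sub_norm_le (F y) (P (cI y))
      rw [norm_sub_rev] at h6
      linarith
    simp [this]
  linarith

theorem Pos_of_Jac {F : (Fin m → ℝ) → Fin m → ℝ} (hF : ContDiff ℝ ((⊤ : ℕ∞) : WithTop ℕ∞) F)
    (hJ : ∀ y ∈ Icc (0 : Fin m → ℝ) 1, 0 < Jac F y) (y0 : Fin m → ℝ)
    (hy0 : ∀ i, y0 i ∈ Ioo (0:ℝ) 1) (hz : F y0 = 0)
    (hb : ∀ y : Fin m → I, (∃ j, y j = 0 ∨ y j = 1) → F (cI y) ≠ 0) : Pos fun y => F (cI y) := by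
  obtain ⟨ε, hε, hlow⟩ := exists_lower isClosed_bdry (hF.continuous.comp cI_continuous) hb
  refine ⟨ε / 2, by positivity, fun φ hφ P hP hPF => ?_⟩
  let Ψ : (Fin (m+1) → ℝ) → Fin m → ℝ := fun x =>
    F (fun i => x i.succ) + x 0 • (P (fun i => x i.succ) - F (fun i => x i.succ))
  have hΨ : ContDiff ℝ ((⊤ : ℕ∞) : WithTop ℕ∞) Ψ := by
    have ht : ContDiff ℝ ((⊤ : ℕ∞) : WithTop ℕ∞) fun x : Fin (m+1) → ℝ => (fun i : Fin m => x i.succ) :=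
      contDiff_pi.2 fun i => contDiff_apply ℝ ℝ _
    exact (hF.comp ht).add (ContDiff.smul (contDiff_apply ℝ ℝ 0) ((hP.comp ht).sub (hF.comp ht)))
  have key := inv_integral φ hφ.1 (ε/2) hφ.2.2.2 Ψ hΨ (by
    intro x hx j hj
    let y : Fin m → I := fun i => ⟨x i.succ, hx.1 _, hx.2 _⟩
    have h2 := hlow y ⟨j, hj.imp (fun h => Subtype.ext h) (fun h => Subtype.ext h)⟩
    have h1 := hPF y
    have e : Ψ x = F (cI y) + x 0 • (P (cI y) - F (cI y)) := rfl
    rw [e]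
    have h5 : ‖x 0 • (P (cI y) - F (cI y))‖ ≤ ‖P (cI y) - F (cI y)‖ := by
      rw [norm_smul, Real.norm_of_nonneg (hx.1 0)]
      exact mul_le_of_le_one_left (norm_nonneg _) (hx.2 0)
    have h6 := norm_sub_le (F (cI y) + x 0 • (P (cI y) - F (cI y))) (x 0 • (P (cI y) - F (cI y)))
    rw [add_sub_cancel_right] at h6
    simp only [Function.comp_apply] at h2
    linarith)
  have e1 : (fun y : Fin m → ℝ => Ψ (Fin.cons 1 y)) = P := by
    funext y; simp [Ψ]
  have e0 : (fun y : Fin m → ℝ => Ψ (Fin.cons 0 y)) = F := by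
    funext y; simp [Ψ]
  have e2 : ∀ y : Fin m → ℝ, Ψ (Fin.cons 1 y) = P y := fun y => congrFun e1 y
  have e3 : ∀ y : Fin m → ℝ, Ψ (Fin.cons 0 y) = F y := fun y => congrFun e0 y
  rw [e1, e0] at key
  simp only [e2, e3] at key
  unfold wdeg
  rw [← key]
  have hc : Continuous fun y => φ (F y) * Jac F y :=
    (hφ.1.continuous.comp hF.continuous).mul (Jac_continuous hF)
  have hy0' : y0 ∈ Icc (0 : Fin m → ℝ) 1 := ⟨fun i => (hy0 i).1.le, fun i => (hy0 i).2.le⟩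
  rw [setIntegral_pos_iff_support_of_nonneg_ae]
  · let U : Set (Fin m → ℝ) := {y | 0 < φ (F y) * Jac F y} ∩ Set.pi univ fun _ => Ioo (0:ℝ) 1
    have hU : IsOpen U := (isOpen_lt continuous_const hc).inter
      (isOpen_set_pi finite_univ fun _ _ => isOpen_Ioo)
    have hne : U.Nonempty := ⟨y0, by
      refine ⟨?_, fun i _ => hy0 i⟩
      change 0 < φ (F y0) * Jac F y0
      rw [hz]
      exact mul_pos hφ.2.2.1 (hJ _ hy0')⟩
    refine (hU.measure_pos volume hne).trans_le (measure_mono ?_)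
    rintro y ⟨h1, h2⟩
    exact ⟨(ne_of_gt h1 : _), fun i => (h2 i trivial).1.le, fun i => (h2 i trivial).2.le⟩
  · refine (ae_restrict_iff' measurableSet_Icc).2 (ae_of_all _ fun y hy => ?_)
    exact mul_nonneg (hφ.2.1 _) (hJ y hy).le
  · exact hc.continuousOn.integrableOn_compact isCompact_Icc

end Pos
end PiW
end

section
open Set Topology Filter MeasureTheory
open scoped unitInterval
set_option linter.unusedSectionVars false
namespace PiW

section Glue
variable {m : ℕ}

/-- halving map on coordinate `i` -/
noncomputable def hv (i : Fin m) (a : ℝ) (y : Fin m → ℝ) : Fin m → ℝ :=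
  Function.update y i ((y i + a) / 2)

/-- its linear part -/
noncomputable def hvd (i : Fin m) : Fin m → ℝ := Function.update 1 i (1/2)

/-- its derivative -/
noncomputable def hvL (i : Fin m) : (Fin m → ℝ) →L[ℝ] (Fin m → ℝ) :=
  LinearMap.toContinuousLinearMap (Matrix.toLin' (Matrix.diagonal (hvd i)))

theorem hvL_apply (i : Fin m) (y : Fin m → ℝ) (j : Fin m) : hvL i y j = hvd i j * y j := by
  simp [hvL, Matrix.mulVec_diagonal]

theorem prod_hvd (i : Fin m) : ∏ j, hvd i j = 1/2 := by
  unfold hvd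
  rw [Finset.prod_update_of_mem (Finset.mem_univ _)]
  simp

theorem hvL_det (i : Fin m) : (hvL i).det = 1/2 := by
  rw [← prod_hvd i]
  simp [hvL, ContinuousLinearMap.det, Matrix.det_diagonal]

theorem hv_eq (i : Fin m) (a : ℝ) (y : Fin m → ℝ) : hv i a y = (sb i) • (fun _ => a/2) + hvL i y := by
  funext j
  simp only [Pi.add_apply, hvL_apply, hv, hvd, sb, Function.update_apply, Pi.smul_apply', Pi.single_apply]
  split_ifs with h
  · subst h; simp; ring
  · simp

theorem hv_hasFDerivAt (i : Fin m) (a : ℝ) (y : Fin m → ℝ) : HasFDerivAt (hv i a) (hvL i) y := by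
  have : hv i a = fun y => (sb i) • (fun _ => a/2) + hvL i y := funext (hv_eq i a)
  rw [this]
  exact (hvL i).hasFDerivAt.const_add _

theorem hv_contDiff (i : Fin m) (a : ℝ) {k : WithTop ℕ∞} : ContDiff ℝ k (hv i a) := by
  have : hv i a = fun y => (sb i) • (fun _ => a/2) + hvL i y := funext (hv_eq i a)
  rw [this]
  exact contDiff_const.add (hvL i).contDiff

theorem hv_inj (i : Fin m) (a : ℝ) : Function.Injective (hv i a) := by
  intro y z h
  funext j
  have := congrFun h j
  simp only [hv, Function.update_apply] at this
  split_ifs at this with hj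
  · subst hj; linarith
  · exact this

theorem Jac_hv {P : (Fin m → ℝ) → Fin m → ℝ} (hP : ContDiff ℝ ((⊤ : ℕ∞) : WithTop ℕ∞) P)
    (i : Fin m) (a : ℝ) (y : Fin m → ℝ) :
    Jac (fun y => P (hv i a y)) y = 1/2 * Jac P (hv i a y) := by
  have h1 : HasFDerivAt (fun y => P (hv i a y)) _ y :=
    HasFDerivAt.comp y ((hP.differentiable (by simp)) _).hasFDerivAt (hv_hasFDerivAt i a y)
  unfold Jac
  rw [h1.fderiv, ← prod_hvd i, ← Matrix.det_mul_column]
  congr 1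
  ext j k
  have : hvL i (sb j) = hvd i j • sb j := by
    funext k
    rw [hvL_apply]
    simp only [sb, Pi.smul_apply, smul_eq_mul, Pi.single_apply]
    split_ifs with h
    · rw [h]
    · simp
  simp [this]

theorem wdeg_hv {φ : (Fin m → ℝ) → ℝ} {P : (Fin m → ℝ) → Fin m → ℝ}
    (hP : ContDiff ℝ ((⊤ : ℕ∞) : WithTop ℕ∞) P) (i : Fin m) (a : ℝ) :
    wdeg φ (fun y => P (hv i a y)) = ∫ y in hv i a '' Icc 0 1, φ (P y) * Jac P y := by
  rw [integral_image_eq_integral_abs_det_fderiv_smul volume measurableSet_Icc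
    (fun y _ => (hv_hasFDerivAt i a y).hasFDerivWithinAt) (hv_inj i a).injOn]
  unfold wdeg
  congr 1
  funext y
  rw [Jac_hv hP, hvL_det]
  simp only [smul_eq_mul]
  rw [abs_of_pos (by norm_num)]
  ring

theorem hv_image (i : Fin m) : hv i 0 '' Icc 0 1 = Icc (0 : Fin m → ℝ) 1 ∩ {y | y i ≤ 1/2} := by
  ext y
  constructor
  · rintro ⟨z, hz, rfl⟩
    have h0 := hz.1 i
    have h1 := hz.2 i
    simp only [Pi.zero_apply, Pi.one_apply] at h0 h1
    refine ⟨⟨fun j => ?_, fun j => ?_⟩, ?_⟩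
    · simp only [hv, Function.update_apply]
      split_ifs
      · simp; linarith
      · exact hz.1 j
    · simp only [hv, Function.update_apply]
      split_ifs
      · simp; linarith
      · exact hz.2 j
    · simp [hv]; linarith
  · rintro ⟨hy, hi⟩
    have hi' : y i ≤ 1/2 := hi
    have h0 : 0 ≤ y i := hy.1 i
    refine ⟨Function.update y i (2 * y i), ⟨fun j => ?_, fun j => ?_⟩, ?_⟩
    · simp only [Function.update_apply]
      split_ifs
      · simp; linarith
      · exact hy.1 j
    · simp only [Function.update_apply]
      split_ifs
      · simp; linarith
      · exact hy.2 j
    · simp [hv]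

theorem hv_image' (i : Fin m) : hv i 1 '' Icc 0 1 = Icc (0 : Fin m → ℝ) 1 ∩ {y | 1/2 ≤ y i} := by
  ext y
  constructor
  · rintro ⟨z, hz, rfl⟩
    have h0 := hz.1 i
    have h1 := hz.2 i
    simp only [Pi.zero_apply, Pi.one_apply] at h0 h1
    refine ⟨⟨fun j => ?_, fun j => ?_⟩, ?_⟩
    · simp only [hv, Function.update_apply]
      split_ifs
      · simp; linarith
      · exact hz.1 j
    · simp only [hv, Function.update_apply]
      split_ifs
      · simp; linarith
      · exact hz.2 j
    · simp [hv]; linarith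
  · rintro ⟨hy, hi⟩
    have hi' : 1/2 ≤ y i := hi
    have h0 : y i ≤ 1 := hy.2 i
    refine ⟨Function.update y i (2 * y i - 1), ⟨fun j => ?_, fun j => ?_⟩, ?_⟩
    · simp only [Function.update_apply]
      split_ifs
      · simp; linarith
      · exact hy.1 j
    · simp only [Function.update_apply]
      split_ifs
      · simp; linarith
      · exact hy.2 j
    · simp [hv]

theorem wdeg_split {φ : (Fin m → ℝ) → ℝ} (hφ : Continuous φ) {P : (Fin m → ℝ) → Fin m → ℝ}
    (hP : ContDiff ℝ ((⊤ : ℕ∞) : WithTop ℕ∞) P) (i : Fin m) :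
    wdeg φ P = wdeg φ (fun y => P (hv i 0 y)) + wdeg φ (fun y => P (hv i 1 y)) := by
  have hc : Continuous fun y => φ (P y) * Jac P y :=
    (hφ.comp hP.continuous).mul (Jac_continuous hP)
  have hIntg : IntegrableOn (fun y => φ (P y) * Jac P y) (Icc (0 : Fin m → ℝ) 1) :=
    hc.continuousOn.integrableOn_compact isCompact_Icc
  have hm : MeasurableSet {y : Fin m → ℝ | y i ≤ 1/2} :=
    measurableSet_le (measurable_pi_apply i) measurable_const
  have h1 := integral_inter_add_sdiff (μ := volume) hm hIntg
  rw [wdeg_hv hP, wdeg_hv hP, hv_image, hv_image']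
  unfold wdeg
  rw [← h1]
  congr 1
  refine setIntegral_congr_set ?_
  have hz : volume {y : Fin m → ℝ | y i = 1/2} = 0 := by
    have := Measure.pi_hyperplane (fun _ : Fin m => (volume : Measure ℝ)) i (1/2)
    exact this
  refine ae_eq_set.2 ⟨?_, ?_⟩
  · convert measure_empty (μ := volume)
    ext y
    simp only [Set.mem_sdiff, mem_inter_iff, mem_empty_iff_false, iff_false]
    rintro ⟨⟨h1, h2⟩, h3⟩
    exact h3 ⟨h1, (le_of_lt (not_le.1 h2) : (1:ℝ)/2 ≤ y i)⟩
  · refine measure_mono_null ?_ hz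
    rintro y ⟨⟨h1, h2⟩, h3⟩
    refine le_antisymm ?_ h2
    by_contra h
    exact h3 ⟨h1, h⟩

/-- first half of the cube -/
noncomputable def hI0 (t : I) : I := ⟨(t : ℝ) / 2, by have := t.2.1; positivity, by have := t.2.2; linarith⟩
/-- second half of the cube -/
noncomputable def hI1 (t : I) : I := ⟨((t : ℝ) + 1) / 2, by have := t.2.1; positivity, by have := t.2.2; linarith⟩

theorem Pos_glue (i : Fin m) {F1 F2 G : (Fin m → I) → Fin m → ℝ} (h1 : Pos F1) (h2 : Pos F2)
    (hG1 : ∀ y, G (Function.update y i (hI0 (y i))) = F1 y)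
    (hG2 : ∀ y, G (Function.update y i (hI1 (y i))) = F2 y) : Pos G := by
  obtain ⟨η1, hη1, h1⟩ := h1
  obtain ⟨η2, hη2, h2⟩ := h2
  refine ⟨min η1 η2, lt_min hη1 hη2, fun φ hφ P hP hPG => ?_⟩
  rw [wdeg_split hφ.1.continuous hP i]
  refine add_pos (h1 φ (hφ.mono (min_le_left _ _)) _ (hP.comp (hv_contDiff i 0)) fun y => ?_)
    (h2 φ (hφ.mono (min_le_right _ _)) _ (hP.comp (hv_contDiff i 1)) fun y => ?_)
  · have e : hv i 0 (cI y) = cI (Function.update y i (hI0 (y i))) := by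
      funext j
      simp only [hv, cI, Function.update_apply, hI0]
      split_ifs <;> simp
    rw [← hG1, e]
    exact (hPG _).trans_le (min_le_left _ _)
  · have e : hv i 1 (cI y) = cI (Function.update y i (hI1 (y i))) := by
      funext j
      simp only [hv, cI, Function.update_apply, hI1]
      split_ifs <;> simp
    rw [← hG2, e]
    exact (hPG _).trans_le (min_le_right _ _)

end Glue
end PiW
end

section
open Set Topology Filter MeasureTheory
open scoped unitInterval
set_option linter.unusedSectionVars false
namespace PiW

section DegPos
variable {n m2 : ℕ}

/-- stabilisation of a map by the identity -/
noncomputable def stab (m2 : ℕ) (F : (Fin (n+1) → I) → Fin (n+1) → ℝ) (y : Fin (n+1+m2) → I) :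
    Fin (n+1+m2) → ℝ :=
  Fin.append (F fun i => y (Fin.castAdd m2 i)) (fun j => 2 * (y (Fin.natAdd (n+1) j) : ℝ) - 1)

/-- loops of positive degree -/
def DegPos (m2 : ℕ) {b : ({0}ᶜ : Set (Fin (n+1) → ℝ))} (f : GenLoop (Fin n) ({0}ᶜ : Set (Fin (n+1) → ℝ)) b) :
    Prop :=
  ∃ F : (Fin (n+1) → I) → Fin (n+1) → ℝ, Continuous F ∧
    (∀ x, x 0 = 0 → F x = (f (Fin.tail x) : Fin (n+1) → ℝ)) ∧
    (∀ x, (x 0 = 1 ∨ ∃ j : Fin n, x j.succ = 0 ∨ x j.succ = 1) → F x = b) ∧ Pos (stab m2 F)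

theorem update_castAdd (y : Fin (n+1+m2) → I) (i : Fin (n+1)) (a : I) :
    (fun j => Function.update y (Fin.castAdd m2 i) a (Fin.castAdd m2 j)) =
      Function.update (fun j => y (Fin.castAdd m2 j)) i a := by
  funext j
  simp only [Function.update_apply, Fin.castAdd_inj]

theorem update_natAdd (y : Fin (n+1+m2) → I) (i : Fin (n+1)) (a : I) (j : Fin m2) :
    Function.update y (Fin.castAdd m2 i) a (Fin.natAdd (n+1) j) = y (Fin.natAdd (n+1) j) := by
  rw [Function.update_of_ne]
  intro h
  have := congrArg Fin.val h
  simp at this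
  have := i.2
  omega

theorem projIcc_of_eq {r : ℝ} {t : I} (h : r = t) : projIcc (0:ℝ) 1 zero_le_one r = t := by
  subst h; exact projIcc_val _ _

theorem DegPos_transAt {b : ({0}ᶜ : Set (Fin (n+1) → ℝ))}
    {f g : GenLoop (Fin n) ({0}ᶜ : Set (Fin (n+1) → ℝ)) b} (hf : DegPos m2 f) (hg : DegPos m2 g)
    (i : Fin n) : DegPos m2 (GenLoop.transAt i f g) := by
  obtain ⟨F, hF, hF0, hFb, hFP⟩ := hf
  obtain ⟨G, hG, hG0, hGb, hGP⟩ := hg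
  let A : (Fin (n+1) → I) → Fin (n+1) → I := fun x =>
    Function.update x i.succ (projIcc 0 1 zero_le_one (2 * (x i.succ : ℝ)))
  let B : (Fin (n+1) → I) → Fin (n+1) → I := fun x =>
    Function.update x i.succ (projIcc 0 1 zero_le_one (2 * (x i.succ : ℝ) - 1))
  have hx : Continuous fun x : Fin (n+1) → I => (x i.succ : ℝ) :=
    continuous_subtype_val.comp (continuous_apply _)
  have hA : Continuous A := continuous_id.update _ (continuous_projIcc.comp (hx.const_mul 2))
  have hB : Continuous B :=
    continuous_id.update _ (continuous_projIcc.comp ((hx.const_mul 2).sub continuous_const))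
  let K : (Fin (n+1) → I) → Fin (n+1) → ℝ := fun x =>
    if (x i.succ : ℝ) ≤ 1/2 then F (A x) else G (B x)
  have hagree : ∀ x, (x i.succ : ℝ) = 1/2 → F (A x) = G (B x) := by
    intro x hx
    rw [hFb _ (Or.inr ⟨i, Or.inr ?_⟩), hGb _ (Or.inr ⟨i, Or.inl ?_⟩)]
    · simp only [B, Function.update_self]
      exact projIcc_of_eq (by rw [hx]; simp)
    · simp only [A, Function.update_self]
      exact projIcc_of_eq (by rw [hx]; simp)
  have hK1 : ∀ x, (x i.succ : ℝ) ≤ 1/2 → K x = F (A x) := fun x h => if_pos h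
  have hK2 : ∀ x, 1/2 ≤ (x i.succ : ℝ) → K x = G (B x) := fun x h => by
    by_cases h' : (x i.succ : ℝ) ≤ 1/2
    · rw [hK1 x h', hagree x (le_antisymm h' h)]
    · exact if_neg h'
  refine ⟨K, Continuous.if_le (hF.comp hA) (hG.comp hB) hx continuous_const hagree, ?_, ?_, ?_⟩
  · intro x hx0
    rw [transAt_apply]
    have e : ∀ a, Fin.tail (Function.update x i.succ a) = Function.update (Fin.tail x) i a :=
      fun a => Fin.tail_update_succ x i a
    have e0 : ∀ a, Function.update x i.succ a 0 = 0 := fun a => by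
      rw [Function.update_of_ne (Fin.succ_ne_zero i).symm, hx0]
    by_cases h : (x i.succ : ℝ) ≤ 1/2
    · rw [hK1 x h, hF0 _ (e0 _), if_pos (show ((Fin.tail x) i : ℝ) ≤ 1/2 from h), e]; rfl
    · rw [hK2 x (le_of_lt (not_le.1 h)), hG0 _ (e0 _), if_neg (show ¬ ((Fin.tail x) i : ℝ) ≤ 1/2 from h), e]; rfl
  · intro x hxb
    have hmem : ∀ a : I, (x i.succ = 0 → a = 0 ∨ a = 1) → (x i.succ = 1 → a = 0 ∨ a = 1) →
      (Function.update x i.succ a 0 = 1 ∨ ∃ j : Fin n, Function.update x i.succ a j.succ = 0 ∨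
        Function.update x i.succ a j.succ = 1) := by
      intro a h0 h1
      rcases hxb with hxb | ⟨j, hj⟩
      · left; rw [Function.update_of_ne (Fin.succ_ne_zero i).symm, hxb]
      · right
        refine ⟨j, ?_⟩
        by_cases hji : j = i
        · subst hji
          rw [Function.update_self]
          exact hj.elim h0 h1
        · rw [Function.update_of_ne (fun h => hji (Fin.succ_injective _ h))]
          exact hj
    by_cases h : (x i.succ : ℝ) ≤ 1/2
    · rw [hK1 x h]
      refine hFb _ (hmem _ (fun h0 => Or.inl ?_) fun h1 => ?_)
      · exact projIcc_of_eq (by rw [h0]; simp)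
      · rw [h1] at h; norm_num at h
    · have h' := le_of_lt (not_le.1 h)
      rw [hK2 x h']
      refine hGb _ (hmem _ (fun h0 => ?_) fun h1 => Or.inr ?_)
      · rw [h0] at h; norm_num at h
      · exact projIcc_of_eq (by rw [h1]; norm_num)
  · refine Pos_glue (Fin.castAdd m2 i.succ) hFP hGP (fun y => ?_) (fun y => ?_)
    · unfold stab
      simp only [update_castAdd, update_natAdd]
      rw [hK1 _ (by simp only [Function.update_self, hI0]; linarith [(y (Fin.castAdd m2 i.succ)).2.2])]
      congr 2
      simp only [A, Function.update_self, Function.update_idem]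
      rw [projIcc_of_eq (t := y (Fin.castAdd m2 i.succ)) (by simp only [hI0]; ring)]
      exact Function.update_eq_self _ (fun j => y (Fin.castAdd m2 j))
    · unfold stab
      simp only [update_castAdd, update_natAdd]
      rw [hK2 _ (by simp only [Function.update_self, hI1]; linarith [(y (Fin.castAdd m2 i.succ)).2.1])]
      congr 2
      simp only [B, Function.update_self, Function.update_idem]
      rw [projIcc_of_eq (t := y (Fin.castAdd m2 i.succ)) (by simp only [hI1]; ring)]
      exact Function.update_eq_self _ (fun j => y (Fin.castAdd m2 j))

end DegPos
end PiW
end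

section
open Set Topology Filter MeasureTheory
open scoped unitInterval
set_option linter.unusedSectionVars false
namespace PiW

section Gen
variable {n m2 : ℕ}

/-- height function -/
noncomputable def gh (x : Fin (n+1) → ℝ) : ℝ := 4 * x 0 - 1 + 4 * ∑ i : Fin n, (2 * x i.succ - 1)^2

/-- model map -/
noncomputable def gF (x : Fin (n+1) → ℝ) : Fin (n+1) → ℝ :=
  Fin.cons (gh x) fun i => 2 * x i.succ - 1

/-- base point -/
noncomputable def gb (n : ℕ) : Fin (n+1) → ℝ := Fin.cons 3 0

theorem gh_contDiff {k : WithTop ℕ∞} : ContDiff ℝ k (gh : (Fin (n+1) → ℝ) → ℝ) := by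
  unfold gh; fun_prop

theorem gF_contDiff {k : WithTop ℕ∞} : ContDiff ℝ k (gF : (Fin (n+1) → ℝ) → Fin (n+1) → ℝ) := by
  refine contDiff_pi.2 fun i => ?_
  refine Fin.cases ?_ (fun i => ?_) i
  · simpa [gF] using gh_contDiff
  · simp only [gF, Fin.cons_succ]; fun_prop

/-- model map cut off -/
noncomputable def gK (s : ℝ) (x : Fin (n+1) → ℝ) : Fin (n+1) → ℝ :=
  (1 - s * cl ((gh x - 1)/2)) • gF x + (s * cl ((gh x - 1)/2)) • gb n

theorem gK_continuous : Continuous fun p : ℝ × (Fin (n+1) → ℝ) => gK p.1 p.2 := by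
  have h1 : Continuous fun p : ℝ × (Fin (n+1) → ℝ) => p.1 * cl ((gh p.2 - 1)/2) :=
    continuous_fst.mul (cl_continuous.comp
      (((gh_contDiff (k := 0)).continuous.comp continuous_snd |>.sub continuous_const).div_const 2))
  unfold gK
  exact ((continuous_const.sub h1).smul ((gF_contDiff (k := 0)).continuous.comp continuous_snd)).add
    (h1.smul continuous_const)

theorem gK_zero_mid {s : ℝ} (hs0 : 0 ≤ s) (hs : s ≤ 1) {x : Fin (n+1) → ℝ} (h : gK s x = 0) :
    (∀ i : Fin n, x i.succ = 1/2) ∧ 0 < x 0 ∧ x 0 < 1 := by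
  set c := s * cl ((gh x - 1)/2) with hc
  have hc0 : 0 ≤ c := mul_nonneg hs0 (cl_nonneg _)
  have hc1 : c ≤ 1 := mul_le_one₀ hs (cl_nonneg _) (cl_le_one _)
  have h0 : (1 - c) * gh x + c * 3 = 0 := by
    have := congrFun h 0
    simpa [gK, ← hc, gF, gb] using this
  have hs' : ∀ i : Fin n, (1 - c) * (2 * x i.succ - 1) = 0 := fun i => by
    have := congrFun h i.succ
    simpa [gK, ← hc, gF, gb] using this
  have hne : 1 - c ≠ 0 := by
    intro h1
    rw [h1] at h0
    have : c = 1 := by linarith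
    rw [this] at h0; norm_num at h0
  have hx : ∀ i : Fin n, x i.succ = 1/2 := fun i => by
    have := (mul_eq_zero.1 (hs' i)).resolve_left hne
    linarith
  have hg : gh x = 4 * x 0 - 1 := by
    unfold gh
    rw [Finset.sum_eq_zero]
    · simp
    · intro i _
      rw [hx i]; norm_num
  have hpos : 0 < 1 - c := lt_of_le_of_ne (by linarith) (Ne.symm hne)
  refine ⟨hx, ?_, ?_⟩
  · by_contra hcon
    have h1 : gh x ≤ -1 := by rw [hg]; linarith
    have : c = 0 := by rw [hc, cl_of_le (by linarith), mul_zero]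
    rw [this] at h0
    linarith
  · by_contra hcon
    have h1 : 3 ≤ gh x := by rw [hg]; linarith
    nlinarith

theorem gK_one_bdry {x : Fin (n+1) → ℝ} (h : 3 ≤ gh x) : gK 1 x = gb n := by
  simp [gK, cl_of_ge (show 1 ≤ (gh x - 1)/2 by linarith)]

theorem gh_ge {x : Fin (n+1) → ℝ} (h0 : 0 ≤ x 0) (h : x 0 = 1 ∨ ∃ j : Fin n, x j.succ = 0 ∨ x j.succ = 1) :
    3 ≤ gh x := by
  unfold gh
  rcases h with h | ⟨j, hj⟩
  · have : 0 ≤ ∑ i : Fin n, (2 * x i.succ - 1)^2 := Finset.sum_nonneg fun i _ => sq_nonneg _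
    rw [h]; linarith
  · have := Finset.single_le_sum (f := fun i : Fin n => (2 * x i.succ - 1)^2)
      (fun i _ => sq_nonneg _) (Finset.mem_univ j)
    have h1 : (2 * x j.succ - 1)^2 = 1 := by rcases hj with h | h <;> rw [h] <;> norm_num
    simp only [h1] at this
    linarith

/-- smooth stabilised model -/
noncomputable def gS (m2 : ℕ) (y : Fin (n+1+m2) → ℝ) : Fin (n+1+m2) → ℝ :=
  Fin.append (gF fun i => y (Fin.castAdd m2 i)) (fun j => 2 * y (Fin.natAdd (n+1) j) - 1)

theorem gS_apply_zero (y : Fin (n+1+m2) → ℝ) :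
    gS m2 y (Fin.castAdd m2 0) = gh (fun i => y (Fin.castAdd m2 i)) := by
  simp [gS, gF]

theorem gS_apply_ne (y : Fin (n+1+m2) → ℝ) {k : Fin (n+1+m2)} (hk : k ≠ Fin.castAdd m2 0) :
    gS m2 y k = 2 * y k - 1 := by
  revert hk
  refine Fin.addCases (fun i => ?_) (fun i => ?_) k
  · refine Fin.cases (fun h => absurd rfl h) (fun i _ => ?_) i
    simp [gS, gF]
  · intro _; simp [gS]

theorem gS_contDiff {k : WithTop ℕ∞} : ContDiff ℝ k (gS m2 : (Fin (n+1+m2) → ℝ) → _) := by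
  refine contDiff_pi.2 fun i => ?_
  by_cases hi : i = Fin.castAdd m2 0
  · subst hi
    simp only [gS_apply_zero]
    exact gh_contDiff.comp (contDiff_pi.2 fun i => contDiff_apply ℝ ℝ _)
  · simp only [gS_apply_ne _ hi]; fun_prop

theorem gS_fderiv (y v : Fin (n+1+m2) → ℝ) (k : Fin (n+1+m2)) :
    fderiv ℝ (gS m2) y v k = fderiv ℝ (fun y => gS m2 y k) y v := by
  have h : DifferentiableAt ℝ (gS (n := n) m2) y := (gS_contDiff (k := 1)).differentiable (by simp) y
  have h2 := (hasFDerivAt_pi'.1 h.hasFDerivAt) k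
  rw [h2.fderiv]
  rfl

theorem Jac_gS (y : Fin (n+1+m2) → ℝ) : 0 < Jac (gS m2) y := by
  have hne : ∀ j k : Fin (n+1+m2), k ≠ Fin.castAdd m2 0 →
      fderiv ℝ (gS m2) y (sb j) k = if j = k then 2 else 0 := by
    intro j k hk
    rw [gS_fderiv]
    simp only [gS_apply_ne _ hk]
    have h : HasFDerivAt (fun y : Fin (n+1+m2) → ℝ => 2 * y k - 1)
        ((2:ℝ) • (ContinuousLinearMap.proj k : (Fin (n+1+m2) → ℝ) →L[ℝ] ℝ)) y :=
      (((ContinuousLinearMap.proj k : (Fin (n+1+m2) → ℝ) →L[ℝ] ℝ).hasFDerivAt).const_mul 2).sub_const 1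
    rw [h.fderiv]
    simp [sb, Pi.single_apply, eq_comm]
  have h0 : fderiv ℝ (gS m2) y (sb (Fin.castAdd m2 0)) (Fin.castAdd m2 (0 : Fin (n+1))) = 4 := by
    rw [gS_fderiv]
    simp only [gS_apply_zero, gh]
    have hp : ∀ i : Fin (n+1), HasFDerivAt (fun y : Fin (n+1+m2) → ℝ => y (Fin.castAdd m2 i))
        (ContinuousLinearMap.proj (Fin.castAdd m2 i) : (Fin (n+1+m2) → ℝ) →L[ℝ] ℝ) y := fun i =>
      (ContinuousLinearMap.proj (Fin.castAdd m2 i) : (Fin (n+1+m2) → ℝ) →L[ℝ] ℝ).hasFDerivAt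
    have h := (((hp 0).const_mul 4).sub_const 1).add
      ((HasFDerivAt.fun_sum (u := Finset.univ) fun (i : Fin n) _ =>
        (((hp i.succ).const_mul 2).sub_const 1).pow 2).const_mul 4)
    have h' := h.fderiv
    change fderiv ℝ (fun y : Fin (n+1+m2) → ℝ => 4 * y (Fin.castAdd m2 0) - 1 +
      4 * ∑ i : Fin n, (2 * y (Fin.castAdd m2 i.succ) - 1)^2) y = _ at h'
    rw [h']
    simp [sb, Pi.single_apply, Fin.castAdd_inj]
  unfold Jac
  rw [Matrix.det_of_lowerTriangular]
  · refine Finset.prod_pos fun k _ => ?_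
    simp only [Matrix.of_apply]
    by_cases hk : k = Fin.castAdd m2 0
    · rw [hk, h0]; norm_num
    · rw [hne k k hk]; simp
  · intro i j hij
    have hij : i < j := hij
    simp only [Matrix.of_apply]
    rw [hne i j, if_neg hij.ne]
    rintro rfl
    have : i.val < (Fin.castAdd m2 (0 : Fin (n+1))).val := hij
    simp at this

theorem gS_zero : gS m2 (fun k : Fin (n+1+m2) => if k = Fin.castAdd m2 0 then (1/4 : ℝ) else 1/2) = 0 := by
  funext k
  by_cases hk : k = Fin.castAdd m2 0
  · subst hk
    rw [gS_apply_zero]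
    simp [gh, Fin.castAdd_inj, Fin.succ_ne_zero]
  · rw [gS_apply_ne _ hk]
    simp [hk]

theorem append_eq_zero {a c : ℕ} {u : Fin a → ℝ} {v : Fin c → ℝ} (h : Fin.append u v = 0) :
    u = 0 ∧ v = 0 := by
  constructor
  · funext i; have := congrFun h (Fin.castAdd c i); simpa using this
  · funext i; have := congrFun h (Fin.natAdd a i); simpa using this

theorem gK_bdry_ne {s : ℝ} (hs0 : 0 ≤ s) (hs : s ≤ 1) (y : Fin (n+1+m2) → I)
    (hy : ∃ j, y j = 0 ∨ y j = 1) :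
    stab m2 (fun x => gK s (cI x)) y ≠ 0 := by
  intro h
  obtain ⟨h1, h2⟩ := append_eq_zero h
  obtain ⟨h3, h4, h5⟩ := gK_zero_mid hs0 hs h1
  obtain ⟨j, hj⟩ := hy
  revert hj
  refine Fin.addCases (fun i => ?_) (fun i => ?_) j
  · refine Fin.cases ?_ (fun i => ?_) i
    · simp only [cI] at h4 h5
      rintro (hj | hj) <;> rw [hj] at h4 h5 <;> simp at h4 h5
    · have := h3 i
      simp only [cI] at this
      rintro (hj | hj) <;> rw [hj] at this <;> norm_num at this
  · have := congrFun h2 i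
    simp only [Pi.zero_apply] at this
    rintro (hj | hj) <;> rw [hj] at this <;> norm_num at this

theorem stab_continuous {X : Type*} [TopologicalSpace X] {F : X × (Fin (n+1) → I) → Fin (n+1) → ℝ}
    (hF : Continuous F) : Continuous fun p : X × (Fin (n+1+m2) → I) => stab m2 (fun x => F (p.1, x)) p.2 := by
  refine continuous_pi fun k => ?_
  refine Fin.addCases (fun i => ?_) (fun i => ?_) k
  · simp only [stab, Fin.append_left]
    exact (continuous_apply i).comp (hF.comp (by fun_prop))
  · simp only [stab, Fin.append_right]
    fun_prop

theorem Pos_gK : Pos (stab m2 fun x : Fin (n+1) → I => gK 1 (cI x)) := by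
  have h0 : Pos (stab m2 fun x : Fin (n+1) → I => gK 0 (cI x)) := by
    have e : (stab m2 fun x : Fin (n+1) → I => gK 0 (cI x)) = fun y => gS m2 (cI y) := by
      funext y
      simp [stab, gS, gK, cI]
      rfl
    rw [e]
    refine Pos_of_Jac gS_contDiff (fun y _ => Jac_gS y) _ ?_ gS_zero ?_
    · intro i
      split_ifs <;> constructor <;> norm_num
    · intro y hy h
      exact gK_bdry_ne (le_refl 0) zero_le_one y hy ((congrFun e y).trans h)
  have hc : Continuous fun p : I × (Fin (n+1) → I) => gK (p.1 : ℝ) (cI p.2) :=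
    gK_continuous.comp (f := fun p : I × (Fin (n+1) → I) => ((p.1 : ℝ), cI p.2))
      ((continuous_subtype_val.comp continuous_fst).prodMk (cI_continuous.comp continuous_snd))
  have := Pos_homotopy (fun p : I × (Fin (n+1+m2) → I) =>
    stab m2 (fun x => gK (p.1 : ℝ) (cI x)) p.2) (stab_continuous (m2 := m2) hc)
    (fun s y hy => gK_bdry_ne s.2.1 s.2.2 y hy) (by simpa using h0)
  simpa using this

theorem exists_DegPos (n m2 : ℕ) : ∃ (b : ({0}ᶜ : Set (Fin (n+1) → ℝ)))
    (f : GenLoop (Fin n) ({0}ᶜ : Set (Fin (n+1) → ℝ)) b), DegPos m2 f := by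
  have hb : gb n ∈ ({0}ᶜ : Set (Fin (n+1) → ℝ)) := by
    intro h
    have := congrFun (mem_singleton_iff.1 h) 0
    simp [gb] at this
  have hc : Continuous fun x : Fin (n+1) → ℝ => gK 1 x :=
    gK_continuous.comp (continuous_const.prodMk continuous_id)
  have hb' : ∀ x : Fin (n+1) → I, (x 0 = 1 ∨ ∃ j : Fin n, x j.succ = 0 ∨ x j.succ = 1) →
      gK 1 (cI x) = gb n := by
    intro x hx
    refine gK_one_bdry (gh_ge (x 0).2.1 ?_)
    refine hx.imp (fun h => by simp [cI, h]) ?_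
    rintro ⟨j, hj⟩
    exact ⟨j, hj.imp (fun h => by simp [cI, h]) (fun h => by simp [cI, h])⟩
  refine ⟨⟨gb n, hb⟩, mkLoop (fun y => gK 1 (cI (Fin.cons 0 y : Fin (n+1) → I))) ?_ ?_ ?_, 
    fun x => gK 1 (cI x), hc.comp cI_continuous, ?_, hb', Pos_gK⟩
  · exact hc.comp (cI_continuous.comp (consI_continuous.comp (continuous_const.prodMk continuous_id)))
  · intro t h
    have := (gK_zero_mid zero_le_one le_rfl (mem_singleton_iff.1 h)).2.1
    simp [cI] at this
  · rintro t ⟨j, hj⟩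
    exact hb' _ (Or.inr ⟨j, by simpa using hj⟩)
  · intro x hx
    rw [mkLoop_apply, ← hx]
    congr 2
    exact (Fin.cons_self_tail x).symm

theorem DegPos_pow {k : ℕ} {b : ({0}ᶜ : Set (Fin (k+1+1) → ℝ))}
    {f : GenLoop (Fin (k+1)) ({0}ᶜ : Set (Fin (k+1+1) → ℝ)) b} (hf : DegPos m2 f) (r : ℕ) :
    ∃ g : GenLoop (Fin (k+1)) ({0}ᶜ : Set (Fin (k+1+1) → ℝ)) b, DegPos m2 g ∧
      (cls f)^(r+1) = cls g := by
  induction r with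
  | zero => exact ⟨f, hf, by simp⟩
  | succ r ih =>
    obtain ⟨g, hg, hr⟩ := ih
    refine ⟨GenLoop.transAt 0 f g, DegPos_transAt hf hg 0, ?_⟩
    rw [pow_succ, hr, cls_mul 0]

end Gen
end PiW
end

section
open Set Topology Filter MeasureTheory
open scoped unitInterval
set_option linter.unusedSectionVars false
namespace PiW

section Slice
variable {ι : Type*} [Fintype ι] {P Q R : ι → Type} [∀ i, Fintype (P i)] [∀ i, Fintype (Q i)]
  [∀ i, DecidableEq (Q i)] [∀ i, Fintype (R i)] (l : ∀ i, Q i)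
  (eP : ∀ i, P i ≃ R i ⊕ {b // b ≠ l i})

/-- the transverse slice -/
noncomputable def slice (v : ∀ i, R i → ℂ) : VV P Q := fun i a b =>
  Sum.elim (fun r => if b = l i then v i r else 0) (fun b' => if b = b'.1 then 1 else 0) (eP i a)

theorem slice_inl (v : ∀ i, R i → ℂ) (i : ι) (r : R i) (w : Q i → ℂ) :
    ∑ b, slice l eP v i ((eP i).symm (Sum.inl r)) b * w b = v i r * w (l i) := by
  simp [slice]

theorem slice_inr (v : ∀ i, R i → ℂ) (i : ι) (b' : {b // b ≠ l i}) (w : Q i → ℂ) :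
    ∑ b, slice l eP v i ((eP i).symm (Sum.inr b')) b * w b = w b' := by
  simp [slice]

theorem slice_continuous : Continuous (slice l eP) := by
  refine continuous_pi fun i => continuous_pi fun a => continuous_pi fun b => ?_
  unfold slice
  rcases eP i a with r | b'
  · simp only [Sum.elim_inl]
    split_ifs <;> fun_prop
  · simp only [Sum.elim_inr]; fun_prop

theorem slice_mem {v : ∀ i, R i → ℂ} (hv : v ≠ 0) : slice l eP v ∈ (DD P Q)ᶜ := by
  intro h
  refine hv (funext fun i => funext fun r => ?_)
  obtain ⟨u, hu, h⟩ := h i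
  by_contra hr
  refine hu (funext fun b => ?_)
  by_cases hb : b = l i
  · have := h ((eP i).symm (Sum.inl r))
    rw [slice_inl] at this
    rw [hb]
    exact (mul_eq_zero.1 this).resolve_left hr
  · have := h ((eP i).symm (Sum.inr ⟨b, hb⟩))
    rwa [slice_inr] at this

theorem slice_notMem (v : ∀ i, R i → ℂ) : slice l eP v ∉ DInf (P := P) l := by
  rintro ⟨-, i, u, hu, hl, h⟩
  refine hu (funext fun b => ?_)
  by_cases hb : b = l i
  · rw [hb]; exact hl
  · have := h ((eP i).symm (Sum.inr ⟨b, hb⟩))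
    rwa [slice_inr] at this

/-- extension of a vector by one -/
def ex1 (u : ∀ i, {b // b ≠ l i} → ℂ) (i : ι) (b : Q i) : ℂ := if h : b = l i then 1 else u i ⟨b, h⟩

theorem ex1_self (u : ∀ i, {b // b ≠ l i} → ℂ) (i : ι) : ex1 l u i (l i) = 1 := by simp [ex1]

theorem ex1_of (u : ∀ i, {b // b ≠ l i} → ℂ) (i : ι) (b : {b // b ≠ l i}) : ex1 l u i b = u i b := by
  simp [ex1, b.2]

theorem ex1_ne (u : ∀ i, {b // b ≠ l i} → ℂ) (i : ι) : ex1 l u i ≠ 0 := fun h => by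
  have := congrFun h (l i)
  rw [ex1_self] at this
  simp at this

theorem ex1_continuous : Continuous (ex1 l) := by
  refine continuous_pi fun i => continuous_pi fun b => ?_
  unfold ex1
  by_cases h : b = l i
  · simp only [h, dif_pos]; fun_prop
  · simp only [h, dif_neg, not_false_eq_true]; fun_prop

/-- evaluation map -/
noncomputable def Ev (A : VV P Q) (u : ∀ i, {b // b ≠ l i} → ℂ) : ∀ i, P i → ℂ :=
  fun i a => ∑ b, A i a b * ex1 l u i b

theorem Ev_continuous : Continuous fun p : VV P Q × (∀ i, {b // b ≠ l i} → ℂ) => Ev l p.1 p.2 := by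
  refine continuous_pi fun i => continuous_pi fun a => ?_
  refine continuous_finsetSum _ fun b _ => Continuous.mul (by fun_prop) ?_
  exact (continuous_apply b).comp ((continuous_apply i).comp ((ex1_continuous l).comp continuous_snd))

theorem Ev_mem {A : VV P Q} {u : ∀ i, {b // b ≠ l i} → ℂ} (h : Ev l A u = 0) : A ∈ DD P Q :=
  fun i => ⟨ex1 l u i, ex1_ne l u i, fun a => congrFun (congrFun h i) a⟩

theorem Ev_slice_inl (v : ∀ i, R i → ℂ) (u : ∀ i, {b // b ≠ l i} → ℂ) (i : ι) (r : R i) :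
    Ev l (slice l eP v) u i ((eP i).symm (Sum.inl r)) = v i r := by
  rw [Ev, slice_inl, ex1_self, mul_one]

theorem Ev_slice_inr (v : ∀ i, R i → ℂ) (u : ∀ i, {b // b ≠ l i} → ℂ) (i : ι) (b : {b // b ≠ l i}) :
    Ev l (slice l eP v) u i ((eP i).symm (Sum.inr b)) = u i b := by
  rw [Ev, slice_inr, ex1_of]

variable {n1 m2 : ℕ} (e1 : (∀ i, R i → ℂ) ≃L[ℝ] (Fin n1 → ℝ))
  (e2 : (∀ i, {b // b ≠ l i} → ℂ) ≃L[ℝ] (Fin m2 → ℝ))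

/-- coordinates on the target -/
noncomputable def TT (ρ : ℝ) (w : ∀ i, P i → ℂ) : Fin (n1 + m2) → ℝ :=
  Fin.append (e1 fun i r => w i ((eP i).symm (Sum.inl r)))
    (ρ⁻¹ • e2 fun i b => w i ((eP i).symm (Sum.inr b)))

theorem TT_continuous (ρ : ℝ) : Continuous (TT l eP e1 e2 ρ) := by
  refine continuous_pi fun k => ?_
  refine Fin.addCases (fun i => ?_) (fun i => ?_) k
  · simp only [TT, Fin.append_left]
    exact (continuous_apply i).comp (e1.continuous.comp (by fun_prop))
  · simp only [TT, Fin.append_right]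
    exact (continuous_apply i).comp ((e2.continuous.comp (by fun_prop)).const_smul ρ⁻¹)

theorem TT_zero {ρ : ℝ} (hρ : 0 < ρ) {w : ∀ i, P i → ℂ} (h : TT l eP e1 e2 ρ w = 0) : w = 0 := by
  obtain ⟨h1, h2⟩ := append_eq_zero h
  have h1' := (map_eq_zero_iff e1 e1.injective).1 h1
  have h2' := (map_eq_zero_iff e2 e2.injective).1
    ((smul_eq_zero.1 h2).resolve_left (inv_ne_zero hρ.ne'))
  funext i a
  obtain ⟨c, rfl⟩ := (eP i).symm.surjective a
  rcases c with r | b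
  · exact congrFun (congrFun h1' i) r
  · exact congrFun (congrFun h2' i) b

theorem TT_slice {ρ : ℝ} (hρ : 0 < ρ) (v : Fin n1 → ℝ) (u : Fin m2 → ℝ) :
    TT l eP e1 e2 ρ (Ev l (slice l eP (e1.symm v)) (e2.symm (ρ • u))) = Fin.append v u := by
  unfold TT
  simp only [Ev_slice_inl, Ev_slice_inr]
  congr 1
  · exact e1.apply_symm_apply v
  · have : e2 (fun i b => e2.symm (ρ • u) i b) = ρ • u := e2.apply_symm_apply _
    rw [this, inv_smul_smul₀ hρ.ne']

/-- zeros of a family avoiding `DInf` are bounded -/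
theorem bounded_zeros {X : Type*} [TopologicalSpace X] [CompactSpace X] (G : X → VV P Q)
    (hG : Continuous G) (hD : ∀ x, G x ∉ DInf (P := P) l) :
    ∃ ρ > 0, ∀ x u, Ev l (G x) u = 0 → ‖e2 u‖ < ρ := by
  have hi : ∀ i, ∃ B : ℝ, 0 ≤ B ∧ ∀ x u, Ev l (G x) u = 0 → ‖u i‖ ≤ B := by
    intro i
    let K : Set (X × (Q i → ℂ)) := {p | G p.1 ∈ DD P Q ∧ ‖p.2‖ = 1 ∧ ∀ a, ∑ b, G p.1 i a b * p.2 b = 0}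
    have hKc : IsClosed K := by
      have e : K = {p : X × (Q i → ℂ) | G p.1 ∈ DD P Q} ∩ ({p | ‖p.2‖ = 1} ∩
        ⋂ a, {p | ∑ b, G p.1 i a b * p.2 b = 0}) := by
        ext p; simp [K]
      rw [e]
      refine (isClosed_DD.preimage (hG.comp continuous_fst)).inter
        ((isClosed_eq (by fun_prop) continuous_const).inter (isClosed_iInter fun a =>
          isClosed_eq (continuous_finsetSum _ fun b _ => ?_) continuous_const))
      have h1 : Continuous fun p : X × (Q i → ℂ) => G p.1 i a b :=
        (continuous_apply b).comp ((continuous_apply a).comp ((continuous_apply i).comp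
          (hG.comp continuous_fst)))
      exact h1.mul (by fun_prop)
    have hK : IsCompact K := by
      refine IsCompact.of_isClosed_subset (isCompact_univ.prod (isCompact_sphere (0 : Q i → ℂ) 1)) hKc ?_
      rintro p ⟨-, h, -⟩
      exact ⟨mem_univ _, by simpa using h⟩
    have hlow : ∃ δ > 0, ∀ p ∈ K, δ ≤ ‖p.2 (l i)‖ := by
      rcases K.eq_empty_or_nonempty with h | hne
      · exact ⟨1, one_pos, by simp [h]⟩
      · obtain ⟨p, hp, hmin⟩ := hK.exists_isMinOn hne
          (f := fun p : X × (Q i → ℂ) => ‖p.2 (l i)‖) (by fun_prop)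
        refine ⟨_, norm_pos_iff.2 fun h0 => ?_, fun q hq => hmin hq⟩
        refine hD p.1 ⟨hp.1, i, p.2, fun h => ?_, h0, hp.2.2⟩
        have := hp.2.1
        rw [h] at this
        simp at this
    obtain ⟨δ, hδ, hlow⟩ := hlow
    refine ⟨δ⁻¹, by positivity, fun x u hu => ?_⟩
    have hpos : 0 < ‖ex1 l u i‖ := norm_pos_iff.2 (ex1_ne l u i)
    have hk := hlow (x, (‖ex1 l u i‖⁻¹ : ℂ) • ex1 l u i) ⟨Ev_mem l hu, ?_, ?_⟩
    · simp only [Pi.smul_apply, ex1_self, smul_eq_mul, mul_one] at hk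
      rw [norm_inv, Complex.norm_real, norm_norm] at hk
      have h1 : ‖ex1 l u i‖ ≤ δ⁻¹ := by
        rw [le_inv_comm₀ hδ hpos] at hk
        exact hk
      refine le_trans ((pi_norm_le_iff_of_nonneg (norm_nonneg _)).2 fun b => ?_) h1
      rw [← ex1_of l u i b]
      exact norm_le_pi_norm (ex1 l u i) b
    · simp only
      rw [norm_smul, norm_inv, Complex.norm_real, norm_norm, inv_mul_cancel₀ hpos.ne']
    · intro a
      have := congrFun (congrFun hu i) a
      simp only [Ev, Pi.zero_apply] at this
      simp only [Pi.smul_apply, smul_eq_mul]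
      rw [← mul_zero (‖ex1 l u i‖⁻¹ : ℂ), ← this, Finset.mul_sum]
      exact Finset.sum_congr rfl fun b _ => by ring
  choose B hB0 hB using hi
  let S := ∑ i, B i
  have hS : 0 ≤ S := Finset.sum_nonneg fun i _ => hB0 i
  refine ⟨‖(e2 : (∀ i, {b // b ≠ l i} → ℂ) →L[ℝ] (Fin m2 → ℝ))‖ * S + 1, by positivity, fun x u hu => ?_⟩
  have h1 : ‖u‖ ≤ S := (pi_norm_le_iff_of_nonneg hS).2 fun i =>
    (hB i x u hu).trans (Finset.single_le_sum (fun i _ => hB0 i) (Finset.mem_univ i))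
  have h2 := (e2 : (∀ i, {b // b ≠ l i} → ℂ) →L[ℝ] (Fin m2 → ℝ)).le_opNorm u
  have h3 := mul_le_mul_of_nonneg_left h1
    (norm_nonneg (e2 : (∀ i, {b // b ≠ l i} → ℂ) →L[ℝ] (Fin m2 → ℝ)))
  have h4 : ‖e2 u‖ ≤ ‖(e2 : (∀ i, {b // b ≠ l i} → ℂ) →L[ℝ] (Fin m2 → ℝ))‖ * ‖u‖ := h2
  linarith

end Slice
end PiW
end

section
open Set Topology Filter MeasureTheory
open scoped unitInterval
set_option linter.unusedSectionVars false
namespace PiW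

section Main
variable {ι : Type*} [Fintype ι] {P Q R : ι → Type} [∀ i, Fintype (P i)] [∀ i, Fintype (Q i)]
  [∀ i, DecidableEq (Q i)] [∀ i, Fintype (R i)] (l : ∀ i, Q i)
  (eP : ∀ i, P i ≃ R i ⊕ {b // b ≠ l i})

theorem avoid_DInf (hq : ∀ i, 1 ≤ Fintype.card (Q i))
    (hpq : ∀ i, Fintype.card (Q i) ≤ Fintype.card (P i)) {n : ℕ} (hn : n + 1 = 2 * cc P Q)
    (G : (Fin (n+1+1) → I) → VV P Q) (hG : Continuous G) {C : Set (Fin (n+1+1) → I)}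
    (hC : IsClosed C) (hCZ : ∀ y ∈ C, G y ∉ DInf (P := P) l) :
    ∃ G' : (Fin (n+1+1) → I) → VV P Q, Continuous G' ∧ (∀ y ∈ C, G' y = G y) ∧
      ∀ y, G' y ∉ DInf (P := P) l := by
  by_cases h : 2 ≤ dE P Q
  · obtain ⟨d, hd⟩ := Nat.exists_eq_add_of_le' h
    refine general_position (isClosed_DInf l) (thin_DInf l hd) ?_ G hG hC hCZ
    rw [← dE_add hq hpq]
    omega
  · refine ⟨G, hG, fun _ _ => rfl, ?_⟩
    rintro y ⟨-, i, u, hu, hl, -⟩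
    have h1 : Fintype.card (Q i) ≤ 1 := by
      by_contra hc
      refine h (le_trans ?_ (Finset.single_le_sum (f := fun i =>
        2 * ((Fintype.card (P i) + 1) * (Fintype.card (Q i) - 1))) (fun _ _ => Nat.zero_le _)
        (Finset.mem_univ i)))
      have h2 : 1 ≤ Fintype.card (Q i) - 1 := by omega
      have : 1 ≤ (Fintype.card (P i) + 1) * (Fintype.card (Q i) - 1) :=
        Nat.mul_pos (Nat.succ_pos _) h2
      omega
    have := Fintype.card_le_one_iff_subsingleton.1 h1
    exact hu (funext fun b => by rw [Subsingleton.elim b (l i), hl]; rfl)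

variable {n m2 : ℕ} (e1 : (∀ i, R i → ℂ) ≃L[ℝ] (Fin (n+1) → ℝ))

/-- the slice as a continuous map of complements -/
noncomputable def sliceMap : C(({0}ᶜ : Set (Fin (n+1) → ℝ)), ((DD P Q)ᶜ : Set (VV P Q))) :=
  ⟨fun v => ⟨slice l eP (e1.symm v), slice_mem l eP fun h =>
    v.2 (by simpa using h)⟩,
    ((slice_continuous l eP).comp (e1.symm.continuous.comp continuous_subtype_val)).subtype_mk _⟩

theorem sliceMap_apply (v : ({0}ᶜ : Set (Fin (n+1) → ℝ))) :
    (sliceMap l eP e1 v : VV P Q) = slice l eP (e1.symm v) := rfl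

theorem not_null (e2 : (∀ i, {b // b ≠ l i} → ℂ) ≃L[ℝ] (Fin m2 → ℝ)) (hq : ∀ i, 1 ≤ Fintype.card (Q i))
    (hpq : ∀ i, Fintype.card (Q i) ≤ Fintype.card (P i)) (hn : n + 1 = 2 * cc P Q)
    {b : ({0}ᶜ : Set (Fin (n+1) → ℝ))} {f : GenLoop (Fin n) ({0}ᶜ : Set (Fin (n+1) → ℝ)) b}
    (hf : DegPos m2 f)
    (h : GenLoop.Homotopic (mapLoop (sliceMap l eP e1) rfl f) GenLoop.const) : False := by
  obtain ⟨H, hH, hH0, hH1, hHW, hHb⟩ := homotopic_family h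
  obtain ⟨F, hF, hF0, hFb, hFP⟩ := hf
  have hb0 : ∀ t, ((GenLoop.const : GenLoop (Fin n) ((DD P Q)ᶜ : Set (VV P Q))
    (sliceMap l eP e1 b)) t : VV P Q) = slice l eP (e1.symm b) := fun t => rfl
  let SF : (Fin (n+1) → I) → VV P Q := fun x => slice l eP (e1.symm (F x))
  have hSF : Continuous SF := (slice_continuous l eP).comp (e1.symm.continuous.comp hF)
  let HH : (Fin (n+1) → I) → VV P Q := fun x => H (x 0, Fin.tail x)
  have htl : Continuous fun x : Fin (n+1) → I => Fin.tail x := by unfold Fin.tail; fun_prop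
  have hHH : Continuous HH := hH.comp ((continuous_apply 0).prodMk htl)
  have hHHW : ∀ x, HH x ∈ (DD P Q)ᶜ := fun x => hHW _
  have hagree : ∀ x : Fin (n+1) → I, (∃ j, x j = 0 ∨ x j = 1) → SF x = HH x := by
    intro x hx
    by_cases h0 : x 0 = 0
    · simp only [SF, HH, h0, hH0, hF0 x h0]
      rfl
    · have hx' : x 0 = 1 ∨ ∃ j : Fin n, x j.succ = 0 ∨ x j.succ = 1 := by
        obtain ⟨j, hj⟩ := hx
        revert hj
        refine Fin.cases (fun hj => Or.inl (hj.resolve_left h0)) (fun j hj => Or.inr ⟨j, hj⟩) j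
      simp only [SF, HH, hFb x hx']
      rcases hx' with h1 | ⟨j, hj⟩
      · rw [h1, hH1, hb0]
      · rw [hHb _ _ ⟨j, hj⟩]
        rfl
  let G : (Fin (n+1+1) → I) → VV P Q := fun z =>
    (1 - (z 0 : ℝ)) • SF (Fin.tail z) + (z 0 : ℝ) • HH (Fin.tail z)
  have htl' : Continuous fun x : Fin (n+1+1) → I => Fin.tail x := by unfold Fin.tail; fun_prop
  have hz0 : Continuous fun z : Fin (n+1+1) → I => (z 0 : ℝ) :=
    continuous_subtype_val.comp (continuous_apply 0)
  have hG : Continuous G := ((continuous_const.sub hz0).smul (hSF.comp htl')).add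
    (hz0.smul (hHH.comp htl'))
  have hGb : ∀ (s : I) (x : Fin (n+1) → I), (∃ j, x j = 0 ∨ x j = 1) → G (Fin.cons s x) = HH x := by
    intro s x hx
    simp only [G, Fin.cons_zero, Fin.tail_cons, hagree x hx]
    rw [← add_smul]; simp
  have hG0 : ∀ x : Fin (n+1) → I, G (Fin.cons 0 x) = SF x := fun x => by simp [G]
  have hG1 : ∀ x : Fin (n+1) → I, G (Fin.cons 1 x) = HH x := fun x => by simp [G]
  have hDD : ∀ {A : VV P Q}, A ∈ (DD P Q)ᶜ → A ∉ DInf (P := P) l := fun hA h => hA h.1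
  obtain ⟨G', hG', hGG', hD⟩ := avoid_DInf l hq hpq hn G hG
    (C := {y | ∃ j, y j = 0 ∨ y j = 1}) isClosed_bdry (by
      rintro z ⟨j, hj⟩
      rw [← Fin.cons_self_tail z]
      revert hj
      refine Fin.cases ?_ (fun j => ?_) j
      · rintro (h0 | h0)
        · rw [h0, hG0]; exact slice_notMem l eP _
        · rw [h0, hG1]; exact hDD (hHHW _)
      · intro hj
        rw [hGb _ _ ⟨j, hj⟩]; exact hDD (hHHW _))
  have hG'b : ∀ (s : I) (x : Fin (n+1) → I), (∃ j, x j = 0 ∨ x j = 1) → G' (Fin.cons s x) = HH x := by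
    rintro s x ⟨j, hj⟩
    rw [hGG' _ ⟨j.succ, by simpa using hj⟩, hGb s x ⟨j, hj⟩]
  have hG'0 : ∀ x : Fin (n+1) → I, G' (Fin.cons 0 x) = SF x := fun x => by
    rw [hGG' _ ⟨0, by simp⟩, hG0]
  have hG'1 : ∀ x : Fin (n+1) → I, G' (Fin.cons 1 x) = HH x := fun x => by
    rw [hGG' _ ⟨0, by simp⟩, hG1]
  obtain ⟨ρ, hρ, hbd⟩ := bounded_zeros l e2 G' hG' hD
  let X : (Fin (n+1+m2) → I) → Fin (n+1) → I := fun y i => y (Fin.castAdd m2 i)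
  let U : (Fin (n+1+m2) → I) → Fin m2 → ℝ := fun y j => 2 * (y (Fin.natAdd (n+1) j) : ℝ) - 1
  have hX : Continuous X := continuous_pi fun i => continuous_apply _
  have hU : Continuous U := continuous_pi fun j =>
    (continuous_const.mul (continuous_subtype_val.comp (continuous_apply _))).sub continuous_const
  let Θ : I × (Fin (n+1+m2) → I) → Fin (n+1+m2) → ℝ := fun p =>
    TT l eP e1 e2 ρ (Ev l (G' (Fin.cons p.1 (X p.2))) (e2.symm (ρ • U p.2)))
  have hΘ : Continuous Θ := by
    refine (TT_continuous l eP e1 e2 ρ).comp ((Ev_continuous l).comp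
      (f := fun p : I × (Fin (n+1+m2) → I) =>
        (G' (Fin.cons p.1 (X p.2)), e2.symm (ρ • U p.2))) (Continuous.prodMk ?_ ?_))
    · exact hG'.comp (consI_continuous.comp (continuous_fst.prodMk (hX.comp continuous_snd)))
    · exact e2.symm.continuous.comp ((hU.comp continuous_snd).const_smul ρ)
  have hnz : ∀ (s : I) (y : Fin (n+1+m2) → I), G' (Fin.cons s (X y)) ∈ (DD P Q)ᶜ → Θ (s, y) ≠ 0 :=
    fun s y hy h0 => hy (Ev_mem l (TT_zero l eP e1 e2 hρ h0))
  have hΘb : ∀ s y, (∃ j, y j = 0 ∨ y j = 1) → Θ (s, y) ≠ 0 := by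
    rintro s y ⟨j, hj⟩
    revert hj
    refine Fin.addCases (fun i hj => ?_) (fun i hj => ?_) j
    · refine hnz s y ?_
      rw [hG'b s (X y) ⟨i, hj⟩]
      exact hHHW _
    · intro h0
      have h1 := hbd _ _ (TT_zero l eP e1 e2 hρ h0)
      rw [ContinuousLinearEquiv.apply_symm_apply, norm_smul, Real.norm_of_nonneg hρ.le] at h1
      have h2 : ‖U y i‖ ≤ ‖U y‖ := norm_le_pi_norm (U y) i
      have h3 : ‖U y i‖ = 1 := by
        simp only [U]
        rcases hj with h | h <;> rw [h] <;> norm_num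
      nlinarith
  have h0 : (fun y => Θ (0, y)) = stab m2 F := by
    funext y
    simp only [Θ, hG'0]
    exact TT_slice l eP e1 e2 hρ _ _
  have hpos := Pos_homotopy Θ hΘ hΘb (by rw [h0]; exact hFP)
  refine not_Pos (hΘ.comp (continuous_const.prodMk continuous_id)) (fun y => ?_) hpos
  refine hnz 1 y ?_
  rw [hG'1]
  exact hHHW _

end Main
end PiW
end

section
open Set Topology Filter MeasureTheory
open scoped unitInterval
set_option linter.unusedSectionVars false
namespace PiW

section Final

theorem infinite_somewhere {ι : Type*} [Fintype ι] {P Q : ι → Type} [∀ i, Fintype (P i)]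
    [∀ i, Fintype (Q i)] [∀ i, DecidableEq (Q i)] (hq : ∀ i, 1 ≤ Fintype.card (Q i))
    (hpq : ∀ i, Fintype.card (Q i) ≤ Fintype.card (P i)) {k : ℕ} (hk : k + 1 + 1 = 2 * cc P Q) :
    ∃ b : ((DD P Q)ᶜ : Set (VV P Q)),
      Infinite (HomotopyGroup (Fin (k + 1)) ((DD P Q)ᶜ : Set (VV P Q)) b) := by
  classical
  have hne : ∀ i, Nonempty (Q i) := fun i => Fintype.card_pos_iff.1 (hq i)
  let l : ∀ i, Q i := fun i => Classical.choice (hne i)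
  let R : ι → Type := fun i => Fin (Fintype.card (P i) - Fintype.card (Q i) + 1)
  have hcard : ∀ i, Fintype.card (P i) = Fintype.card (R i ⊕ {b // b ≠ l i}) := by
    intro i
    rw [Fintype.card_sum, Fintype.card_subtype_compl, Fintype.card_subtype_eq]
    simp only [R, Fintype.card_fin]
    have h1 := hq i
    have h2 := hpq i
    omega
  let eP : ∀ i, P i ≃ R i ⊕ {b // b ≠ l i} := fun i => Fintype.equivOfCardEq (hcard i)
  let m2 := Module.finrank ℝ (∀ i, {b // b ≠ l i} → ℂ)
  have h1 : Module.finrank ℝ (∀ i, R i → ℂ) = Module.finrank ℝ (Fin (k+1+1) → ℝ) := by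
    rw [Module.finrank_pi_fintype, Module.finrank_fin_fun, hk, cc, Finset.mul_sum]
    refine Finset.sum_congr rfl fun i _ => ?_
    rw [Module.finrank_pi_fintype]
    simp only [Complex.finrank_real_complex, Finset.sum_const, Finset.card_univ, smul_eq_mul, R,
      Fintype.card_fin]
    ring
  have h2 : Module.finrank ℝ (∀ i, {b // b ≠ l i} → ℂ) = Module.finrank ℝ (Fin m2 → ℝ) := by
    rw [Module.finrank_fin_fun]
  let e1 : (∀ i, R i → ℂ) ≃L[ℝ] (Fin (k+1+1) → ℝ) := ContinuousLinearEquiv.ofFinrankEq h1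
  let e2 : (∀ i, {b // b ≠ l i} → ℂ) ≃L[ℝ] (Fin m2 → ℝ) := ContinuousLinearEquiv.ofFinrankEq h2
  obtain ⟨b, f, hf⟩ := exists_DegPos (k+1) m2
  refine ⟨sliceMap l eP e1 b, ?_⟩
  by_contra hfin
  rw [not_infinite_iff_finite] at hfin
  have hg := isOfFinOrder_of_finite (mapHom (N := Fin (k+1)) (sliceMap l eP e1) rfl (cls f))
  obtain ⟨r, hr, hr1⟩ := isOfFinOrder_iff_pow_eq_one.1 hg
  obtain ⟨s, rfl⟩ := Nat.exists_eq_add_of_le' hr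
  obtain ⟨g, hg, hgr⟩ := DegPos_pow hf s
  rw [← map_pow, hgr, mapHom_cls, cls_one] at hr1
  exact not_null l eP e1 e2 hq hpq hk hg (cls_eq.1 hr1)

theorem rank_lt_iff {p q : ℕ} (A : Matrix (Fin p) (Fin q) ℂ) :
    A.rank < q ↔ ∃ u : Fin q → ℂ, u ≠ 0 ∧ ∀ a, ∑ b, A a b * u b = 0 := by
  have h := LinearMap.finrank_range_add_finrank_ker A.mulVecLin
  rw [Module.finrank_fin_fun] at h
  have h' : A.rank + Module.finrank ℂ (LinearMap.ker A.mulVecLin) = q := h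
  have hk : (∃ u : Fin q → ℂ, u ≠ 0 ∧ ∀ a, ∑ b, A a b * u b = 0) ↔ LinearMap.ker A.mulVecLin ≠ ⊥ := by
    rw [Submodule.ne_bot_iff]
    constructor
    · rintro ⟨u, hu, h⟩
      exact ⟨u, LinearMap.mem_ker.2 (funext h), hu⟩
    · rintro ⟨u, h, hu⟩
      exact ⟨u, hu, fun a => congrFun (LinearMap.mem_ker.1 h) a⟩
  rw [hk, ne_eq, ← Submodule.finrank_eq_zero]
  omega

end Final
end PiW
end

/-- Let `ι` be a nonempty finite index set and, for each `i`, let `p i ≥ q i ≥ 1`.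
Let `W` be the complement, in the product `M = ∏ i, M_{p i, q i}` of the spaces of
`p i × q i` complex matrices, of the product `D = ∏ i, D_{p i, q i}` of the sets of
matrices of rank less than `q i`. Set `c = ∑ i, (p i − q i + 1)`. Then the homotopy
group `π_{2c−1}` of `W` (based at any point) is isomorphic to the infinite cyclic
group `ℤ`. (The index is written as `k + 1` with `k + 1 = 2c − 1`.) -/
theorem complement_of_product_of_degenerate_matrices_first_homotopy_group
    {ι : Type*} [Fintype ι] [Nonempty ι] (p q : ι → ℕ)
    (hq : ∀ i, 1 ≤ q i) (hpq : ∀ i, q i ≤ p i)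
    (k : ℕ) (hk : k + 1 = 2 * (∑ i, (p i - q i + 1)) - 1)
    (x : {A : ∀ i, Matrix (Fin (p i)) (Fin (q i)) ℂ // ¬ ∀ i, (A i).rank < q i}) :
    Nonempty (HomotopyGroup (Fin (k + 1))
      {A : ∀ i, Matrix (Fin (p i)) (Fin (q i)) ℂ // ¬ ∀ i, (A i).rank < q i} x
      ≃* Multiplicative ℤ) := by
  let P : ι → Type := fun i => Fin (p i)
  let Q : ι → Type := fun i => Fin (q i)
  have hq' : ∀ i, 1 ≤ Fintype.card (Q i) := fun i => by simpa [Q] using hq i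
  have hpq' : ∀ i, Fintype.card (Q i) ≤ Fintype.card (P i) := fun i => by simpa [P, Q] using hpq i
  have hk' : k + 1 + 1 = 2 * PiW.cc P Q := by
    simp only [PiW.cc, P, Q, Fintype.card_fin]
    omega
  have hmem : ∀ A : ∀ i, Matrix (Fin (p i)) (Fin (q i)) ℂ,
      (¬ ∀ i, (A i).rank < q i) ↔ (A : PiW.VV P Q) ∈ (PiW.DD P Q)ᶜ := fun A => by
    simp only [PiW.rank_lt_iff]
    rfl
  let φ : {A : ∀ i, Matrix (Fin (p i)) (Fin (q i)) ℂ // ¬ ∀ i, (A i).rank < q i} ≃ₜ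
      ((PiW.DD P Q)ᶜ : Set (PiW.VV P Q)) :=
    { toFun := fun y => ⟨y.1, (hmem y.1).1 y.2⟩
      invFun := fun y => ⟨y.1, (hmem y.1).2 y.2⟩
      left_inv := fun y => rfl
      right_inv := fun y => rfl
      continuous_toFun := continuous_subtype_val.subtype_mk _
      continuous_invFun := continuous_subtype_val.subtype_mk _ }
  obtain ⟨b1, hb1⟩ := PiW.cyclic_all (ι := ι) k _ P Q inferInstance inferInstance hq' hpq' hk' rfl
  obtain ⟨b2, hb2⟩ := PiW.infinite_somewhere (P := P) (Q := Q) hq' hpq' hk'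
  obtain ⟨ψ1, h1⟩ := PiW.homog hpq' b1 (φ x)
  obtain ⟨ψ2, h2⟩ := PiW.homog hpq' b2 (φ x)
  have hcyc : IsCyclic (HomotopyGroup (Fin (k + 1)) ((PiW.DD P Q)ᶜ : Set (PiW.VV P Q)) (φ x)) :=
    isCyclic_of_surjective (PiW.homeoEquiv (N := Fin (k+1)) ψ1 h1)
      (PiW.homeoEquiv (N := Fin (k+1)) ψ1 h1).surjective
  have hinf : Infinite (HomotopyGroup (Fin (k + 1)) ((PiW.DD P Q)ᶜ : Set (PiW.VV P Q)) (φ x)) :=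
    Infinite.of_injective _ (PiW.homeoEquiv (N := Fin (k+1)) ψ2 h2).injective
  exact ⟨(PiW.homeoEquiv (N := Fin (k+1)) φ rfl).trans (intCyclicMulEquiv).symm⟩
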